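/- Suppose ω ⊂ 𝕋² is open and satisfies the geometric control condition, fix c > 0, and let ω′ be an open subset of ω with closure contained in ω that also satisfies the geometric control condition. If T > 0 is large enough (with respect to c), there exists a smooth triple (f̄, Ē, b̄) on [0,T], solving the 2D relativistic Vlasov–Maxwell system (with speed of light c) with some smooth source Ḡ(t,x,v) whose spatial support is contained in ω, such that: (i) f̄, Ē, b̄ vanish identically at t = 0 and at t = T; (ii) for every t ∈ [0,T] and v ∈ ℝ², the function x ↦ f̄(t,x,v) is compactly supported in ω; (iii) the relativistic characteristics (X,V) associated with the force field Ē + (1/c) v̂⊥ b̄ satisfy: for every (x,v) ∈ 𝕋²×ℝ² there exists t ∈ [T/9, 8T/9] with X(t,0,x,v) ∈ ω′ and |V(t,0,x,v)| ≥ 4. -/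

import Mathlib

noncomputable section

open MeasureTheory Real

/-- Points of the plane; the torus `𝕋²` is represented via `ℤ²`-periodic objects on `ℝ²`. -/
abbrev V2 := ℝ × ℝ

/-- `v ↦ v⊥ = (v₂, -v₁)`. -/
def pperp (v : V2) : V2 := (v.2, -v.1)

/-- Euclidean norm on `ℝ²`. -/
noncomputable def en (v : V2) : ℝ := Real.sqrt (v.1 ^ 2 + v.2 ^ 2)

/-- Relativistic velocity `v̂ = v/√(1+|v|²/c²)` for speed of light `c`. -/
noncomputable def vhat (c : ℝ) (v : V2) : V2 :=
  (1 / Real.sqrt (1 + (v.1 ^ 2 + v.2 ^ 2) / c ^ 2)) • v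

/-- `ℤ²`-periodicity of a function on `ℝ²` (i.e. the function lives on the torus `𝕋²`). -/
def Zper {α : Type*} (g : V2 → α) : Prop :=
  ∀ (x : V2) (m n : ℤ), g (x.1 + (m : ℝ), x.2 + (n : ℝ)) = g x

/-- A fundamental domain for the torus. -/
def unitSq : Set V2 := Set.Icc ((0 : ℝ), (0 : ℝ)) ((1 : ℝ), (1 : ℝ))

/-- Integral over the torus of a (periodic) function. -/
noncomputable def intT2 (g : V2 → ℝ) : ℝ := ∫ x in unitSq, g x

/-- Integral over `𝕋² × ℝ²`. -/
noncomputable def intT2R2 (g : V2 → V2 → ℝ) : ℝ := ∫ x in unitSq, ∫ v : V2, g x v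

/-- Spatial divergence of a vector field on `ℝ²`. -/
noncomputable def divF (E : V2 → V2) (x : V2) : ℝ :=
  fderiv ℝ (fun y => (E y).1) x ((1 : ℝ), (0 : ℝ)) +
    fderiv ℝ (fun y => (E y).2) x ((0 : ℝ), (1 : ℝ))

/-- Geometric control condition for a (periodic) set `ω ⊆ 𝕋²`. -/
def GCC (ω : Set V2) : Prop :=
  ∀ x e : V2, en e = 1 → ∃ y : ℝ, 0 ≤ y ∧ x + y • e ∈ ω

/-- Open ball of the torus, of center `x₀` and radius `r` (as a periodic subset of `ℝ²`). -/
def ballT2 (x₀ : V2) (r : ℝ) : Set V2 :=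
  {x : V2 | ∃ m n : ℤ, en (x.1 - (x₀.1 + (m : ℝ)), x.2 - (x₀.2 + (n : ℝ))) < r}

/-- The full preimage in `ℝ²` of the image in `𝕋²` of the line through `p` directed by `d`. -/
def periodizedLine (p d : V2) : Set V2 :=
  {x : V2 | ∃ (t : ℝ) (m n : ℤ), x = p + t • d + ((m : ℝ), (n : ℝ))}

/-- The strip assumption: `ω` contains the image of a straight line of `ℝ²`
which is closed in the torus. -/
def StripAssumption (ω : Set V2) : Prop :=
  ∃ p d : V2, d ≠ 0 ∧ IsClosed (periodizedLine p d) ∧ periodizedLine p d ⊆ ω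

/-- All iterated derivatives of order at most `k` are bounded by `κ` in sup norm. -/
def DerivBound {E F : Type*} [NormedAddCommGroup E] [NormedSpace ℝ E]
    [NormedAddCommGroup F] [NormedSpace ℝ F] (k : ℕ) (κ : ℝ) (g : E → F) : Prop :=
  ∀ i : ℕ, i ≤ k → ∀ p, ‖iteratedFDeriv ℝ i g p‖ ≤ κ

/-- Relativistic characteristics for the force field `Force`, with speed of light `c`,
starting from `(x,v)` at time `s`. -/
def IsRelChar (c : ℝ) (Force : ℝ → V2 → V2 → V2) (s : ℝ) (x v : V2)
    (X V : ℝ → V2) : Prop :=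
  X s = x ∧ V s = v ∧
    ∀ t : ℝ, HasDerivAt X (vhat c (V t)) t ∧ HasDerivAt V (Force t (X t) (V t)) t

/-- `(F, E, b)` is a classical, `𝕋²`-periodic solution on `[0,T]` of the 2D relativistic
Vlasov–Maxwell system with speed of light `c` and source `S`. -/
def IsVMSolution (c T : ℝ) (F : ℝ × V2 × V2 → ℝ) (E : ℝ × V2 → V2)
    (b : ℝ × V2 → ℝ) (S : ℝ × V2 × V2 → ℝ) : Prop :=
  ContDiff ℝ 1 F ∧ ContDiff ℝ 1 E ∧ ContDiff ℝ 1 b ∧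
  (∀ t v, Zper fun x => F (t, x, v)) ∧ (∀ t, Zper fun x => E (t, x)) ∧
  (∀ t, Zper fun x => b (t, x)) ∧
  ∀ t ∈ Set.Icc (0 : ℝ) T, ∀ x v : V2,
    -- Vlasov equation: ∂ₜf + v̂·∇ₓf + (E + c⁻¹ v̂⊥ b)·∇ᵥf = S
    (fderiv ℝ F (t, x, v)
        ((1 : ℝ), vhat c v, E (t, x) + (c⁻¹ * b (t, x)) • pperp (vhat c v))
      = S (t, x, v)) ∧
    -- ∂ₜE₁ − c ∂_{x₂} b = −∫ f v̂₁ dv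
    (fderiv ℝ (fun p => (E p).1) (t, x) ((1 : ℝ), ((0 : ℝ), (0 : ℝ)))
        - c * fderiv ℝ b (t, x) ((0 : ℝ), ((0 : ℝ), (1 : ℝ)))
      = -∫ w : V2, F (t, x, w) * (vhat c w).1) ∧
    -- ∂ₜE₂ + c ∂_{x₁} b = −∫ f v̂₂ dv
    (fderiv ℝ (fun p => (E p).2) (t, x) ((1 : ℝ), ((0 : ℝ), (0 : ℝ)))
        + c * fderiv ℝ b (t, x) ((0 : ℝ), ((1 : ℝ), (0 : ℝ)))
      = -∫ w : V2, F (t, x, w) * (vhat c w).2) ∧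
    -- ∂ₜb + c (∂_{x₁}E₂ − ∂_{x₂}E₁) = 0
    (fderiv ℝ b (t, x) ((1 : ℝ), ((0 : ℝ), (0 : ℝ)))
        + c * (fderiv ℝ (fun p => (E p).2) (t, x) ((0 : ℝ), ((1 : ℝ), (0 : ℝ)))
            - fderiv ℝ (fun p => (E p).1) (t, x) ((0 : ℝ), ((0 : ℝ), (1 : ℝ)))) = 0) ∧
    -- Gauss law: ∂_{x₁}E₁ + ∂_{x₂}E₂ = ∫ f dv − ∫∫ f dv dx
    (fderiv ℝ (fun p => (E p).1) (t, x) ((0 : ℝ), ((1 : ℝ), (0 : ℝ)))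
        + fderiv ℝ (fun p => (E p).2) (t, x) ((0 : ℝ), ((0 : ℝ), (1 : ℝ)))
      = (∫ w : V2, F (t, x, w)) - intT2R2 fun y w => F (t, y, w))

/-! ### Directional derivatives -/

section DirDeriv

variable {E : Type*} [NormedAddCommGroup E] [NormedSpace ℝ E]
  {F : Type*} [NormedAddCommGroup F] [NormedSpace ℝ F]

/-- Derivative of `u` in the direction `w`. -/
def dd (w : E) (u : E → F) : E → F := fun p => fderiv ℝ u p w

lemma ContDiff.dd_top {u : E → F} (hu : ContDiff ℝ (⊤ : ℕ∞) u) (w : E) :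
    ContDiff ℝ (⊤ : ℕ∞) (dd w u) := by
  have h : ContDiff ℝ (⊤ : ℕ∞) (fderiv ℝ u) := hu.fderiv_right (by simp)
  exact h.clm_apply contDiff_const

lemma ContDiff.differentiable_top {u : E → F} (hu : ContDiff ℝ (⊤ : ℕ∞) u) :
    Differentiable ℝ u := hu.differentiable (by simp)

lemma dd_add {u v : E → F} (hu : Differentiable ℝ u) (hv : Differentiable ℝ v) (w : E) :
    dd w (fun p => u p + v p) = fun p => dd w u p + dd w v p := by
  funext p
  simp only [dd]
  rw [fderiv_fun_add (hu p) (hv p)]; rfl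

lemma dd_sub {u v : E → F} (hu : Differentiable ℝ u) (hv : Differentiable ℝ v) (w : E) :
    dd w (fun p => u p - v p) = fun p => dd w u p - dd w v p := by
  funext p
  simp only [dd]
  rw [fderiv_fun_sub (hu p) (hv p)]; rfl

lemma dd_neg (u : E → F) (w : E) :
    dd w (fun p => - u p) = fun p => - dd w u p := by
  funext p
  simp only [dd]
  rw [fderiv_fun_neg]; rfl

lemma dd_const_mul {A : Type*} [NormedCommRing A] [NormedAlgebra ℝ A] {u : E → A}
    (hu : Differentiable ℝ u) (a : A) (w : E) :
    dd w (fun p => a * u p) = fun p => a * dd w u p := by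
  funext p
  simp only [dd]
  rw [fderiv_const_mul (hu p)]; rfl

lemma dd_mul {A : Type*} [NormedCommRing A] [NormedAlgebra ℝ A] {u v : E → A}
    (hu : Differentiable ℝ u) (hv : Differentiable ℝ v) (w : E) :
    dd w (fun p => u p * v p) = fun p => dd w u p * v p + u p * dd w v p := by
  funext p
  simp only [dd]
  rw [fderiv_fun_mul (hu p) (hv p)]
  simp; ring

lemma dd_comm {u : E → F} (hu : ContDiff ℝ (⊤ : ℕ∞) u) (w w' : E) :
    dd w (dd w' u) = dd w' (dd w u) := by
  funext p
  have hs : IsSymmSndFDerivAt ℝ u p :=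
    hu.contDiffAt.isSymmSndFDerivAt (by
      simp only [minSmoothness_of_isRCLikeNormedField]
      exact WithTop.coe_le_coe.2 le_top)
  have hd : Differentiable ℝ (fderiv ℝ u) :=
    (hu.fderiv_right (m := (⊤ : ℕ∞)) (by simp)).differentiable (by simp)
  have key : ∀ a b : E, dd a (dd b u) p = fderiv ℝ (fderiv ℝ u) p a b := by
    intro a b
    have : HasFDerivAt (dd b u) ((fderiv ℝ (fderiv ℝ u) p).flip b) p := by
      have := (hd p).hasFDerivAt.clm_apply (hasFDerivAt_const b p)
      change HasFDerivAt (fun y => fderiv ℝ u y b) _ p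
      simpa using this
    simp only [dd] at this ⊢
    rw [this.fderiv]; rfl
  rw [key, key, hs.eq]

lemma dd_comp_add {u : E → F} (w a : E) :
    dd w (fun p => u (p + a)) = fun p => dd w u (p + a) := by
  funext p
  simp only [dd]
  rw [fderiv_comp_add_right]

lemma dd_hasDerivAt {u : E → F} (hu : Differentiable ℝ u) {γ : ℝ → E} {γ' : E} {t : ℝ}
    (h : HasDerivAt γ γ' t) : HasDerivAt (fun s => u (γ s)) (dd γ' u (γ t)) t :=
  (hu (γ t)).hasFDerivAt.comp_hasDerivAt t h

lemma dd_eq_zero_of_eventually {u : E → F} {p : E} (w : E)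
    (h : ∀ᶠ q in nhds p, u q = 0) : dd w u p = 0 := by
  have : u =ᶠ[nhds p] fun _ => 0 := h
  simp only [dd]
  rw [this.fderiv_eq]; simp

lemma dd_lin {u : E → F} (a b : E) (s t : ℝ) (p : E) :
    dd (s • a + t • b) u p = s • dd a u p + t • dd b u p := by
  simp [dd]

end DirDeriv

/-- Time direction in space-time. -/
def dT : ℝ × V2 := ((1 : ℝ), ((0 : ℝ), (0 : ℝ)))
/-- First space direction in space-time. -/
def dX : ℝ × V2 := ((0 : ℝ), ((1 : ℝ), (0 : ℝ)))
/-- Second space direction in space-time. -/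
def dY : ℝ × V2 := ((0 : ℝ), ((0 : ℝ), (1 : ℝ)))

/-- Functions of a parameter (such as time) and space which are `ℤ²`-periodic in space. -/
def SPer {E α : Type*} (u : E × V2 → α) : Prop := ∀ t, Zper fun x => u (t, x)

lemma SPer.dd {E F : Type*} [NormedAddCommGroup E] [NormedSpace ℝ E] [NormedAddCommGroup F]
    [NormedSpace ℝ F] {u : E × V2 → F} (hu : SPer u) (w : E × V2) : SPer (dd w u) := by
  intro t x m n
  have h : (fun p : E × V2 => u (p + ((0 : E), ((m : ℝ), (n : ℝ))))) = u := by
    funext p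
    have := hu p.1 p.2 m n
    simpa [Prod.add_def] using this
  have h2 := congrFun (dd_comp_add (u := u) w ((0 : E), ((m : ℝ), (n : ℝ)))) (t, x)
  rw [h] at h2
  simpa [Prod.add_def] using h2.symm

/-- Smooth periodic electromagnetic fields satisfying Faraday's law, whose charge and current
densities are supported (in space) in the set `K`. -/
structure Adm (c : ℝ) (K : Set V2) (e₁ e₂ b : ℝ × V2 → ℝ) : Prop where
  s1 : ContDiff ℝ (⊤ : ℕ∞) e₁
  s2 : ContDiff ℝ (⊤ : ℕ∞) e₂
  s3 : ContDiff ℝ (⊤ : ℕ∞) b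
  p1 : SPer e₁
  p2 : SPer e₂
  p3 : SPer b
  far : ∀ p, dd dT b p + c * (dd dX e₂ p - dd dY e₁ p) = 0
  gauss : ∀ p : ℝ × V2, p.2 ∉ K → dd dX e₁ p + dd dY e₂ p = 0
  amp1 : ∀ p : ℝ × V2, p.2 ∉ K → dd dT e₁ p - c * dd dY b p = 0
  amp2 : ∀ p : ℝ × V2, p.2 ∉ K → dd dT e₂ p + c * dd dX b p = 0

lemma Adm.add {c : ℝ} {K : Set V2} {e₁ e₂ b e₁' e₂' b' : ℝ × V2 → ℝ} (h : Adm c K e₁ e₂ b)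
    (h' : Adm c K e₁' e₂' b') :
    Adm c K (fun p => e₁ p + e₁' p) (fun p => e₂ p + e₂' p) (fun p => b p + b' p) where
  s1 := h.s1.add h'.s1
  s2 := h.s2.add h'.s2
  s3 := h.s3.add h'.s3
  p1 := fun t x m n => by have := h.p1 t x m n; have := h'.p1 t x m n; simp_all
  p2 := fun t x m n => by have := h.p2 t x m n; have := h'.p2 t x m n; simp_all
  p3 := fun t x m n => by have := h.p3 t x m n; have := h'.p3 t x m n; simp_all
  far := fun p => by
    simp only [dd_add h.s1.differentiable_top h'.s1.differentiable_top,
      dd_add h.s2.differentiable_top h'.s2.differentiable_top,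
      dd_add h.s3.differentiable_top h'.s3.differentiable_top]
    linear_combination h.far p + h'.far p
  gauss := fun p hp => by
    simp only [dd_add h.s1.differentiable_top h'.s1.differentiable_top,
      dd_add h.s2.differentiable_top h'.s2.differentiable_top]
    linear_combination h.gauss p hp + h'.gauss p hp
  amp1 := fun p hp => by
    simp only [dd_add h.s1.differentiable_top h'.s1.differentiable_top,
      dd_add h.s3.differentiable_top h'.s3.differentiable_top]
    linear_combination h.amp1 p hp + h'.amp1 p hp
  amp2 := fun p hp => by
    simp only [dd_add h.s2.differentiable_top h'.s2.differentiable_top,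
      dd_add h.s3.differentiable_top h'.s3.differentiable_top]
    linear_combination h.amp2 p hp + h'.amp2 p hp

lemma Adm.const_mul {c : ℝ} {K : Set V2} {e₁ e₂ b : ℝ × V2 → ℝ} (h : Adm c K e₁ e₂ b)
    (a : ℝ) :
    Adm c K (fun p => a * e₁ p) (fun p => a * e₂ p) (fun p => a * b p) where
  s1 := contDiff_const.mul h.s1
  s2 := contDiff_const.mul h.s2
  s3 := contDiff_const.mul h.s3
  p1 := fun t x m n => by have := h.p1 t x m n; simp_all
  p2 := fun t x m n => by have := h.p2 t x m n; simp_all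
  p3 := fun t x m n => by have := h.p3 t x m n; simp_all
  far := fun p => by
    simp only [dd_const_mul h.s1.differentiable_top, dd_const_mul h.s2.differentiable_top,
      dd_const_mul h.s3.differentiable_top]
    linear_combination a * h.far p
  gauss := fun p hp => by
    simp only [dd_const_mul h.s1.differentiable_top, dd_const_mul h.s2.differentiable_top]
    linear_combination a * h.gauss p hp
  amp1 := fun p hp => by
    simp only [dd_const_mul h.s1.differentiable_top, dd_const_mul h.s3.differentiable_top]
    linear_combination a * h.amp1 p hp
  amp2 := fun p hp => by
    simp only [dd_const_mul h.s2.differentiable_top, dd_const_mul h.s3.differentiable_top]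
    linear_combination a * h.amp2 p hp

/-- Time shift of a space-time function. -/
def tsh (τ : ℝ) (u : ℝ × V2 → ℝ) : ℝ × V2 → ℝ := fun p => u (p + (-τ, 0))

lemma tsh_apply (τ : ℝ) (u : ℝ × V2 → ℝ) (t : ℝ) (x : V2) : tsh τ u (t, x) = u (t - τ, x) := by
  simp [tsh, sub_eq_add_neg]

lemma dd_tsh (τ : ℝ) (u : ℝ × V2 → ℝ) (w : ℝ × V2) : dd w (tsh τ u) = tsh τ (dd w u) :=
  dd_comp_add w _

lemma Adm.shift {c : ℝ} {K : Set V2} {e₁ e₂ b : ℝ × V2 → ℝ} (h : Adm c K e₁ e₂ b) (τ : ℝ) :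
    Adm c K (tsh τ e₁) (tsh τ e₂) (tsh τ b) where
  s1 := h.s1.comp (contDiff_id.add contDiff_const)
  s2 := h.s2.comp (contDiff_id.add contDiff_const)
  s3 := h.s3.comp (contDiff_id.add contDiff_const)
  p1 := fun t x m n => by simpa [tsh_apply] using h.p1 (t - τ) x m n
  p2 := fun t x m n => by simpa [tsh_apply] using h.p2 (t - τ) x m n
  p3 := fun t x m n => by simpa [tsh_apply] using h.p3 (t - τ) x m n
  far := fun p => by
    simp only [dd_tsh, tsh]
    exact h.far _
  gauss := fun p hp => by
    simp only [dd_tsh, tsh]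
    exact h.gauss _ (by simpa using hp)
  amp1 := fun p hp => by
    simp only [dd_tsh, tsh]
    exact h.amp1 _ (by simpa using hp)
  amp2 := fun p hp => by
    simp only [dd_tsh, tsh]
    exact h.amp2 _ (by simpa using hp)

/-! ### Velocity profiles and assembly of the Vlasov–Maxwell solution -/

lemma gamma_pos (c : ℝ) (v : V2) : 0 < 1 + (v.1 ^ 2 + v.2 ^ 2) / c ^ 2 := by positivity

lemma vhat_contDiff (c : ℝ) : ContDiff ℝ (⊤ : ℕ∞) (vhat c) := by
  unfold vhat
  have h : ContDiff ℝ (⊤ : ℕ∞) fun v : V2 => 1 + (v.1 ^ 2 + v.2 ^ 2) / c ^ 2 := by fun_prop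
  have h2 : ContDiff ℝ (⊤ : ℕ∞) fun v : V2 => 1 / √(1 + (v.1 ^ 2 + v.2 ^ 2) / c ^ 2) :=
    contDiff_const.div (h.sqrt fun v => (gamma_pos c v).ne')
      fun v => (Real.sqrt_pos.2 (gamma_pos c v)).ne'
  exact h2.smul contDiff_id

lemma vhat_neg (c : ℝ) (v : V2) : vhat c (-v) = - vhat c v := by
  simp [vhat]

/-- A fixed smooth even compactly supported bump on the plane. -/
def bump2 (v : V2) : ℝ :=
  (⟨1, 2, by norm_num, by norm_num⟩ : ContDiffBump (0 : ℝ)) v.1 *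
    (⟨1, 2, by norm_num, by norm_num⟩ : ContDiffBump (0 : ℝ)) v.2

lemma bump2_contDiff : ContDiff ℝ (⊤ : ℕ∞) bump2 :=
  ((ContDiffBump.contDiff _).comp contDiff_fst).mul ((ContDiffBump.contDiff _).comp contDiff_snd)

lemma bump2_compact : HasCompactSupport bump2 := by
  refine HasCompactSupport.intro (K := Set.Icc (-2) 2 ×ˢ Set.Icc (-2) 2)
    (isCompact_Icc.prod isCompact_Icc) fun x hx => ?_
  have : ∀ y : ℝ, y ∉ Set.Icc (-2 : ℝ) 2 →
      (⟨1, 2, by norm_num, by norm_num⟩ : ContDiffBump (0 : ℝ)) y = 0 := by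
    intro y hy
    apply ContDiffBump.zero_of_le_dist
    simp only [dist_zero_right, Real.norm_eq_abs]
    by_contra hcon
    push Not at hcon
    exact hy ⟨(abs_le.1 hcon.le).1, (abs_le.1 hcon.le).2⟩
  rw [Set.mem_prod, not_and_or] at hx
  rcases hx with hx | hx
  · simp [bump2, this _ hx]
  · simp [bump2, this _ hx]

lemma bump2_neg (v : V2) : bump2 (-v) = bump2 v := by
  simp [bump2, ContDiffBump.neg]

lemma bump2_flip (v : V2) : bump2 (v.1, -v.2) = bump2 v := by
  simp [bump2, ContDiffBump.neg]

lemma bump2_nonneg (v : V2) : 0 ≤ bump2 v :=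
  mul_nonneg (ContDiffBump.nonneg' _ _) (ContDiffBump.nonneg' _ _)

lemma bump2_pos {v : V2} (h1 : |v.1| < 2) (h2 : |v.2| < 2) : 0 < bump2 v :=
  mul_pos (ContDiffBump.pos_of_mem_ball _ (by simpa using h1))
    (ContDiffBump.pos_of_mem_ball _ (by simpa using h2))

lemma integral_eq_zero_of_odd {f : V2 → ℝ} (h : ∀ v, f (-v) = - f v) : ∫ v, f v = 0 := by
  have h1 := integral_neg_eq_self f (volume : Measure V2)
  simp only [h, integral_neg] at h1
  linarith

lemma integral_eq_zero_of_flip {f : V2 → ℝ} (h : ∀ v : V2, f (v.1, -v.2) = - f v) :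
    ∫ v, f v = 0 := by
  have hmp : MeasurePreserving (fun v : V2 => (v.1, -v.2)) volume volume :=
    (MeasurePreserving.id (volume : Measure ℝ)).prod (Measure.measurePreserving_neg volume)
  have hemb : MeasurableEmbedding (fun v : V2 => (v.1, -v.2)) :=
    ((Homeomorph.refl ℝ).prodCongr (Homeomorph.neg ℝ)).measurableEmbedding
  have h1 := hmp.integral_comp hemb f
  simp only [h, integral_neg] at h1
  linarith

lemma integral_pos_of_pos_at {f : V2 → ℝ} (hf : Continuous f) (hc : HasCompactSupport f)
    (h0 : ∀ v, 0 ≤ f v) {v : V2} (hv : 0 < f v) : 0 < ∫ v, f v :=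
  hf.integral_pos_of_hasCompactSupport_nonneg_nonzero hc h0 hv.ne'

lemma exists_profiles (c : ℝ) : ∃ β₀ β₁ β₂ : V2 → ℝ,
    (ContDiff ℝ (⊤ : ℕ∞) β₀ ∧ ContDiff ℝ (⊤ : ℕ∞) β₁ ∧ ContDiff ℝ (⊤ : ℕ∞) β₂) ∧
    (HasCompactSupport β₀ ∧ HasCompactSupport β₁ ∧ HasCompactSupport β₂) ∧
    ((∫ v, β₀ v = 1) ∧ (∫ v, β₁ v = 0) ∧ (∫ v, β₂ v = 0)) ∧
    ((∫ v, β₀ v * (vhat c v).1 = 0) ∧ (∫ v, β₁ v * (vhat c v).1 = 1) ∧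
      (∫ v, β₂ v * (vhat c v).1 = 0)) ∧
    ((∫ v, β₀ v * (vhat c v).2 = 0) ∧ (∫ v, β₁ v * (vhat c v).2 = 0) ∧
      (∫ v, β₂ v * (vhat c v).2 = 1)) := by
  have hb := bump2_contDiff
  have hbc := bump2_compact
  have hv := vhat_contDiff c
  have hcont := hb.continuous
  have hvc := hv.continuous
  have hflip1 : ∀ v : V2, (vhat c (v.1, -v.2)).1 = (vhat c v).1 := by intro v; simp [vhat]
  have hflip2 : ∀ v : V2, (vhat c (v.1, -v.2)).2 = -(vhat c v).2 := by intro v; simp [vhat]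
  set I₀ := ∫ v, bump2 v with hI₀
  have hI₀p : 0 < I₀ := integral_pos_of_pos_at hcont hbc bump2_nonneg
    (v := 0) (bump2_pos (by simp) (by simp))
  have hsgn : ∀ v : V2, 0 < 1 / √(1 + (v.1 ^ 2 + v.2 ^ 2) / c ^ 2) := fun v =>
    one_div_pos.2 (Real.sqrt_pos.2 (gamma_pos c v))
  set I₁ := ∫ v, bump2 v * v.1 * (vhat c v).1 with hI₁
  set I₂ := ∫ v, bump2 v * v.2 * (vhat c v).2 with hI₂
  have hI₁p : 0 < I₁ := by
    refine integral_pos_of_pos_at ((hcont.mul continuous_fst).mul (continuous_fst.comp hvc))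
      ((hbc.mul_right).mul_right) (fun v => ?_) (v := (1, 1)) ?_
    · have := bump2_nonneg v
      have h1 := (hsgn v).le
      simp only [vhat, Prod.smul_fst, smul_eq_mul]
      have : 0 ≤ v.1 * v.1 := mul_self_nonneg _
      calc 0 ≤ bump2 v * (1 / √(1 + (v.1 ^ 2 + v.2 ^ 2) / c ^ 2) * (v.1 * v.1)) := by positivity
        _ = _ := by ring
    · have := hsgn (1, 1)
      simp only [vhat, Prod.smul_fst, smul_eq_mul]
      have := bump2_pos (v := (1, 1)) (by norm_num) (by norm_num)
      simp only [mul_one]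
      positivity
  have hI₂p : 0 < I₂ := by
    refine integral_pos_of_pos_at ((hcont.mul continuous_snd).mul (continuous_snd.comp hvc))
      ((hbc.mul_right).mul_right) (fun v => ?_) (v := (1, 1)) ?_
    · have := bump2_nonneg v
      have h1 := (hsgn v).le
      simp only [vhat, Prod.smul_snd, smul_eq_mul]
      have : 0 ≤ v.2 * v.2 := mul_self_nonneg _
      calc 0 ≤ bump2 v * (1 / √(1 + (v.1 ^ 2 + v.2 ^ 2) / c ^ 2) * (v.2 * v.2)) := by positivity
        _ = _ := by ring
    · have := hsgn (1, 1)
      simp only [vhat, Prod.smul_snd, smul_eq_mul]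
      have := bump2_pos (v := (1, 1)) (by norm_num) (by norm_num)
      simp only [mul_one]
      positivity
  refine ⟨fun v => I₀⁻¹ * bump2 v, fun v => I₁⁻¹ * (bump2 v * v.1), fun v => I₂⁻¹ * (bump2 v * v.2),
    ⟨contDiff_const.mul hb, contDiff_const.mul (hb.mul contDiff_fst),
      contDiff_const.mul (hb.mul contDiff_snd)⟩,
    ⟨hbc.mul_left, hbc.mul_right.mul_left, hbc.mul_right.mul_left⟩, ⟨?_, ?_, ?_⟩, ⟨?_, ?_, ?_⟩,
    ⟨?_, ?_, ?_⟩⟩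
  · rw [integral_const_mul, ← hI₀, inv_mul_cancel₀ hI₀p.ne']
  · exact integral_eq_zero_of_odd fun v => by simp [bump2_neg]
  · exact integral_eq_zero_of_odd fun v => by simp [bump2_neg]
  · exact integral_eq_zero_of_odd fun v => by simp [bump2_neg, vhat_neg]
  · simp only [mul_assoc]; rw [integral_const_mul]
    simp only [← mul_assoc]
    rw [← hI₁, inv_mul_cancel₀ hI₁p.ne']
  · exact integral_eq_zero_of_flip fun v => by simp [bump2_flip, hflip1]
  · exact integral_eq_zero_of_odd fun v => by simp [bump2_neg, vhat_neg]
  · exact integral_eq_zero_of_flip fun v => by simp [bump2_flip, hflip2]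
  · simp only [mul_assoc]; rw [integral_const_mul]
    simp only [← mul_assoc]
    rw [← hI₂, inv_mul_cancel₀ hI₂p.ne']

lemma intT2_div_eq_zero {F : Type*} [NormedAddCommGroup F] [NormedSpace ℝ F] {f g : V2 → F}
    (hf : ContDiff ℝ (⊤ : ℕ∞) f) (hg : ContDiff ℝ (⊤ : ℕ∞) g)
    (pf : Zper f) (pg : Zper g) :
    ∫ x in unitSq, (dd ((1 : ℝ), (0 : ℝ)) f x + dd ((0 : ℝ), (1 : ℝ)) g x) = 0 := by
  have h := integral_divergence_prod_Icc_of_hasFDerivAt_of_le f g (fderiv ℝ f) (fderiv ℝ g)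
    (0, 0) (1, 1) (by simp [Prod.le_def]) hf.continuous.continuousOn hg.continuous.continuousOn
    (fun x _ => (hf.differentiable_top x).hasFDerivAt)
    (fun x _ => (hg.differentiable_top x).hasFDerivAt)
    (((hf.dd_top _).continuous.add (hg.dd_top _).continuous).continuousOn.integrableOn_compact
      isCompact_Icc)
  have h1 : ∀ x : ℝ, g (x, 1) = g (x, 0) := fun x => by simpa using pg (x, 0) 0 1
  have h2 : ∀ y : ℝ, f (1, y) = f (0, y) := fun y => by simpa using pf (0, y) 1 0
  simp only [h1, h2] at h
  simpa [unitSq, dd] using h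

lemma dd_slice {E F : Type*} [NormedAddCommGroup E] [NormedSpace ℝ E] [NormedAddCommGroup F]
    [NormedSpace ℝ F] {u : E × V2 → F} (hu : Differentiable ℝ u) (t : E) (w x : V2) :
    dd w (fun y => u (t, y)) x = dd ((0 : E), w) u (t, x) := by
  have h : HasFDerivAt (fun y : V2 => ((t, y) : E × V2)) (ContinuousLinearMap.inr ℝ E V2) x :=
    hasFDerivAt_prodMk_right t x
  have := (hu (t, x)).hasFDerivAt.comp x h
  have h3 : fderiv ℝ (fun y => u (t, y)) x = _ := this.fderiv
  simp only [dd]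
  rw [h3]; simp

theorem assembly {c : ℝ} {K : Set V2} (hK : IsClosed K) {e₁ e₂ b : ℝ × V2 → ℝ}
    (h : Adm c K e₁ e₂ b) :
    ∃ F G : ℝ × V2 × V2 → ℝ, ContDiff ℝ (⊤ : ℕ∞) F ∧ ContDiff ℝ (⊤ : ℕ∞) G ∧
      (∀ t x v, x ∉ K → F (t, x, v) = 0) ∧ (∀ t x v, x ∉ K → G (t, x, v) = 0) ∧
      (∀ T, IsVMSolution c T F (fun p => (e₁ p, e₂ p)) b G) ∧
      (∀ t, (∀ᶠ s in nhds t, ∀ x, e₁ (s, x) = 0 ∧ e₂ (s, x) = 0 ∧ b (s, x) = 0) →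
        ∀ x v, F (t, x, v) = 0) := by
  obtain ⟨β₀, β₁, β₂, ⟨sm0, sm1, sm2⟩, ⟨cs0, cs1, cs2⟩, ⟨m00, m01, m02⟩, ⟨m10, m11, m12⟩,
    ⟨m20, m21, m22⟩⟩ := exists_profiles c
  set ρ : ℝ × V2 → ℝ := fun p => dd dX e₁ p + dd dY e₂ p with hρ
  set j₁ : ℝ × V2 → ℝ := fun p => -(dd dT e₁ p - c * dd dY b p) with hj₁
  set j₂ : ℝ × V2 → ℝ := fun p => -(dd dT e₂ p + c * dd dX b p) with hj₂
  have sρ : ContDiff ℝ (⊤ : ℕ∞) ρ := (h.s1.dd_top _).add (h.s2.dd_top _)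
  have sj₁ : ContDiff ℝ (⊤ : ℕ∞) j₁ :=
    ((h.s1.dd_top _).sub (contDiff_const.mul (h.s3.dd_top _))).neg
  have sj₂ : ContDiff ℝ (⊤ : ℕ∞) j₂ :=
    ((h.s2.dd_top _).add (contDiff_const.mul (h.s3.dd_top _))).neg
  have pρ : SPer ρ := fun t x m n => by
    have h1 := h.p1.dd dX t x m n; have h2 := h.p2.dd dY t x m n
    simp only [hρ] at h1 h2 ⊢; rw [h1, h2]
  have pj₁ : SPer j₁ := fun t x m n => by
    have h1 := h.p1.dd dT t x m n; have h2 := h.p3.dd dY t x m n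
    simp only [hj₁] at h1 h2 ⊢; rw [h1, h2]
  have pj₂ : SPer j₂ := fun t x m n => by
    have h1 := h.p2.dd dT t x m n; have h2 := h.p3.dd dX t x m n
    simp only [hj₂] at h1 h2 ⊢; rw [h1, h2]
  have zρ : ∀ p : ℝ × V2, p.2 ∉ K → ρ p = 0 := fun p hp => h.gauss p hp
  have zj₁ : ∀ p : ℝ × V2, p.2 ∉ K → j₁ p = 0 := fun p hp => by
    simp only [hj₁]; rw [h.amp1 p hp, neg_zero]
  have zj₂ : ∀ p : ℝ × V2, p.2 ∉ K → j₂ p = 0 := fun p hp => by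
    simp only [hj₂]; rw [h.amp2 p hp, neg_zero]
  set F : ℝ × V2 × V2 → ℝ := fun q => ρ (q.1, q.2.1) * β₀ q.2.2 + j₁ (q.1, q.2.1) * β₁ q.2.2
    + j₂ (q.1, q.2.1) * β₂ q.2.2 with hF
  have hpr : ContDiff ℝ (⊤ : ℕ∞) fun q : ℝ × V2 × V2 => ((q.1, q.2.1) : ℝ × V2) := by fun_prop
  have hpv : ContDiff ℝ (⊤ : ℕ∞) fun q : ℝ × V2 × V2 => q.2.2 := by fun_prop
  have sF : ContDiff ℝ (⊤ : ℕ∞) F :=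
    (((sρ.comp hpr).mul (sm0.comp hpv)).add ((sj₁.comp hpr).mul (sm1.comp hpv))).add
      ((sj₂.comp hpr).mul (sm2.comp hpv))
  have zF : ∀ t x v, x ∉ K → F (t, x, v) = 0 := fun t x v hx => by
    simp only [hF]; rw [zρ _ hx, zj₁ _ hx, zj₂ _ hx]; simp
  have hvh := vhat_contDiff c
  set G : ℝ × V2 × V2 → ℝ := fun q => fderiv ℝ F q ((1 : ℝ), vhat c q.2.2,
    (e₁ (q.1, q.2.1), e₂ (q.1, q.2.1)) + (c⁻¹ * b (q.1, q.2.1)) • pperp (vhat c q.2.2)) with hG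
  have sG : ContDiff ℝ (⊤ : ℕ∞) G := by
    have h1 : ContDiff ℝ (⊤ : ℕ∞) (fderiv ℝ F) := sF.fderiv_right (by simp)
    refine h1.clm_apply (contDiff_const.prodMk ((hvh.comp hpv).prodMk ?_))
    refine ((h.s1.comp hpr).prodMk (h.s2.comp hpr)).add
      ((contDiff_const.mul (h.s3.comp hpr)).smul ?_)
    exact ((contDiff_snd.comp (hvh.comp hpv)).prodMk (contDiff_fst.comp (hvh.comp hpv)).neg)
  have zG : ∀ t x v, x ∉ K → G (t, x, v) = 0 := fun t x v hx => by
    have hev : ∀ᶠ q : ℝ × V2 × V2 in nhds (t, x, v), F q = 0 := by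
      have ho : IsOpen {q : ℝ × V2 × V2 | q.2.1 ∉ K} :=
        hK.isOpen_compl.preimage (by fun_prop : Continuous fun q : ℝ × V2 × V2 => q.2.1)
      filter_upwards [ho.mem_nhds (show (t, x, v) ∈ _ from hx)] with q hq
      exact zF q.1 q.2.1 q.2.2 hq
    exact dd_eq_zero_of_eventually _ hev
  have hint : ∀ {β : V2 → ℝ} (w : V2 → ℝ), ContDiff ℝ (⊤ : ℕ∞) β → HasCompactSupport β →
      Continuous w → Integrable fun v => β v * w v := fun w hs hcs hw =>
    (hs.continuous.mul hw).integrable_of_hasCompactSupport hcs.mul_right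
  have mom : ∀ (w : V2 → ℝ), Continuous w → ∀ t x, ∫ v, F (t, x, v) * w v =
      ρ (t, x) * (∫ v, β₀ v * w v) + j₁ (t, x) * (∫ v, β₁ v * w v)
        + j₂ (t, x) * ∫ v, β₂ v * w v := by
    intro w hw t x
    have e : ∀ v, F (t, x, v) * w v = ρ (t, x) * (β₀ v * w v) + j₁ (t, x) * (β₁ v * w v)
        + j₂ (t, x) * (β₂ v * w v) := fun v => by simp only [hF]; ring
    simp only [e]
    have i0 := (hint w sm0 cs0 hw).const_mul (ρ (t, x))
    have i1 := (hint w sm1 cs1 hw).const_mul (j₁ (t, x))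
    have i2 := (hint w sm2 cs2 hw).const_mul (j₂ (t, x))
    rw [integral_add (f := fun v => ρ (t, x) * (β₀ v * w v) + j₁ (t, x) * (β₁ v * w v)) (i0.add i1) i2,
      integral_add i0 i1]
    simp only [integral_const_mul]
  have mom0 : ∀ t x, ∫ v, F (t, x, v) = ρ (t, x) := fun t x => by
    have := mom (fun _ => 1) continuous_const t x
    simp only [mul_one] at this
    rw [this, m00, m01, m02]; ring
  have mom1 : ∀ t x, ∫ v, F (t, x, v) * (vhat c v).1 = j₁ (t, x) := fun t x => by
    rw [mom (fun v => (vhat c v).1) (continuous_fst.comp hvh.continuous) t x]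
    rw [m10, m11, m12]; ring
  have mom2 : ∀ t x, ∫ v, F (t, x, v) * (vhat c v).2 = j₂ (t, x) := fun t x => by
    rw [mom (fun v => (vhat c v).2) (continuous_snd.comp hvh.continuous) t x]
    rw [m20, m21, m22]; ring
  have htot : ∀ t, intT2R2 (fun y w => F (t, y, w)) = 0 := fun t => by
    simp only [intT2R2, mom0, hρ]
    have hin : ContDiff ℝ (⊤ : ℕ∞) fun y : V2 => ((t, y) : ℝ × V2) := by fun_prop
    have := intT2_div_eq_zero (h.s1.comp hin) (h.s2.comp hin) (h.p1 t) (h.p2 t)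
    simp only [Function.comp_def, dd_slice h.s1.differentiable_top,
      dd_slice h.s2.differentiable_top] at this
    exact this
  refine ⟨F, G, sF, sG, zF, zG, fun T => ⟨sF.of_le (by exact_mod_cast le_top),
    (h.s1.prodMk h.s2).of_le (by exact_mod_cast le_top), h.s3.of_le (by exact_mod_cast le_top),
    ?_, ?_, h.p3, ?_⟩, ?_⟩
  · intro t v x m n
    have h1 := pρ t x m n; have h2 := pj₁ t x m n; have h3 := pj₂ t x m n
    simp only [hF] at h1 h2 h3 ⊢
    rw [h1, h2, h3]
  · intro t x m n
    have h1 := h.p1 t x m n; have h2 := h.p2 t x m n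
    simp only at h1 h2 ⊢
    rw [h1, h2]
  · intro t _ x v
    refine ⟨rfl, ?_, ?_, h.far (t, x), ?_⟩
    · rw [mom1]; simp only [hj₁, neg_neg]; rfl
    · rw [mom2]; simp only [hj₂, neg_neg]; rfl
    · rw [mom0, htot, sub_zero]; rfl
  · intro t ht x v
    have ev : ∀ᶠ p in nhds ((t, x) : ℝ × V2), e₁ p = 0 ∧ e₂ p = 0 ∧ b p = 0 := by
      have := (continuous_fst.tendsto ((t, x) : ℝ × V2)).eventually ht
      filter_upwards [this] with p hp using hp p.2
    have d1 : ∀ w, dd w e₁ (t, x) = 0 := fun w =>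
      dd_eq_zero_of_eventually w (ev.mono fun p hp => hp.1)
    have d2 : ∀ w, dd w e₂ (t, x) = 0 := fun w =>
      dd_eq_zero_of_eventually w (ev.mono fun p hp => hp.2.1)
    have d3 : ∀ w, dd w b (t, x) = 0 := fun w =>
      dd_eq_zero_of_eventually w (ev.mono fun p hp => hp.2.2)
    simp [hF, hρ, hj₁, hj₂, d1, d2, d3]

/-! ### Geometry of the control region -/

/-- Points of `ω` at (sup-norm) distance at least `ρ` from the complement. -/
def core (ω : Set V2) (ρ : ℝ) : Set V2 := {x | ∀ y, y ∉ ω → ρ ≤ dist x y}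

lemma core_closed (ω : Set V2) (ρ : ℝ) : IsClosed (core ω ρ) := by
  have : core ω ρ = ⋂ y ∈ ωᶜ, {x | ρ ≤ dist x y} := by ext; simp [core]
  rw [this]
  exact isClosed_biInter fun y _ => isClosed_le continuous_const (by fun_prop)

lemma core_subset {ω : Set V2} {ρ : ℝ} (h : 0 < ρ) : core ω ρ ⊆ ω := by
  intro x hx
  by_contra hn
  have := hx x hn
  simp at this; linarith

lemma core_move {ω : Set V2} {ρ ρ' : ℝ} {x y : V2} (hx : x ∈ core ω ρ) (h : ρ' + dist x y ≤ ρ) :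
    y ∈ core ω ρ' := fun z hz => by
  have := hx z hz
  have := dist_triangle x y z
  linarith

lemma core_anti {ω : Set V2} {ρ ρ' : ℝ} (h : ρ' ≤ ρ) : core ω ρ ⊆ core ω ρ' := fun _ hx =>
  core_move hx (by simpa using h)

lemma core_per {ω : Set V2} (hω : Zper fun x => x ∈ ω) (ρ : ℝ) : Zper fun x => x ∈ core ω ρ := by
  have key : ∀ (x : V2) (m n : ℤ), x ∈ core ω ρ → (x.1 + (m : ℝ), x.2 + (n : ℝ)) ∈ core ω ρ := by
    intro x m n hx y hy
    have h1 := hω y (-m) (-n)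
    have h2 := hx (y.1 + ((-m : ℤ) : ℝ), y.2 + ((-n : ℤ) : ℝ)) (by
      simp only at h1; rwa [h1])
    simp only [Prod.dist_eq, Real.dist_eq] at h2 ⊢
    push_cast at h2
    convert h2 using 3 <;> ring_nf
  intro x m n
  refine propext ⟨fun h => ?_, key x m n⟩
  have := key _ (-m) (-n) h
  simpa using this

/-- Reduction of a point of the plane modulo `ℤ²`. -/
lemma exists_unitSq_rep (x : V2) : ∃ y ∈ unitSq, ∃ m n : ℤ, x = (y.1 + (m : ℝ), y.2 + (n : ℝ)) := by
  refine ⟨(Int.fract x.1, Int.fract x.2), ?_, ⌊x.1⌋, ⌊x.2⌋, ?_⟩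
  · simp only [unitSq, Set.mem_Icc, Prod.le_def]
    exact ⟨⟨Int.fract_nonneg _, Int.fract_nonneg _⟩, (Int.fract_lt_one _).le, (Int.fract_lt_one _).le⟩
  · simp

lemma unitSq_compact : IsCompact unitSq := isCompact_Icc

lemma en_continuous : Continuous en := by unfold en; fun_prop

lemma abs_le_en (v : V2) : |v.1| ≤ en v ∧ |v.2| ≤ en v := by
  unfold en
  constructor
  · exact Real.abs_le_sqrt (by nlinarith [sq_nonneg v.2])
  · exact Real.abs_le_sqrt (by nlinarith [sq_nonneg v.1])

lemma norm_le_en (v : V2) : ‖v‖ ≤ en v := by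
  rw [Prod.norm_def]
  exact max_le (abs_le_en v).1 (abs_le_en v).2

lemma circle_compact : IsCompact {e : V2 | en e = 1} := by
  refine Metric.isCompact_of_isClosed_isBounded (isClosed_eq en_continuous continuous_const) ?_
  refine (Metric.isBounded_closedBall (x := (0 : V2)) (r := 1)).subset fun e he => ?_
  simp only [Metric.mem_closedBall, dist_zero_right]
  exact (norm_le_en e).trans (le_of_eq he)

lemma GCC_uniform {ω : Set V2} (ho : IsOpen ω) (hp : Zper fun x => x ∈ ω) (hG : GCC ω) :
    ∃ r > (0 : ℝ), ∃ L > (0 : ℝ), ∀ x e : V2, en e = 1 →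
      ∃ s, 0 ≤ s ∧ s ≤ L ∧ x + s • e ∈ core ω (3 * r) := by
  set U : ℕ → Set (V2 × V2) := fun n =>
    {p | ∃ s : ℝ, 0 ≤ s ∧ s ≤ n ∧ ∃ ε, 1 / ((n : ℝ) + 1) < ε ∧ p.1 + s • p.2 ∈ core ω ε} with hU
  have hUo : ∀ n, IsOpen (U n) := by
    intro n
    rw [Metric.isOpen_iff]
    rintro ⟨x, e⟩ ⟨s, hs0, hsn, ε, hε, hx⟩
    set d := (ε - 1 / ((n : ℝ) + 1)) / 2 with hd
    have hdp : 0 < d := by simp only [hd]; linarith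
    have hs1 : 0 < 1 + s := by linarith
    refine ⟨d / (1 + s), by positivity, ?_⟩
    rintro ⟨y, f⟩ hyf
    refine ⟨s, hs0, hsn, ε - d, by simp only [hd]; linarith, core_move hx ?_⟩
    simp only [Metric.mem_ball, Prod.dist_eq (x := (y, f)), max_lt_iff] at hyf
    have h1 : dist (x + s • e) (y + s • f) ≤ dist x y + s * dist e f := by
      refine (dist_add_add_le _ _ _ _).trans ?_
      rw [dist_smul₀, Real.norm_eq_abs, abs_of_nonneg hs0]
    rw [dist_comm y, dist_comm f] at hyf
    have h2 : dist x y + s * dist e f ≤ d / (1 + s) + s * (d / (1 + s)) := by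
      have := hyf.1; have := hyf.2; gcongr
    have h3 : d / (1 + s) + s * (d / (1 + s)) = d := by field_simp
    change ε - d + dist (x + s • e) (y + s • f) ≤ ε
    linarith
  have hmono : Monotone U := by
    intro a b hab p
    rintro ⟨s, h0, h1, ε, h2, h3⟩
    have hab' : (a : ℝ) ≤ b := by exact_mod_cast hab
    refine ⟨s, h0, h1.trans hab', ε, lt_of_le_of_lt ?_ h2, h3⟩
    gcongr
  have hcov : unitSq ×ˢ {e : V2 | en e = 1} ⊆ ⋃ n, U n := by
    rintro ⟨x, e⟩ ⟨-, he⟩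
    obtain ⟨s, hs0, hs⟩ := hG x e he
    obtain ⟨ε, hε, hb⟩ := Metric.isOpen_iff.1 ho _ hs
    obtain ⟨n, hn⟩ := exists_nat_gt (max s (1 / ε))
    refine Set.mem_iUnion.2 ⟨n, s, hs0, ((le_max_left _ _).trans hn.le), ε, ?_, ?_⟩
    · have h1 : 1 / ε < (n : ℝ) + 1 := ((le_max_right _ _).trans_lt hn).trans (by linarith)
      rw [div_lt_iff₀ hε] at h1
      rw [div_lt_iff₀ (by positivity)]
      linarith
    · intro y hy
      by_contra hlt
      push Not at hlt
      exact hy (hb (by rw [Metric.mem_ball, dist_comm]; exact hlt))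
  obtain ⟨n, hn⟩ := (unitSq_compact.prod circle_compact).elim_directed_cover U hUo hcov
    hmono.directed_le
  refine ⟨1 / ((n : ℝ) + 1) / 3, by positivity, n + 1, by positivity, fun x e he => ?_⟩
  obtain ⟨y, hy, k, l, hxy⟩ := exists_unitSq_rep x
  obtain ⟨s, h0, h1, ε, h2, h3⟩ := hn (show (y, e) ∈ _ from ⟨hy, he⟩)
  refine ⟨s, h0, by linarith, ?_⟩
  have h4 : y + s • e ∈ core ω (3 * (1 / ((n : ℝ) + 1) / 3)) := core_anti (by linarith) h3
  have h5 := core_per hp (3 * (1 / ((n : ℝ) + 1) / 3)) (y + s • e) k l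
  have h6 : x + s • e = ((y + s • e).1 + (k : ℝ), (y + s • e).2 + (l : ℝ)) := by
    rw [hxy]; ext <;> simp <;> ring
  rw [h6]
  simp only at h5
  rw [h5]; exact h4

/-- A smooth periodic bump function around `y + ℤ²`. -/
def pbump (y : V2) (ρ : ℝ) (x : V2) : ℝ :=
  expNegInvGlue (ρ ^ 2 - (Real.sin (π * (x.1 - y.1)) ^ 2 + Real.sin (π * (x.2 - y.2)) ^ 2))

lemma pbump_contDiff (y : V2) (ρ : ℝ) : ContDiff ℝ (⊤ : ℕ∞) (pbump y ρ) := by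
  unfold pbump
  exact expNegInvGlue.contDiff.comp (by fun_prop)

lemma sin_sq_per (a : ℝ) (m : ℤ) : Real.sin (π * (a + m)) ^ 2 = Real.sin (π * a) ^ 2 := by
  have : π * (a + m) = π * a + m * π := by ring
  rw [this, Real.sin_add_int_mul_pi, mul_pow]
  have : (((-1 : ℝ) ^ m) ^ 2) = 1 := by
    rw [← zpow_natCast, ← zpow_mul, mul_comm, zpow_mul]; norm_num
  rw [this, one_mul]

lemma pbump_per (y : V2) (ρ : ℝ) : Zper (pbump y ρ) := by
  intro x m n
  have h1 : x.1 + (m : ℝ) - y.1 = (x.1 - y.1) + m := by ring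
  have h2 : x.2 + (n : ℝ) - y.2 = (x.2 - y.2) + n := by ring
  simp only [pbump, h1, h2, sin_sq_per]

lemma pbump_nonneg (y : V2) (ρ : ℝ) (x : V2) : 0 ≤ pbump y ρ x := expNegInvGlue.nonneg _

lemma pbump_pos_self (y : V2) {ρ : ℝ} (h : 0 < ρ) : 0 < pbump y ρ y := by
  unfold pbump
  apply expNegInvGlue.pos_of_pos
  simp; positivity

lemma abs_sub_round_le_sin (u : ℝ) : 2 * |u - round u| ≤ |Real.sin (π * u)| := by
  have h0 : |Real.sin (π * u)| = |Real.sin (π * (u - round u))| := by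
    have := sin_sq_per (u - round u) (round u)
    rw [sub_add_cancel] at this
    exact (sq_eq_sq_iff_abs_eq_abs _ _).1 this
  rw [h0]
  set w := u - round u with hw
  have hw2 : |w| ≤ 1 / 2 := abs_sub_round u
  have h1 : |Real.sin (π * w)| = Real.sin (π * |w|) := by
    have h2 : |π * w| = π * |w| := by rw [abs_mul, abs_of_pos pi_pos]
    rw [← h2]
    exact Real.abs_sin_eq_sin_abs_of_abs_le_pi (by rw [h2]; nlinarith [pi_pos])
  rw [h1]
  have := Real.mul_le_sin (x := π * |w|) (by positivity) (by nlinarith [pi_pos])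
  calc 2 * |w| = 2 / π * (π * |w|) := by field_simp
    _ ≤ _ := this

lemma pbump_ne_zero {y : V2} {ρ : ℝ} (hρ : 0 < ρ) {x : V2} (h : pbump y ρ x ≠ 0) :
    ∃ m n : ℤ, dist x (y.1 + (m : ℝ), y.2 + (n : ℝ)) < ρ / 2 := by
  have hpos : 0 < ρ ^ 2 - (Real.sin (π * (x.1 - y.1)) ^ 2 + Real.sin (π * (x.2 - y.2)) ^ 2) := by
    by_contra hn
    exact h (expNegInvGlue.zero_of_nonpos (not_lt.1 hn))
  have key : ∀ a : ℝ, Real.sin (π * a) ^ 2 < ρ ^ 2 → |a - round a| < ρ / 2 := by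
    intro a ha
    have h1 := abs_lt_of_sq_lt_sq ha hρ.le
    have h2 := abs_sub_round_le_sin a
    linarith
  refine ⟨round (x.1 - y.1), round (x.2 - y.2), ?_⟩
  simp only [Prod.dist_eq, Real.dist_eq, max_lt_iff, ← sub_sub]
  exact ⟨key _ (by nlinarith [sq_nonneg (Real.sin (π * (x.2 - y.2)))]),
    key _ (by nlinarith [sq_nonneg (Real.sin (π * (x.1 - y.1)))])⟩

lemma exists_cutoff {ω : Set V2} (hp : Zper fun x => x ∈ ω) {r : ℝ} (hr : 0 < r) :
    ∃ χ : V2 → ℝ, ContDiff ℝ (⊤ : ℕ∞) χ ∧ Zper χ ∧ (∀ x, 0 ≤ χ x) ∧ (∀ x ∈ core ω r, 1 ≤ χ x) ∧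
      ∀ x, x ∉ core ω (r / 2) → χ x = 0 := by
  have hcomp : IsCompact (core ω r ∩ unitSq) := unitSq_compact.inter_left (core_closed ω r)
  obtain ⟨t, ht, hcov⟩ := hcomp.elim_nhds_subcover (fun y => {x | 0 < pbump y r x}) (fun y _ =>
    (isOpen_lt continuous_const (pbump_contDiff y r).continuous).mem_nhds (pbump_pos_self y hr))
  set g : V2 → ℝ := fun x => ∑ y ∈ t, pbump y r x with hg
  have gs : ContDiff ℝ (⊤ : ℕ∞) g := ContDiff.sum fun y _ => pbump_contDiff y r
  have gper : Zper g := fun x m n => Finset.sum_congr rfl fun y _ => pbump_per y r x m n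
  have g0 : ∀ x, 0 ≤ g x := fun x => Finset.sum_nonneg fun y _ => pbump_nonneg y r x
  have gpos : ∀ x ∈ core ω r ∩ unitSq, 0 < g x := by
    intro x hx
    obtain ⟨y, hy, hxy⟩ := Set.mem_iUnion₂.1 (hcov hx)
    exact Finset.sum_pos' (fun y _ => pbump_nonneg y r x) ⟨y, hy, hxy⟩
  have gz : ∀ x, x ∉ core ω (r / 2) → g x = 0 := by
    intro x hx
    refine Finset.sum_eq_zero fun y hy => ?_
    by_contra hne
    obtain ⟨m, n, hd⟩ := pbump_ne_zero hr hne
    have h1 : (y.1 + (m : ℝ), y.2 + (n : ℝ)) ∈ core ω r := by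
      have := core_per hp r y m n
      simp only at this
      rw [this]; exact (ht y hy).1
    exact hx (core_move h1 (by rw [dist_comm]; linarith))
  obtain ⟨m, hm, hmle⟩ : ∃ m > 0, ∀ x ∈ core ω r ∩ unitSq, m ≤ g x := by
    rcases (core ω r ∩ unitSq).eq_empty_or_nonempty with he | hne
    · exact ⟨1, one_pos, fun x hx => by rw [he] at hx; exact hx.elim⟩
    · obtain ⟨x₀, hx₀, hmin⟩ := hcomp.exists_isMinOn hne gs.continuous.continuousOn
      exact ⟨g x₀, gpos x₀ hx₀, fun x hx => hmin hx⟩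
  refine ⟨fun x => m⁻¹ * g x, contDiff_const.mul gs, fun x a b => ?_, fun x => ?_, fun x hx => ?_,
    fun x hx => ?_⟩
  · simp only; rw [gper x a b]
  · exact mul_nonneg (inv_nonneg.2 hm.le) (g0 x)
  · obtain ⟨y, hy, a, b, rfl⟩ := exists_unitSq_rep x
    have h1 := core_per hp r y a b
    simp only at h1
    rw [h1] at hx
    have h2 := hmle y ⟨hx, hy⟩
    simp only
    rw [gper y a b]
    rw [← div_eq_inv_mul, le_div_iff₀ hm]; linarith
  · simp only; rw [gz x hx, mul_zero]

/-! ### Elementary bounds for relativistic velocities -/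

lemma en_eq_norm (v : V2) : en v = ‖(⟨v.1, v.2⟩ : ℂ)‖ := by
  rw [en, Complex.norm_eq_sqrt_sq_add_sq]

lemma en_nonneg (v : V2) : 0 ≤ en v := Real.sqrt_nonneg _

lemma en_sq (v : V2) : en v ^ 2 = v.1 ^ 2 + v.2 ^ 2 := Real.sq_sqrt (by positivity)

lemma en_le_two_norm (v : V2) : en v ≤ 2 * ‖v‖ := by
  have h1 : |v.1| ≤ ‖v‖ := norm_fst_le v
  have h2 : |v.2| ≤ ‖v‖ := norm_snd_le v
  refine Real.sqrt_le_iff.2 ⟨by positivity, ?_⟩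
  have := sq_abs v.1; have := sq_abs v.2
  nlinarith [abs_nonneg v.1, abs_nonneg v.2]

lemma en_smul (a : ℝ) (v : V2) : en (a • v) = |a| * en v := by
  rw [en, en, ← Real.sqrt_sq_eq_abs, ← Real.sqrt_mul (sq_nonneg a)]
  congr 1; simp; ring

lemma en_sub_le (u v : V2) : |en u - en v| ≤ en (u - v) := by
  simp only [en_eq_norm]
  exact abs_norm_sub_norm_le (⟨u.1, u.2⟩ : ℂ) ⟨v.1, v.2⟩

lemma en_add_le (u v : V2) : en (u + v) ≤ en u + en v := by
  simp only [en_eq_norm]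
  exact norm_add_le (⟨u.1, u.2⟩ : ℂ) ⟨v.1, v.2⟩

/-- The Lorentz factor. -/
def lor (c : ℝ) (v : V2) : ℝ := √(1 + (v.1 ^ 2 + v.2 ^ 2) / c ^ 2)

lemma vhat_eq (c : ℝ) (v : V2) : vhat c v = (1 / lor c v) • v := rfl

lemma lor_sq (c : ℝ) (v : V2) : lor c v ^ 2 = 1 + en v ^ 2 / c ^ 2 := by
  rw [lor, Real.sq_sqrt (gamma_pos c v).le, en_sq]

lemma one_le_lor (c : ℝ) (v : V2) : 1 ≤ lor c v := by
  rw [lor]; apply Real.one_le_sqrt.2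
  have : 0 ≤ (v.1 ^ 2 + v.2 ^ 2) / c ^ 2 := by positivity
  linarith

lemma en_le_lor {c : ℝ} (hc : 0 < c) (v : V2) : en v ≤ c * lor c v := by
  have h1 := lor_sq c v
  have h2 := one_le_lor c v
  apply le_of_sq_le_sq _ (by positivity)
  rw [mul_pow, h1]; field_simp; nlinarith
  
lemma en_vhat (c : ℝ) (v : V2) : en (vhat c v) = en v / lor c v := by
  have := one_le_lor c v
  rw [vhat_eq, en_smul, abs_of_nonneg (by positivity)]; ring

lemma en_vhat_le {c : ℝ} (hc : 0 < c) (v : V2) : en (vhat c v) ≤ c := by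
  have := one_le_lor c v
  rw [en_vhat, div_le_iff₀ (by linarith)]; exact en_le_lor hc v

lemma norm_vhat_le_c {c : ℝ} (hc : 0 < c) (v : V2) : ‖vhat c v‖ ≤ c :=
  (norm_le_en _).trans (en_vhat_le hc v)

lemma norm_vhat_le (c : ℝ) (v : V2) : ‖vhat c v‖ ≤ ‖v‖ := by
  have h := one_le_lor c v
  rw [vhat_eq, norm_smul, Real.norm_of_nonneg (by positivity)]
  have : 1 / lor c v ≤ 1 := by rw [div_le_one (by linarith)]; exact h
  nlinarith [norm_nonneg v]

lemma norm_pperp (v : V2) : ‖pperp v‖ = ‖v‖ := by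
  simp [pperp, Prod.norm_def, max_comm]

lemma lor_sub_le {c : ℝ} (hc : 0 < c) (u v : V2) : |lor c u - lor c v| ≤ en (u - v) / c := by
  have h1 := lor_sq c u
  have h2 := lor_sq c v
  have hu := one_le_lor c u
  have hv := one_le_lor c v
  have h3 : (lor c u - lor c v) * (lor c u + lor c v) = (en u - en v) * (en u + en v) / c ^ 2 := by
    have : (lor c u - lor c v) * (lor c u + lor c v) = lor c u ^ 2 - lor c v ^ 2 := by ring
    rw [this, h1, h2]; ring
  have h4 : en u + en v ≤ c * (lor c u + lor c v) := by
    have := en_le_lor hc u; have := en_le_lor hc v; linarith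
  have hs : 0 < lor c u + lor c v := by linarith
  have h5 : |lor c u - lor c v| * (lor c u + lor c v) = |en u - en v| * (en u + en v) / c ^ 2 := by
    have := congrArg abs h3
    rw [abs_mul, abs_of_pos hs, abs_div, abs_mul, abs_of_nonneg (add_nonneg (en_nonneg u)
      (en_nonneg v)), abs_of_pos (by positivity : (0 : ℝ) < c ^ 2)] at this
    exact this
  have h6 : |lor c u - lor c v| * (lor c u + lor c v) ≤ (en (u - v) / c) * (lor c u + lor c v) := by
    rw [h5, div_le_iff₀ (by positivity)]
    calc |en u - en v| * (en u + en v) ≤ en (u - v) * (c * (lor c u + lor c v)) :=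
          mul_le_mul (en_sub_le u v) h4 (add_nonneg (en_nonneg u) (en_nonneg v)) (en_nonneg _)
      _ = _ := by field_simp
  exact le_of_mul_le_mul_right h6 hs

lemma vhat_sub_le {c : ℝ} (hc : 0 < c) (u v : V2) : ‖vhat c u - vhat c v‖ ≤ 4 * ‖u - v‖ := by
  have hu := one_le_lor c u
  have hv := one_le_lor c v
  have e : vhat c u - vhat c v = (1 / lor c v) • (u - v) +
      ((lor c v - lor c u) / lor c v) • vhat c u := by
    rw [vhat_eq, vhat_eq, smul_smul, smul_sub]
    have : (lor c v - lor c u) / lor c v * (1 / lor c u) = 1 / lor c u - 1 / lor c v := by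
      field_simp
    rw [this, sub_smul]; abel
  have h1 : en (vhat c u - vhat c v) ≤ 2 * en (u - v) := by
    rw [e]
    refine (en_add_le _ _).trans ?_
    rw [en_smul, en_smul]
    have a1 : |1 / lor c v| ≤ 1 := by
      rw [abs_of_nonneg (by positivity), div_le_one (by linarith)]; exact hv
    have a2 : |(lor c v - lor c u) / lor c v| ≤ en (u - v) / c := by
      rw [abs_div, abs_of_pos (by linarith : 0 < lor c v), abs_sub_comm]
      exact (div_le_self (abs_nonneg _) hv).trans (lor_sub_le hc u v)
    have a3 := en_vhat_le hc u
    have h0 := en_nonneg (u - v)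
    have : |(lor c v - lor c u) / lor c v| * en (vhat c u) ≤ en (u - v) / c * c :=
      mul_le_mul a2 a3 (en_nonneg _) (by positivity)
    rw [div_mul_cancel₀ _ hc.ne'] at this
    nlinarith
  have h2 := norm_le_en (vhat c u - vhat c v)
  have h3 := en_le_two_norm (u - v)
  linarith

/-- Fast particles have a velocity bounded below. -/
lemma en_vhat_ge {c : ℝ} (hc : 0 < c) {δ : ℝ} (hδ : 0 < δ) : ∃ s₀ > 0, ∀ v : V2, δ ≤ en v →
    s₀ ≤ en (vhat c v) := by
  refine ⟨(1 / δ + 1 / c)⁻¹, by positivity, fun v hv => ?_⟩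
  have hv0 : 0 < en v := by linarith
  have h1 : lor c v ≤ 1 + en v / c := by
    have := lor_sub_le hc v 0
    have h0 : lor c 0 = 1 := by simp [lor]
    rw [h0, sub_zero] at this
    linarith [(abs_le.1 this).2]
  have hl := one_le_lor c v
  rw [en_vhat, inv_le_comm₀ (by positivity) (by positivity), inv_div, div_le_iff₀ hv0]
  have h2 : 1 ≤ 1 / δ * en v := by rw [div_mul_eq_mul_div, one_mul, one_le_div hδ]; exact hv
  calc lor c v ≤ 1 + en v / c := h1
    _ ≤ 1 / δ * en v + en v / c := by linarith
    _ = _ := by ring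

/-- Integrated form of a differential inequality. -/
lemma norm_sub_le_of_deriv {f : ℝ → V2} {f' : ℝ → V2} {B B' : ℝ → ℝ} {s t : ℝ} (hst : s ≤ t)
    (hf : ∀ u ∈ Set.Icc s t, HasDerivAt f (f' u) u) (hB : ∀ u, HasDerivAt B (B' u) u)
    (h : ∀ u ∈ Set.Icc s t, ‖f' u‖ ≤ B' u) : ‖f t - f s‖ ≤ B t - B s := by
  have := image_norm_le_of_norm_deriv_right_le_deriv_boundary (f := fun u => f u - f s)
    (f' := f') (a := s) (b := t) (B := fun u => B u - B s) (B' := B')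
    (fun u hu => ((hf u hu).continuousAt.continuousWithinAt.sub continuousWithinAt_const))
    (fun u hu => ((hf u ⟨hu.1, hu.2.le⟩).sub_const _).hasDerivWithinAt) (by simp)
    (fun u => (hB u).sub_const _)
    (fun u hu => h u ⟨hu.1, hu.2.le⟩)
  exact this ⟨hst, le_rfl⟩

/-! ### Flashes -/

/-- Continuous periodic space-time functions are bounded on compact time intervals. -/
lemma SPer.bounded_compact {E F : Type*} [TopologicalSpace E] [NormedAddCommGroup F]
    {u : E × V2 → F} (hu : Continuous u) (hp : SPer u) {S : Set E} (hS : IsCompact S) :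
    ∃ M, 0 ≤ M ∧ ∀ t ∈ S, ∀ x, ‖u (t, x)‖ ≤ M := by
  obtain ⟨M, hM⟩ := (hS.prod unitSq_compact).exists_bound_of_continuousOn hu.continuousOn
  refine ⟨max M 0, le_max_right _ _, fun t ht x => ?_⟩
  obtain ⟨y, hy, m, n, rfl⟩ := exists_unitSq_rep x
  have := hp t y m n
  simp only at this
  rw [this]
  exact (hM (t, y) ⟨ht, hy⟩).trans (le_max_left _ _)

lemma SPer.bounded {F : Type*} [NormedAddCommGroup F] {u : ℝ × V2 → F} (hu : Continuous u)
    (hp : SPer u) (a b : ℝ) : ∃ M, 0 ≤ M ∧ ∀ t ∈ Set.Icc a b, ∀ x, ‖u (t, x)‖ ≤ M :=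
  hp.bounded_compact hu isCompact_Icc

lemma Zper.bounded {F : Type*} [NormedAddCommGroup F] {u : V2 → F} (hu : Continuous u)
    (hp : Zper u) : ∃ M, 0 ≤ M ∧ ∀ x, ‖u x‖ ≤ M := by
  obtain ⟨M, h0, hM⟩ := SPer.bounded (u := fun p : ℝ × V2 => u p.2) (hu.comp continuous_snd)
    (fun _ => hp) 0 0
  exact ⟨M, h0, fun x => hM 0 (by simp) x⟩

lemma Zper.dd {F : Type*} [NormedAddCommGroup F] [NormedSpace ℝ F] {u : V2 → F}
    (hu : Zper u) (w : V2) : Zper (dd w u) := by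
  intro x m n
  have h : (fun p : V2 => u (p + ((m : ℝ), (n : ℝ)))) = u := by
    funext p
    have := hu p m n
    simpa [Prod.add_def] using this
  have h2 := congrFun (dd_comp_add (u := u) w ((m : ℝ), (n : ℝ))) x
  rw [h] at h2
  simpa [Prod.add_def] using h2.symm

lemma Zper.fderiv {F : Type*} [NormedAddCommGroup F] [NormedSpace ℝ F] {u : V2 → F}
    (hu : Zper u) : Zper (fderiv ℝ u) := fun x m n => by
  exact ContinuousLinearMap.ext fun w => hu.dd w x m n

lemma SPer.fderiv {F : Type*} [NormedAddCommGroup F] [NormedSpace ℝ F] {u : ℝ × V2 → F}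
    (hu : SPer u) : SPer (fderiv ℝ u) := fun t x m n => by
  exact ContinuousLinearMap.ext fun w => hu.dd w t x m n

/-- A train of short pulses with small integral. -/
lemma exists_train (n : ℕ) {Δ α : ℝ} (hΔ : 0 < Δ) (hα : 0 < α) : ∃ A : ℝ → ℝ,
    ContDiff ℝ (⊤ : ℕ∞) A ∧ (∀ u, 0 ≤ A u) ∧ (∀ i : ℕ, 1 ≤ i → i ≤ n → 10 ≤ A (i * Δ)) ∧
    (∀ i : ℕ, A (i * Δ + Δ / 2) = 0) ∧ (∀ u ≤ Δ / 2, A u = 0) ∧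
    (∀ u, n * Δ + Δ / 2 ≤ u → A u = 0) ∧ (∀ u, 0 ≤ u → ∫ s in (0 : ℝ)..u, A s ≤ α) := by
  set θ : ℝ := min (Δ / 2) (α / (20 * (n + 1))) with hθ
  have hθ0 : 0 < θ := lt_min (by positivity) (by positivity)
  have hθ1 : θ ≤ Δ / 2 := min_le_left _ _
  have hθ2 : θ ≤ α / (20 * (n + 1)) := min_le_right _ _
  let f : ContDiffBump (0 : ℝ) := ⟨θ / 2, θ, by positivity, by linarith⟩
  have hz : ∀ x : ℝ, Δ / 2 ≤ |x| → f x = 0 := fun x hx =>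
    f.zero_of_le_dist (by rw [Real.dist_eq, sub_zero]; exact hθ1.trans hx)
  have hint : ∀ a u : ℝ, 0 ≤ u → ∫ s in (0 : ℝ)..u, f (s - a) ≤ 2 * θ := by
    intro a u hu
    have h1 : Integrable (fun s => f (s - a)) := f.integrable.comp_sub_right a
    rw [intervalIntegral.integral_of_le hu]
    calc ∫ s in Set.Ioc 0 u, f (s - a) ≤ ∫ s, f (s - a) :=
          setIntegral_le_integral h1 (Filter.Eventually.of_forall fun s => f.nonneg)
      _ = ∫ s, f s := integral_sub_right_eq_self (fun s => f s) a
      _ ≤ volume.real (Metric.closedBall (0 : ℝ) f.rOut) := f.integral_le_measure_closedBall _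
      _ = 2 * θ := by rw [Real.volume_real_closedBall hθ0.le]
  have hsm : ∀ a : ℝ, ContDiff ℝ (⊤ : ℕ∞) (fun u : ℝ => f (u - a)) := fun a =>
    f.contDiff.comp (contDiff_id.sub contDiff_const)
  refine ⟨fun u => ∑ i ∈ Finset.range n, 10 * f (u - (i + 1 : ℕ) * Δ), ?_, ?_, ?_, ?_, ?_, ?_, ?_⟩
  · exact ContDiff.sum fun i _ => contDiff_const.mul (hsm _)
  · exact fun u => Finset.sum_nonneg fun i _ => mul_nonneg (by norm_num) f.nonneg
  · intro i hi hin
    obtain ⟨j, rfl⟩ : ∃ j, i = j + 1 := ⟨i - 1, by omega⟩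
    have : (10 : ℝ) = 10 * f ((j + 1 : ℕ) * Δ - (j + 1 : ℕ) * Δ) := by
      rw [sub_self, f.one_of_mem_closedBall (by simp [f.rIn_pos.le]), mul_one]
    refine this.le.trans ?_
    exact Finset.single_le_sum (f := fun i : ℕ => 10 * f ((j + 1 : ℕ) * Δ - (i + 1 : ℕ) * Δ))
      (fun i _ => mul_nonneg (by norm_num) f.nonneg) (Finset.mem_range.2 (show j < n by omega))
  · intro i
    refine Finset.sum_eq_zero fun j _ => ?_
    rw [hz, mul_zero]
    have h : (i : ℝ) * Δ + Δ / 2 - (j + 1 : ℕ) * Δ = ((2 * ((i : ℤ) - (j + 1 : ℕ)) + 1 : ℤ) : ℝ) * (Δ / 2) := by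
      push_cast; ring
    rw [h, abs_mul, abs_of_pos (half_pos hΔ), ← Int.cast_abs]
    have : (1 : ℤ) ≤ |2 * ((i : ℤ) - (j + 1 : ℕ)) + 1| := Int.one_le_abs (by omega)
    have : (1 : ℝ) ≤ ((|2 * ((i : ℤ) - (j + 1 : ℕ)) + 1| : ℤ) : ℝ) := by exact_mod_cast this
    nlinarith
  · intro u hu
    refine Finset.sum_eq_zero fun j _ => ?_
    rw [hz, mul_zero]
    rw [abs_of_nonpos, neg_sub]
    · push_cast; nlinarith [(Nat.cast_nonneg j : (0 : ℝ) ≤ j)]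
    · push_cast; nlinarith [(Nat.cast_nonneg j : (0 : ℝ) ≤ j)]
  · intro u hu
    refine Finset.sum_eq_zero fun j hj => ?_
    have hj' : ((j + 1 : ℕ) : ℝ) ≤ n := by exact_mod_cast Finset.mem_range.1 hj
    rw [hz, mul_zero]
    rw [abs_of_nonneg] <;> nlinarith
  · intro u hu
    have hii : ∀ i ∈ Finset.range n, IntervalIntegrable
        (fun s => 10 * f (s - (i + 1 : ℕ) * Δ)) volume 0 u := fun i _ =>
      (continuous_const.mul (hsm _).continuous).intervalIntegrable _ _
    simp only []
    rw [intervalIntegral.integral_finsetSum hii]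
    calc ∑ i ∈ Finset.range n, ∫ s in (0 : ℝ)..u, 10 * f (s - (i + 1 : ℕ) * Δ)
        ≤ ∑ i ∈ Finset.range n, 10 * (2 * θ) := by
          refine Finset.sum_le_sum fun i _ => ?_
          rw [intervalIntegral.integral_const_mul]
          have := hint ((i + 1 : ℕ) * Δ) u hu
          linarith
      _ = n * (20 * θ) := by rw [Finset.sum_const, Finset.card_range, nsmul_eq_mul]; ring
      _ ≤ (n + 1) * (20 * (α / (20 * (n + 1)))) := by gcongr; linarith
      _ = α := by field_simp

/-- The field generated by a localized current. -/
lemma flash_adm (c : ℝ) {K : Set V2} (hK : IsClosed K) {χ : V2 → ℝ} (hχ : ContDiff ℝ (⊤ : ℕ∞) χ)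
    (hp : Zper χ) (h0 : ∀ x, x ∉ K → χ x = 0) {A : ℝ → ℝ} (hA : ContDiff ℝ (⊤ : ℕ∞) A) :
    Adm c K (fun p => - deriv A p.1 * χ p.2) (fun _ => 0)
      (fun p => - c * A p.1 * dd ((0 : ℝ), (1 : ℝ)) χ p.2) := by
  have hA' : ContDiff ℝ (⊤ : ℕ∞) (deriv A) := by
    simpa using hA.iterate_deriv 1
  have hx := hχ.dd_top ((0 : ℝ), (1 : ℝ))
  have hz1 : ∀ x, x ∉ K → ∀ w, dd w χ x = 0 := fun x hxK w =>
    dd_eq_zero_of_eventually w (Filter.mem_of_superset (hK.isOpen_compl.mem_nhds hxK) fun y hy => h0 y hy)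
  have hz2 : ∀ x, x ∉ K → ∀ w w', dd w (dd w' χ) x = 0 := fun x hxK w w' =>
    dd_eq_zero_of_eventually w (Filter.mem_of_superset (hK.isOpen_compl.mem_nhds hxK)
      fun y hy => hz1 y hy w')
  have hprod : ∀ (a : ℝ → ℝ) (u : V2 → ℝ), ContDiff ℝ (⊤ : ℕ∞) a → ContDiff ℝ (⊤ : ℕ∞) u →
      ∀ (s : ℝ) (w : V2) (p : ℝ × V2), dd (s, w) (fun p => a p.1 * u p.2) p =
        s * deriv a p.1 * u p.2 + a p.1 * dd w u p.2 := by
    intro a u ha hu s w p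
    have h1 : HasFDerivAt (fun p : ℝ × V2 => a p.1) _ p :=
      (ha.differentiable_top p.1).hasFDerivAt.comp p hasFDerivAt_fst
    have h2 : HasFDerivAt (fun p : ℝ × V2 => u p.2) _ p :=
      (hu.differentiable_top p.2).hasFDerivAt.comp p hasFDerivAt_snd
    have := (h1.mul h2).fderiv
    simp only [dd]
    change fderiv ℝ (fun p : ℝ × V2 => a p.1 * u p.2) p = _ at this
    rw [this]
    have h3 : (fderiv ℝ a p.1) s = s * deriv a p.1 := by
      rw [← fderiv_apply_one_eq_deriv, ← smul_eq_mul, ← map_smul]; simp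
    simp only [ContinuousLinearMap.add_apply, ContinuousLinearMap.smul_apply, ContinuousLinearMap.comp_apply,
      ContinuousLinearMap.coe_fst', ContinuousLinearMap.coe_snd', h3, smul_eq_mul]
    ring
  have hd : ∀ t, deriv (fun t => - deriv A t) t = - deriv (deriv A) t := fun t => by
    rw [deriv.fun_neg]
  have hd' : ∀ t, deriv (fun t => - c * A t) t = - c * deriv A t := fun t =>
    deriv_const_mul _ (hA.differentiable_top t)
  have e1 : ∀ s w p, dd (s, w) (fun p : ℝ × V2 => - deriv A p.1 * χ p.2) p =
      - s * deriv (deriv A) p.1 * χ p.2 - deriv A p.1 * dd w χ p.2 := fun s w p => by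
    have := hprod (fun t => - deriv A t) χ hA'.neg hχ s w p
    rw [this, hd]; ring
  have e3 : ∀ s w p, dd (s, w) (fun p : ℝ × V2 => - c * A p.1 * dd ((0 : ℝ), (1 : ℝ)) χ p.2) p =
      - c * s * deriv A p.1 * dd ((0 : ℝ), (1 : ℝ)) χ p.2 - c * A p.1 * dd w (dd ((0 : ℝ), (1 : ℝ)) χ) p.2 :=
    fun s w p => by
    have := hprod (fun t => - c * A t) _ (contDiff_const.mul hA) hx s w p
    rw [this, hd']; ring
  have e2 : ∀ w p, dd w (fun _ : ℝ × V2 => (0 : ℝ)) p = 0 := fun w p => by simp [dd]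
  refine ⟨?_, contDiff_const, ?_, ?_, fun _ _ _ _ => rfl, ?_, ?_, ?_, ?_, ?_⟩
  · exact (hA'.comp contDiff_fst).neg.mul (hχ.comp contDiff_snd)
  · exact (contDiff_const.mul (hA.comp contDiff_fst)).mul (hx.comp contDiff_snd)
  · intro t x m n
    have := hp x m n
    simp [this]
  · intro t x m n
    have := hp.dd ((0 : ℝ), (1 : ℝ)) x m n
    simp [this]
  · intro p
    simp only [dT, dX, dY, e1, e2, e3]
    rw [show ((0 : ℝ), (0 : ℝ)) = (0 : V2) from rfl]
    simp [dd]; ring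
  · intro p hpK
    simp only [dX, dY, e1, e2, hz1 _ hpK, h0 _ hpK]; simp
  · intro p hpK
    simp only [dT, dY, e1, e3, hz1 _ hpK, hz2 _ hpK, h0 _ hpK]; simp
  · intro p hpK
    simp only [dT, dX, e2, e3, hz1 _ hpK, hz2 _ hpK]; simp

/-! ### Dynamics -/

/-- The Lorentz force. -/
def frc (c : ℝ) (e₁ e₂ b : ℝ × V2 → ℝ) (t : ℝ) (x v : V2) : V2 :=
  (e₁ (t, x), e₂ (t, x)) + (c⁻¹ * b (t, x)) • pperp (vhat c v)

/-- `(X, V)` is a characteristic curve on the time interval `[s, s']`. -/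
def SolvesOn (c : ℝ) (e₁ e₂ b : ℝ × V2 → ℝ) (X V : ℝ → V2) (s s' : ℝ) : Prop :=
  ∀ t ∈ Set.Icc s s', HasDerivAt X (vhat c (V t)) t ∧ HasDerivAt V (frc c e₁ e₂ b t (X t) (V t)) t

lemma norm_dd_le {E F : Type*} [NormedAddCommGroup E] [NormedSpace ℝ E] [NormedAddCommGroup F]
    [NormedSpace ℝ F] {u : E → F} {B : ℝ} {x : E} (h : ‖fderiv ℝ u x‖ ≤ B) (w : E) :
    ‖dd w u x‖ ≤ B * ‖w‖ :=
  (ContinuousLinearMap.le_opNorm _ _).trans (by gcongr)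

lemma position_lipschitz {c : ℝ} (hc : 0 < c) {e₁ e₂ b : ℝ × V2 → ℝ} {X V : ℝ → V2} {s s' : ℝ}
    (h : SolvesOn c e₁ e₂ b X V s s') {t t' : ℝ} (ht : s ≤ t) (htt : t ≤ t') (ht' : t' ≤ s') :
    ‖X t' - X t‖ ≤ c * (t' - t) := by
  have := norm_sub_le_of_deriv (B := fun u => c * u) (B' := fun _ => c) htt
    (fun u hu => (h u ⟨ht.trans hu.1, hu.2.trans ht'⟩).1)
    (fun u => by simpa using (hasDerivAt_id u).const_mul c) (fun u _ => norm_vhat_le_c hc _)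
  linarith

/-- Estimates for a particle subject to a train of flashes. -/
lemma flash_estimates {c : ℝ} (hc : 0 < c) {χ : V2 → ℝ} (hχ : ContDiff ℝ (⊤ : ℕ∞) χ) {B : ℝ}
    (hB : ∀ x, |χ x| ≤ B) (hB' : ∀ x, ‖fderiv ℝ χ x‖ ≤ B) {A : ℝ → ℝ}
    (hA : ContDiff ℝ (⊤ : ℕ∞) A) (hA0 : ∀ u, 0 ≤ A u) (hA1 : A 0 = 0) {α R : ℝ}
    (hint : ∀ u, 0 ≤ u → ∫ s in (0 : ℝ)..u, A s ≤ α) {X V : ℝ → V2} {t₀ : ℝ}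
    (h : SolvesOn c (tsh t₀ fun p => - deriv A p.1 * χ p.2) (tsh t₀ fun _ => 0)
      (tsh t₀ fun p => - c * A p.1 * dd ((0 : ℝ), (1 : ℝ)) χ p.2) X V t₀ (t₀ + R))
    {u : ℝ} (hu : 0 ≤ u) (huR : u ≤ R) :
    ‖V (t₀ + u) + (A u * χ (X (t₀ + u)), 0) - V t₀‖ ≤ 2 * c * B * α ∧
    ‖X (t₀ + u) - X t₀ - u • vhat c (V t₀)‖ ≤ 4 * (2 * c * B * α) * R + 4 * B * α := by
  have hB0 : 0 ≤ B := (abs_nonneg _).trans (hB 0)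
  have hI : ∀ s, HasDerivAt (fun s => ∫ z in (0 : ℝ)..(s - t₀), A z) (A (s - t₀)) s := fun s => by
    have h1 := (intervalIntegral.integral_hasDerivAt_right (hA.continuous.intervalIntegrable 0 (s - t₀))
      (hA.continuous.stronglyMeasurableAtFilter _ _) hA.continuous.continuousAt)
    exact h1.comp_sub_const s t₀
  have hQ : ∀ u, 0 ≤ u → u ≤ R →
      ‖V (t₀ + u) + (A u * χ (X (t₀ + u)), 0) - V t₀‖ ≤ 2 * c * B * α := by
    intro u hu huR
    have key := norm_sub_le_of_deriv (f := fun s => V s + (A (s - t₀) * χ (X s), (0 : ℝ)))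
      (f' := fun s => (A (s - t₀) * dd (vhat c (V s)) χ (X s), 0) -
        (A (s - t₀) * dd ((0 : ℝ), (1 : ℝ)) χ (X s)) • pperp (vhat c (V s)))
      (B := fun s => 2 * c * B * ∫ z in (0 : ℝ)..(s - t₀), A z)
      (B' := fun s => 2 * c * B * A (s - t₀)) (s := t₀) (t := t₀ + u) (by linarith) ?_
      (fun s => (hI s).const_mul _) ?_
    · simp only [add_sub_cancel_left, sub_self, hA1, zero_mul, intervalIntegral.integral_same,
        mul_zero, sub_zero] at key
      have h0 : ((0 : ℝ), (0 : ℝ)) = (0 : V2) := rfl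
      rw [h0, add_zero] at key
      exact key.trans (mul_le_mul_of_nonneg_left (hint u hu) (by positivity))
    · intro s hs
      have hs' := h s ⟨hs.1, hs.2.trans (by linarith)⟩
      have hAs : HasDerivAt (fun s => A (s - t₀)) (deriv A (s - t₀)) s :=
        (hA.differentiable_top (s - t₀)).hasDerivAt.comp_sub_const s t₀
      have h1 := hAs.mul (dd_hasDerivAt hχ.differentiable_top hs'.1)
      have h2 := hs'.2.add (h1.prodMk (hasDerivAt_const s (0 : ℝ)))
      refine h2.congr_deriv (Eq.symm ?_)
      simp only [frc, tsh_apply]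
      have hcc : c⁻¹ * c = 1 := inv_mul_cancel₀ hc.ne'
      ext
      · simp; linear_combination (A (s - t₀) * dd ((0 : ℝ), (1 : ℝ)) χ (X s) *
          (pperp (vhat c (V s))).1) * hcc
      · simp only [Prod.snd_add, Prod.snd_sub, Prod.smul_snd, smul_eq_mul]
        linear_combination (A (s - t₀) * dd ((0 : ℝ), (1 : ℝ)) χ (X s) *
          (pperp (vhat c (V s))).2) * hcc
    · intro s hs
      have hv := norm_vhat_le_c hc (V s)
      have h1 : ‖dd (vhat c (V s)) χ (X s)‖ ≤ B * c :=
        (norm_dd_le (hB' _) _).trans (by gcongr)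
      have h2 : ‖dd ((0 : ℝ), (1 : ℝ)) χ (X s)‖ ≤ B := by
        have := norm_dd_le (hB' (X s)) ((0 : ℝ), (1 : ℝ))
        simpa [Prod.norm_def] using this
      calc _ ≤ ‖(A (s - t₀) * dd (vhat c (V s)) χ (X s), (0 : ℝ))‖ +
            ‖(A (s - t₀) * dd ((0 : ℝ), (1 : ℝ)) χ (X s)) • pperp (vhat c (V s))‖ := norm_sub_le _ _
        _ ≤ A (s - t₀) * (B * c) + A (s - t₀) * B * c := by
          gcongr
          · rw [Prod.norm_def]
            simp only [norm_zero, norm_mul, Real.norm_of_nonneg (hA0 _)]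
            refine max_le ?_ (by have := hA0 (s - t₀); positivity)
            exact mul_le_mul_of_nonneg_left h1 (hA0 _)
          · rw [norm_smul, norm_mul, Real.norm_of_nonneg (hA0 _), norm_pperp]
            have := hA0 (s - t₀)
            gcongr
        _ = _ := by ring
  refine ⟨hQ u hu huR, ?_⟩
  have hα : 0 ≤ α := by simpa using hint 0 le_rfl
  have hI2 : ∀ s, HasDerivAt (fun s => 4 * (2 * c * B * α) * s + 4 * B * ∫ z in (0 : ℝ)..(s - t₀), A z)
      (4 * (2 * c * B * α) + 4 * B * A (s - t₀)) s := fun s => by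
    have := ((hasDerivAt_id s).const_mul (4 * (2 * c * B * α))).add ((hI s).const_mul (4 * B))
    rwa [mul_one] at this
  have key := norm_sub_le_of_deriv (f := fun s => X s - (s - t₀) • vhat c (V t₀))
    (f' := fun s => vhat c (V s) - vhat c (V t₀))
    (B := fun s => 4 * (2 * c * B * α) * s + 4 * B * ∫ z in (0 : ℝ)..(s - t₀), A z)
    (B' := fun s => 4 * (2 * c * B * α) + 4 * B * A (s - t₀)) (s := t₀) (t := t₀ + u) (by linarith) ?_
    hI2 ?_
  · simp only [add_sub_cancel_left, sub_self, zero_smul, sub_zero, intervalIntegral.integral_same] at key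
    have h1 : X (t₀ + u) - X t₀ - u • vhat c (V t₀) = X (t₀ + u) - u • vhat c (V t₀) - X t₀ := by abel
    rw [h1]
    refine key.trans ?_
    have h2 := hint u hu
    have h3 : 4 * (2 * c * B * α) * u ≤ 4 * (2 * c * B * α) * R :=
      mul_le_mul_of_nonneg_left huR (by positivity)
    have h4 : 4 * B * ∫ z in (0 : ℝ)..u, A z ≤ 4 * B * α :=
      mul_le_mul_of_nonneg_left h2 (by positivity)
    linarith
  · intro s hs
    have hs' := h s ⟨hs.1, hs.2.trans (by linarith)⟩
    have h1 : HasDerivAt (fun s : ℝ => (s - t₀) • vhat c (V t₀)) (vhat c (V t₀)) s := by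
      simpa using ((hasDerivAt_id s).sub_const t₀).smul_const (vhat c (V t₀))
    exact hs'.1.sub h1
  · intro s hs
    have h1 := hQ (s - t₀) (by linarith [hs.1]) (by linarith [hs.2])
    rw [add_sub_cancel] at h1
    refine (vhat_sub_le hc _ _).trans ?_
    have h2 : ‖V s - V t₀‖ ≤ 2 * c * B * α + A (s - t₀) * B := by
      have h3 : V s - V t₀ = (V s + (A (s - t₀) * χ (X s), 0) - V t₀) -
        (A (s - t₀) * χ (X s), 0) := by abel
      rw [h3]
      refine (norm_sub_le _ _).trans (add_le_add h1 ?_)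
      rw [Prod.norm_def]
      simp only [norm_zero, norm_mul, Real.norm_of_nonneg (hA0 _)]
      refine max_le ?_ (mul_nonneg (hA0 _) hB0)
      exact mul_le_mul_of_nonneg_left (hB _) (hA0 _)
    linarith

/-- A sequence of flashes accelerates, inside the control region, all but the slow particles. -/
theorem exists_phase {c : ℝ} (hc : 0 < c) {ω : Set V2} {r L : ℝ} (hr : 0 < r) (hL : 0 < L)
    (hG : ∀ x e, en e = 1 → ∃ s, 0 ≤ s ∧ s ≤ L ∧ x + s • e ∈ core ω (3 * r))
    {χ : V2 → ℝ} (hχ : ContDiff ℝ (⊤ : ℕ∞) χ) (hp : Zper χ) (h1 : ∀ x ∈ core ω r, 1 ≤ χ x)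
    {δ κ : ℝ} (hδ : 0 < δ) (hκ : 0 < κ) : ∃ (R η : ℝ) (A : ℝ → ℝ), 0 < R ∧ 0 < η ∧
      ContDiff ℝ (⊤ : ℕ∞) A ∧ (∀ u ≤ η, A u = 0) ∧ (∀ u, R - η ≤ u → A u = 0) ∧
      ∀ (t₀ : ℝ) (X V : ℝ → V2),
        SolvesOn c (tsh t₀ fun p => - deriv A p.1 * χ p.2) (tsh t₀ fun _ => 0)
          (tsh t₀ fun p => - c * A p.1 * dd ((0 : ℝ), (1 : ℝ)) χ p.2) X V t₀ (t₀ + R) →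
        (∃ t ∈ Set.Icc t₀ (t₀ + R), X t ∈ ω ∧ 4 ≤ en (V t)) ∨
        (en (V t₀) < δ ∧ ‖V (t₀ + R) - V t₀‖ ≤ κ ∧ X (t₀ + R) ∉ core ω (3 / 2 * r)) := by
  obtain ⟨B₁, hB₁0, hB₁⟩ := hp.bounded hχ.continuous
  obtain ⟨B₂, hB₂0, hB₂⟩ := hp.fderiv.bounded (hχ.continuous_fderiv (by simp))
  set B := max B₁ B₂ + 1 with hBdef
  have hBpos : 0 < B := by positivity
  have hB : ∀ x, |χ x| ≤ B := fun x => (hB₁ x).trans (by linarith [le_max_left B₁ B₂])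
  have hB' : ∀ x, ‖fderiv ℝ χ x‖ ≤ B := fun x => (hB₂ x).trans (by linarith [le_max_right B₁ B₂])
  obtain ⟨s₀, hs₀, hfast⟩ := en_vhat_ge hc hδ
  set Δ := r / (2 * c) with hΔdef
  have hΔ : 0 < Δ := by positivity
  have hcΔ : c * Δ = r / 2 := by rw [hΔdef]; field_simp
  obtain ⟨n, hn⟩ := exists_nat_ge (L / s₀ / Δ + 1)
  have hn1 : 1 ≤ n := by
    have h0 : 0 < L / s₀ / Δ := by positivity
    have : (1 : ℝ) ≤ n := by linarith
    exact_mod_cast this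
  set R := (n + 1) * Δ with hRdef
  have hR : 0 < R := by positivity
  set α := min (min κ 1 / (2 * c * B)) (r / 2 / (4 * (2 * c * B) * R + 4 * B)) with hαdef
  have hα : 0 < α := by positivity
  have hα1 : 2 * c * B * α ≤ min κ 1 := by
    have : α ≤ min κ 1 / (2 * c * B) := min_le_left _ _
    rw [le_div_iff₀ (by positivity)] at this; linarith
  have hα2 : 4 * (2 * c * B * α) * R + 4 * B * α ≤ r / 2 := by
    have : α ≤ r / 2 / (4 * (2 * c * B) * R + 4 * B) := min_le_right _ _
    rw [le_div_iff₀ (by positivity)] at this; linarith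
  obtain ⟨A, hAs, hA0, hA10, hAhalf, hAl, hAr, hint⟩ := exists_train n hΔ hα
  refine ⟨R, Δ / 2, A, hR, by positivity, hAs, hAl, fun u hu => hAr u (by rw [hRdef] at hu; linarith), ?_⟩
  intro t₀ X V h
  have est := fun {u : ℝ} (hu : 0 ≤ u) (huR : u ≤ R) =>
    flash_estimates hc hχ hB hB' hAs hA0 (hAl 0 (by positivity)) hint h hu huR
  -- a particle in the control region at the time of a flash is accelerated
  have caught : ∀ i : ℕ, 1 ≤ i → i ≤ n → X (t₀ + i * Δ) ∈ core ω r →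
      ∃ t ∈ Set.Icc t₀ (t₀ + R), X t ∈ ω ∧ 4 ≤ en (V t) := by
    intro i hi hin hX
    have hin' : (i : ℝ) ≤ n := by exact_mod_cast hin
    have hi0 : 0 ≤ (i : ℝ) * Δ := by positivity
    have hiR : (i : ℝ) * Δ + Δ / 2 ≤ R := by rw [hRdef]; nlinarith
    by_cases hv : ‖V t₀‖ ≤ 5
    · refine ⟨t₀ + i * Δ, ⟨by linarith, by linarith⟩, core_subset hr hX, ?_⟩
      have h2 := (est hi0 (by linarith)).1.trans (hα1.trans (min_le_right _ _))
      have h3 := (norm_fst_le _).trans h2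
      have h4 : |(V t₀).1| ≤ 5 := (norm_fst_le (V t₀)).trans hv
      simp only [Prod.fst_sub, Prod.fst_add, Real.norm_eq_abs] at h3
      have h5 := hA10 i hi hin
      have h6 := h1 _ hX
      have h7 : 10 ≤ A (i * Δ) * χ (X (t₀ + i * Δ)) := by nlinarith
      refine le_trans ?_ (abs_le_en _).1
      rw [abs_le] at h3 h4
      refine le_trans ?_ (neg_le_abs _)
      linarith
    · push Not at hv
      refine ⟨t₀ + (i * Δ + Δ / 2), ⟨by linarith, by linarith⟩, ?_, ?_⟩
      · refine core_subset (ρ := r / 2) (by positivity) (core_move hX ?_)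
        have := position_lipschitz hc h (t := t₀ + i * Δ) (t' := t₀ + (i * Δ + Δ / 2))
          (by linarith) (by linarith) (by linarith)
        rw [dist_comm, dist_eq_norm]
        nlinarith
      · have h2 := (est (u := i * Δ + Δ / 2) (by linarith) hiR).1.trans (hα1.trans (min_le_right _ _))
        rw [hAhalf, zero_mul, show ((0 : ℝ), (0 : ℝ)) = (0 : V2) from rfl, add_zero] at h2
        refine le_trans ?_ (norm_le_en _)
        have := norm_sub_norm_le (V t₀) (V (t₀ + (i * Δ + Δ / 2)))
        rw [norm_sub_rev] at this
        linarith
  by_contra hcon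
  push Not at hcon
  obtain ⟨hno, hslow⟩ := hcon
  have hncaught : ∀ i : ℕ, 1 ≤ i → i ≤ n → X (t₀ + i * Δ) ∉ core ω r := fun i hi hin hX => by
    obtain ⟨t, ht, h2, h3⟩ := caught i hi hin hX
    exact absurd h3 (not_le.2 (hno t ht h2))
  have hAR : A R = 0 := hAr R (by rw [hRdef]; linarith)
  refine absurd (hslow ?_ ?_) ?_
  · by_contra hδv
    push Not at hδv
    set s := en (vhat c (V t₀)) with hs
    have hs0 : s₀ ≤ s := hfast _ hδv
    have hspos : 0 < s := hs₀.trans_le hs0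
    obtain ⟨σ, hσ0, hσL, hσ⟩ := hG (X t₀) (s⁻¹ • vhat c (V t₀)) (by
      rw [en_smul, abs_of_pos (inv_pos.2 hspos)]; exact inv_mul_cancel₀ hspos.ne')
    set tt := σ / s with htt
    have htt0 : 0 ≤ tt := by positivity
    have httL : tt ≤ L / s₀ := by rw [htt]; gcongr
    rw [smul_smul, ← div_eq_mul_inv, ← htt] at hσ
    set i := ⌊tt / Δ⌋₊ + 1 with hi
    have hi1 : tt ≤ i * Δ := by
      have := (Nat.lt_floor_add_one (tt / Δ)).le
      rw [div_le_iff₀ hΔ] at this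
      rw [hi]; push_cast; exact this
    have hi2 : i * Δ ≤ tt + Δ := by
      have := Nat.floor_le (div_nonneg htt0 hΔ.le)
      rw [le_div_iff₀ hΔ] at this
      rw [hi]; push_cast; linarith
    have hin : i ≤ n := by
      have h2 : (i : ℝ) ≤ n := by
        refine le_trans ?_ hn
        have : (i : ℝ) ≤ (tt + Δ) / Δ := by rw [le_div_iff₀ hΔ]; exact hi2
        rw [add_div, div_self hΔ.ne'] at this
        refine this.trans ?_
        gcongr
      exact_mod_cast h2
    have hin' : (i : ℝ) ≤ n := by exact_mod_cast hin
    refine hncaught i (by omega) hin (core_move hσ ?_)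
    have h2 := (est (u := i * Δ) (by positivity) (by rw [hRdef]; nlinarith)).2.trans hα2
    rw [dist_comm, dist_eq_norm]
    have h3 : X (t₀ + i * Δ) - (X t₀ + tt • vhat c (V t₀)) =
      (X (t₀ + i * Δ) - X t₀ - (i * Δ) • vhat c (V t₀)) + (i * Δ - tt) • vhat c (V t₀) := by
      rw [sub_smul]; abel
    have h4 : ‖(i * Δ - tt) • vhat c (V t₀)‖ ≤ r / 2 := by
      rw [norm_smul, Real.norm_of_nonneg (by linarith), ← hcΔ, mul_comm]
      gcongr
      · exact norm_vhat_le_c hc _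
      · linarith
    rw [h3]
    have := norm_add_le (X (t₀ + i * Δ) - X t₀ - (i * Δ) • vhat c (V t₀)) ((i * Δ - tt) • vhat c (V t₀))
    linarith
  · have h2 := (est hR.le le_rfl).1.trans (hα1.trans (min_le_left _ _))
    rwa [hAR, zero_mul, show ((0 : ℝ), (0 : ℝ)) = (0 : V2) from rfl, add_zero] at h2
  · intro hX
    refine hncaught n hn1 le_rfl (core_move hX ?_)
    have := position_lipschitz hc h (t := t₀ + n * Δ) (t' := t₀ + R)
      (by have : 0 ≤ (n : ℝ) * Δ := by positivity
          linarith) (by rw [hRdef]; linarith) le_rfl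
    rw [dist_eq_norm]
    have h5 : c * (t₀ + R - (t₀ + n * Δ)) = c * Δ := by rw [hRdef]; ring
    linarith

lemma SolvesOn.congr {c : ℝ} {e₁ e₂ b e₁' e₂' b' : ℝ × V2 → ℝ} {X V : ℝ → V2} {s s' a a' : ℝ}
    (h : SolvesOn c e₁ e₂ b X V s s') (ha : s ≤ a) (ha' : a' ≤ s')
    (heq : ∀ t ∈ Set.Icc a a', ∀ x,
      e₁ (t, x) = e₁' (t, x) ∧ e₂ (t, x) = e₂' (t, x) ∧ b (t, x) = b' (t, x)) :
    SolvesOn c e₁' e₂' b' X V a a' := by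
  intro t ht
  have := h t ⟨ha.trans ht.1, ht.2.trans ha'⟩
  obtain ⟨h1, h2, h3⟩ := heq t ht (X t)
  simp only [frc] at this ⊢
  rwa [h1, h2, h3] at this

/-- Effect of a weak pulse on a slow particle. -/
lemma pulse_estimate {c : ℝ} (hc : 0 < c) {e₁ e₂ b : ℝ × V2 → ℝ} (h1 : Continuous e₁)
    (h2 : Continuous e₂) {τ M M' : ℝ} (hτ : 0 ≤ τ) (hM' : 0 ≤ M')
    (hE : ∀ t ∈ Set.Icc 0 τ, ∀ x, ‖(e₁ (t, x), e₂ (t, x))‖ ≤ M)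
    (hb : ∀ t ∈ Set.Icc 0 τ, ∀ x, |b (t, x)| ≤ M)
    (hlip : ∀ t ∈ Set.Icc 0 τ, ∀ x y,
      ‖(e₁ (t, x), e₂ (t, x)) - (e₁ (t, y), e₂ (t, y))‖ ≤ M' * ‖x - y‖)
    {ε : ℝ} (hε : 0 ≤ ε) {X V : ℝ → V2} {s : ℝ}
    (h : SolvesOn c (tsh s fun p => ε * e₁ p) (tsh s fun p => ε * e₂ p) (tsh s fun p => ε * b p)
      X V s (s + τ)) :
    ‖V (s + τ) - V s - ε • ((∫ t in (0 : ℝ)..τ, e₁ (t, X s)), ∫ t in (0 : ℝ)..τ, e₂ (t, X s))‖ ≤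
      ε * (‖V s‖ + 2 * ε * M * τ) * (M' * τ + c⁻¹ * M) * τ := by
  have hM : 0 ≤ M := (norm_nonneg _).trans (hE 0 ⟨le_rfl, hτ⟩ 0)
  have hci : 0 < c⁻¹ := inv_pos.2 hc
  have hlin : ∀ a : ℝ, ∀ u : ℝ, HasDerivAt (fun u => a * u) a u := fun a u => by
    simpa using (hasDerivAt_id u).const_mul a
  set μ := ‖V s‖ + 2 * ε * M * τ with hμ
  have hμ0 : 0 ≤ μ := by positivity
  have fr : ∀ t ∈ Set.Icc s (s + τ), frc c (tsh s fun p => ε * e₁ p) (tsh s fun p => ε * e₂ p)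
      (tsh s fun p => ε * b p) t (X t) (V t) = ε • (e₁ (t - s, X t), e₂ (t - s, X t)) +
      (ε * (c⁻¹ * b (t - s, X t))) • pperp (vhat c (V t)) := by
    intro t ht
    simp only [frc, tsh_apply]
    ext <;> simp only [Prod.fst_add, Prod.snd_add, Prod.smul_fst, Prod.smul_snd, smul_eq_mul] <;> ring
  have hts : ∀ t ∈ Set.Icc s (s + τ), t - s ∈ Set.Icc 0 τ := fun t ht =>
    ⟨by linarith [ht.1], by linarith [ht.2]⟩
  have hV : ∀ t ∈ Set.Icc s (s + τ), ‖V t‖ ≤ μ := by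
    intro t ht
    have := norm_sub_le_of_deriv (B := fun u => 2 * ε * M * u) (B' := fun _ => 2 * ε * M) ht.1
      (fun u hu => (h u ⟨hu.1, hu.2.trans ht.2⟩).2) (hlin _) (fun u hu => by
        have hu' : u ∈ Set.Icc s (s + τ) := ⟨hu.1, hu.2.trans ht.2⟩
        rw [fr u hu']
        have h3 := hE _ (hts u hu') (X u)
        have h4 := hb _ (hts u hu') (X u)
        refine (norm_add_le _ _).trans ?_
        rw [norm_smul, norm_smul, Real.norm_of_nonneg hε, norm_mul, norm_mul, Real.norm_of_nonneg hε,
          Real.norm_of_nonneg hci.le, norm_pperp, Real.norm_eq_abs]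
        calc ε * ‖(e₁ (u - s, X u), e₂ (u - s, X u))‖ + ε * (c⁻¹ * |b (u - s, X u)|) * ‖vhat c (V u)‖
            ≤ ε * M + ε * (c⁻¹ * M) * c := by
              gcongr
              exact norm_vhat_le_c hc _
          _ = 2 * ε * M := by field_simp; ring)
    have h5 : ‖V t‖ ≤ ‖V t - V s‖ + ‖V s‖ := by simpa using norm_add_le (V t - V s) (V s)
    have h6 : 2 * ε * M * (t - s) ≤ 2 * ε * M * τ := by
      gcongr; linarith [ht.2]
    rw [hμ]; linarith
  have hX : ∀ t ∈ Set.Icc s (s + τ), ‖X t - X s‖ ≤ μ * τ := by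
    intro t ht
    have := norm_sub_le_of_deriv (B := fun u => μ * u) (B' := fun _ => μ) ht.1
      (fun u hu => (h u ⟨hu.1, hu.2.trans ht.2⟩).1) (hlin _) (fun u hu =>
        (norm_vhat_le c _).trans (hV u ⟨hu.1, hu.2.trans ht.2⟩))
    have h6 : μ * (t - s) ≤ μ * τ := by gcongr; linarith [ht.2]
    linarith
  have hI : ∀ (e : ℝ × V2 → ℝ), Continuous e → ∀ t,
      HasDerivAt (fun t => ∫ z in (0 : ℝ)..(t - s), e (z, X s)) (e (t - s, X s)) t := by
    intro e he t
    have hc' : Continuous fun z => e (z, X s) := by fun_prop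
    exact (intervalIntegral.integral_hasDerivAt_right (hc'.intervalIntegrable 0 (t - s))
      (hc'.stronglyMeasurableAtFilter _ _) hc'.continuousAt).comp_sub_const t s
  have key := norm_sub_le_of_deriv
    (f := fun t => V t - ε • ((∫ z in (0 : ℝ)..(t - s), e₁ (z, X s)), ∫ z in (0 : ℝ)..(t - s), e₂ (z, X s)))
    (f' := fun t => ε • (e₁ (t - s, X t), e₂ (t - s, X t)) +
      (ε * (c⁻¹ * b (t - s, X t))) • pperp (vhat c (V t)) - ε • (e₁ (t - s, X s), e₂ (t - s, X s)))
    (B := fun t => ε * μ * (M' * τ + c⁻¹ * M) * t) (B' := fun _ => ε * μ * (M' * τ + c⁻¹ * M))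
    (s := s) (t := s + τ) (by linarith) ?_ (hlin _) ?_
  · have h0 : ((0 : ℝ), (0 : ℝ)) = (0 : V2) := rfl
    simp only [sub_self, intervalIntegral.integral_same, add_sub_cancel_left, h0, smul_zero, sub_zero] at key
    rw [sub_right_comm] at key
    refine key.trans (le_of_eq ?_)
    ring
  · intro t ht
    have h3 := (h t ht).2
    rw [fr t ht] at h3
    exact h3.sub (((hI e₁ h1 t).prodMk (hI e₂ h2 t)).const_smul ε)
  · intro t ht
    have h3 : ε • (e₁ (t - s, X t), e₂ (t - s, X t)) +
      (ε * (c⁻¹ * b (t - s, X t))) • pperp (vhat c (V t)) - ε • (e₁ (t - s, X s), e₂ (t - s, X s)) =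
      ε • ((e₁ (t - s, X t), e₂ (t - s, X t)) - (e₁ (t - s, X s), e₂ (t - s, X s))) +
        (ε * (c⁻¹ * b (t - s, X t))) • pperp (vhat c (V t)) := by rw [smul_sub]; abel
    simp only [h3]
    refine (norm_add_le _ _).trans ?_
    rw [norm_smul, norm_smul, Real.norm_of_nonneg hε, norm_mul, norm_mul, Real.norm_of_nonneg hε,
      Real.norm_of_nonneg hci.le, norm_pperp, Real.norm_eq_abs]
    have h4 := hlip _ (hts t ht) (X t) (X s)
    have h5 := hb _ (hts t ht) (X t)
    calc _ ≤ ε * (M' * (μ * τ)) + ε * (c⁻¹ * M) * μ := by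
          gcongr
          · exact h4.trans (by gcongr; exact hX t ht)
          · exact (norm_vhat_le c _).trans (hV t ht)
      _ = _ := by ring

/-- Reduction of the acceleration of all particles to the existence of one suitable pulse. -/
theorem exists_program {c : ℝ} (hc : 0 < c) {ω K : Set V2} (hK : IsClosed K) {r L : ℝ} (hr : 0 < r)
    (hL : 0 < L) (hG : ∀ x e, en e = 1 → ∃ s, 0 ≤ s ∧ s ≤ L ∧ x + s • e ∈ core ω (3 * r))
    {χ : V2 → ℝ} (hχ : ContDiff ℝ (⊤ : ℕ∞) χ) (hp : Zper χ) (hχ1 : ∀ x ∈ core ω r, 1 ≤ χ x)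
    (hχ0 : ∀ x, x ∉ K → χ x = 0) {e₁ e₂ b : ℝ × V2 → ℝ} (hadm : Adm c K e₁ e₂ b) {τ : ℝ}
    (hτ : 0 < τ) (hz : ∀ t x, t ≤ 0 ∨ τ ≤ t → e₁ (t, x) = 0 ∧ e₂ (t, x) = 0 ∧ b (t, x) = 0)
    {p₀ : ℝ} (hp₀ : 0 < p₀) (hP : ∀ x, x ∉ core ω (3 / 2 * r) →
      p₀ ≤ ‖((∫ t in (0 : ℝ)..τ, e₁ (t, x)), ∫ t in (0 : ℝ)..τ, e₂ (t, x))‖) :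
    ∃ (T₁ η : ℝ) (E₁ E₂ b' : ℝ × V2 → ℝ), 0 < T₁ ∧ 0 < η ∧ Adm c K E₁ E₂ b' ∧
      (∀ t x, t ≤ η ∨ T₁ - η ≤ t → E₁ (t, x) = 0 ∧ E₂ (t, x) = 0 ∧ b' (t, x) = 0) ∧
      ∀ X V, SolvesOn c E₁ E₂ b' X V 0 T₁ → ∃ t ∈ Set.Icc 0 T₁, X t ∈ ω ∧ 4 ≤ en (V t) := by
  obtain ⟨M₁, hM₁0, hM₁⟩ := hadm.p1.bounded hadm.s1.continuous 0 τ
  obtain ⟨M₂, hM₂0, hM₂⟩ := hadm.p2.bounded hadm.s2.continuous 0 τ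
  obtain ⟨M₃, hM₃0, hM₃⟩ := hadm.p3.bounded hadm.s3.continuous 0 τ
  obtain ⟨L₁, hL₁0, hL₁⟩ := hadm.p1.fderiv.bounded (hadm.s1.continuous_fderiv (by simp)) 0 τ
  obtain ⟨L₂, hL₂0, hL₂⟩ := hadm.p2.fderiv.bounded (hadm.s2.continuous_fderiv (by simp)) 0 τ
  have lip : ∀ (e : ℝ × V2 → ℝ) (M : ℝ), Differentiable ℝ e → 0 ≤ M →
      (∀ t ∈ Set.Icc 0 τ, ∀ x, ‖fderiv ℝ e (t, x)‖ ≤ M) →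
      ∀ t ∈ Set.Icc 0 τ, ∀ x y, ‖e (t, x) - e (t, y)‖ ≤ M * ‖x - y‖ := by
    intro e M he hM hb t ht x y
    refine Convex.norm_image_sub_le_of_norm_hasFDerivWithin_le (𝕜 := ℝ) (f := fun x => e (t, x)) (s := Set.univ)
      (f' := fun x => (fderiv ℝ e (t, x)).comp (ContinuousLinearMap.inr ℝ ℝ V2))
      (fun z _ => ((he (t, z)).hasFDerivAt.comp z
        (hasFDerivAt_prodMk_right t z)).hasFDerivWithinAt) (fun z _ => ?_) convex_univ
        (Set.mem_univ _) (Set.mem_univ _)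
    refine (ContinuousLinearMap.opNorm_comp_le _ _).trans ?_
    calc _ ≤ M * 1 := mul_le_mul (hb t ht z) (ContinuousLinearMap.norm_inr_le_one ℝ ℝ V2)
            (norm_nonneg _) hM
      _ = M := mul_one M
  set M := max (max M₁ M₂) M₃ with hMdef
  set M' := max L₁ L₂ with hM'def
  have hM0 : 0 ≤ M := hM₃0.trans (le_max_right _ _)
  have hM'0 : 0 ≤ M' := hL₁0.trans (le_max_left _ _)
  have hci : 0 < c⁻¹ := inv_pos.2 hc
  set Q := (p₀ / 4 + 2 * M * τ) * (M' * τ + c⁻¹ * M) * τ with hQ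
  have hQ0 : 0 ≤ Q := by positivity
  set ε := p₀ / (4 * (Q + 1)) with hε
  have hε0 : 0 < ε := by positivity
  have hεQ : ε * Q ≤ p₀ / 4 := by
    rw [hε, div_mul_eq_mul_div, div_le_iff₀ (by positivity)]; nlinarith
  set δ := ε * p₀ / 8 with hδdef
  have hδ : 0 < δ := by positivity
  obtain ⟨R, η, A, hR, hη, hAs, hAl, hAr, hphase⟩ := exists_phase hc hr hL hG hχ hp hχ1 hδ hδ
  have hflash := flash_adm c hK hχ hp hχ0 hAs
  set f₁ : ℝ × V2 → ℝ := fun p => - deriv A p.1 * χ p.2 with hf₁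
  set f₂ : ℝ × V2 → ℝ := fun _ => 0 with hf₂
  set f₃ : ℝ × V2 → ℝ := fun p => - c * A p.1 * dd ((0 : ℝ), (1 : ℝ)) χ p.2 with hf₃
  have fz : ∀ t x, t ≤ η / 2 ∨ R - η / 2 ≤ t → f₁ (t, x) = 0 ∧ f₂ (t, x) = 0 ∧ f₃ (t, x) = 0 := by
    intro t x ht
    have hev : ∀ᶠ u in nhds t, A u = 0 := by
      rcases ht with ht | ht
      · exact Filter.mem_of_superset (Iio_mem_nhds (show t < η by linarith)) fun u hu => hAl u hu.le
      · exact Filter.mem_of_superset (Ioi_mem_nhds (show R - η < t by linarith)) fun u hu => hAr u hu.le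
    have h1 : A t = 0 := hev.self_of_nhds
    have h2 : deriv A t = 0 := by
      have : A =ᶠ[nhds t] fun _ => 0 := hev
      rw [this.deriv_eq]; simp
    simp [hf₁, hf₂, hf₃, h1, h2]
  refine ⟨2 * R + τ, η / 2, _, _, _, by positivity, by positivity,
    ((hflash.shift 0).add (hflash.shift (R + τ))).add ((hadm.const_mul ε).shift R), ?_, ?_⟩
  · intro t x ht
    have a1 := fz (t - 0) x (ht.imp (fun h => by linarith) (fun h => by linarith))
    have a2 := fz (t - (R + τ)) x (ht.imp (fun h => by linarith) (fun h => by linarith))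
    have hηR : η / 2 ≤ R := by
      by_contra hcon
      push Not at hcon
      have : ∀ u, A u = 0 := fun u => by
        rcases le_total u η with h | h
        · exact hAl u h
        · exact hAr u (by linarith)
      have hA : A = fun _ => 0 := funext this
      -- a vanishing train of flashes cannot accelerate a particle at rest in the control region
      obtain ⟨s, -, -, hs⟩ := hG 0 ((1 : ℝ), (0 : ℝ)) (by simp [en])
      have hv0 : vhat c (0 : V2) = 0 := by simp [vhat]
      rcases hphase 0 (fun _ => (0 : V2) + s • ((1 : ℝ), (0 : ℝ))) (fun _ => 0) (fun t _ => by
        refine ⟨by rw [hv0]; exact hasDerivAt_const _ _, ?_⟩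
        have : frc c (tsh 0 f₁) (tsh 0 f₂) (tsh 0 f₃) t ((0 : V2) + s • ((1 : ℝ), (0 : ℝ))) 0 = 0 := by
          simp [frc, hv0, tsh, hf₁, hf₂, hf₃, hA, pperp]
        rw [this]; exact hasDerivAt_const _ _) with ⟨t, _, _, h4⟩ | ⟨_, _, h5⟩
      · simp [en] at h4; linarith
      · exact h5 (core_anti (by linarith) hs)
    have a3 := hz (t - R) x (ht.imp (fun h => by linarith) (fun h => by linarith))
    simp only [tsh_apply, a1, a2, a3]; simp
  · intro X V hS
    have S1 : SolvesOn c (tsh 0 f₁) (tsh 0 f₂) (tsh 0 f₃) X V 0 (0 + R) := by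
      refine hS.congr le_rfl (by linarith) fun t ht x => ?_
      have a2 := fz (t - (R + τ)) x (Or.inl (by linarith [ht.2]))
      have a3 := hz (t - R) x (Or.inl (by linarith [ht.2]))
      simp only [tsh_apply, a2, a3]; simp
    rcases hphase 0 X V S1 with ⟨t, ht, h⟩ | ⟨hslow, hdV, hcore⟩
    · exact ⟨t, ⟨ht.1, by linarith [ht.2]⟩, h⟩
    have S2 : SolvesOn c (tsh R fun p => ε * e₁ p) (tsh R fun p => ε * e₂ p) (tsh R fun p => ε * b p)
        X V R (R + τ) := by
      refine hS.congr hR.le (by linarith) fun t ht x => ?_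
      have a1 := fz (t - 0) x (Or.inr (by linarith [ht.1]))
      have a2 := fz (t - (R + τ)) x (Or.inl (by linarith [ht.2]))
      simp only [tsh_apply, a1, a2]; simp
    rw [zero_add] at hdV hcore
    have hVR : ‖V R‖ ≤ 2 * δ := by
      have h1 : ‖V R‖ ≤ ‖V R - V 0‖ + ‖V 0‖ := by simpa using norm_add_le (V R - V 0) (V 0)
      linarith [norm_le_en (V 0)]
    have est := pulse_estimate hc hadm.s1.continuous hadm.s2.continuous (M := M) (M' := M') hτ.le hM'0
      (fun t ht x => max_le ((hM₁ t ht x).trans ((le_max_left _ _).trans (le_max_left _ _)))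
        ((hM₂ t ht x).trans ((le_max_right _ _).trans (le_max_left _ _))))
      (fun t ht x => (hM₃ t ht x).trans (le_max_right _ _))
      (fun t ht x y => max_le
        ((lip e₁ L₁ hadm.s1.differentiable_top hL₁0 hL₁ t ht x y).trans
          (by gcongr; exact le_max_left _ _))
        ((lip e₂ L₂ hadm.s2.differentiable_top hL₂0 hL₂ t ht x y).trans
          (by gcongr; exact le_max_right _ _))) hε0.le S2
    have hPx := hP (X R) hcore
    set Px : V2 := ((∫ t in (0 : ℝ)..τ, e₁ (t, X R)), ∫ t in (0 : ℝ)..τ, e₂ (t, X R)) with hPxdef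
    have hfast : δ ≤ ‖V (R + τ)‖ := by
      have h1 : ε * (‖V R‖ + 2 * ε * M * τ) * (M' * τ + c⁻¹ * M) * τ ≤ ε * (p₀ / 4) := by
        calc _ ≤ ε * (2 * δ + 2 * ε * M * τ) * (M' * τ + c⁻¹ * M) * τ := by gcongr
          _ = ε * (ε * Q) := by rw [hQ, hδdef]; ring
          _ ≤ _ := by gcongr
      have h2 : ‖ε • Px‖ ≤ ‖V (R + τ) - V R - ε • Px‖ + ‖V (R + τ)‖ + ‖V R‖ := by
        have h3 : ε • Px = -(V (R + τ) - V R - ε • Px) + V (R + τ) - V R := by abel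
        calc ‖ε • Px‖ = ‖-(V (R + τ) - V R - ε • Px) + V (R + τ) - V R‖ := by rw [← h3]
          _ ≤ _ := (norm_sub_le _ _).trans (by gcongr; exact (norm_add_le _ _).trans (by rw [norm_neg]))
      rw [norm_smul, Real.norm_of_nonneg hε0.le] at h2
      have h4 : ε * p₀ ≤ ε * ‖Px‖ := by gcongr
      rw [hδdef] at hVR ⊢
      nlinarith
    have S3 : SolvesOn c (tsh (R + τ) f₁) (tsh (R + τ) f₂) (tsh (R + τ) f₃) X V (R + τ) (R + τ + R) := by
      refine hS.congr (by linarith) (by linarith) fun t ht x => ?_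
      have a1 := fz (t - 0) x (Or.inr (by linarith [ht.1]))
      have a3 := hz (t - R) x (Or.inr (by linarith [ht.1]))
      simp only [tsh_apply, a1, a3]; simp
    rcases hphase (R + τ) X V S3 with ⟨t, ht, h⟩ | ⟨hslow', -, -⟩
    · exact ⟨t, ⟨by linarith [ht.1], by linarith [ht.2]⟩, h⟩
    · exact absurd hslow' (not_lt.2 (hfast.trans (norm_le_en _)))

/-! ### Integrals depending on a parameter -/

section ParamIntegral

variable {E G : Type} [NormedAddCommGroup E] [NormedSpace ℝ E] [ProperSpace E]
  [NormedAddCommGroup G] [NormedSpace ℝ G] [MeasurableSpace G] [BorelSpace G]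
  {μ : Measure G} [IsFiniteMeasureOnCompacts μ] {K : Set G}

lemma hasFDerivAt_paramIntegral {F : Type} [NormedAddCommGroup F] [NormedSpace ℝ F]
    (hK : IsCompact K) {u : E × G → F} (hu : ContDiff ℝ (⊤ : ℕ∞) u) (p : E) :
    HasFDerivAt (fun p => ∫ y in K, u (p, y) ∂μ)
      (∫ y in K, (fderiv ℝ u (p, y)).comp (ContinuousLinearMap.inl ℝ E G) ∂μ) p := by
  have hc : Continuous fun q : E × G =>
      (fderiv ℝ u q).comp (ContinuousLinearMap.inl ℝ E G) :=
    (hu.continuous_fderiv (by simp)).clm_comp continuous_const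
  obtain ⟨C, hC⟩ := ((isCompact_closedBall p 1).prod hK).exists_bound_of_continuousOn
    hc.continuousOn
  have hcp : ∀ q : E, ContinuousOn (fun y => u (q, y)) K := fun q =>
    (hu.continuous.comp (by fun_prop : Continuous fun y : G => (q, y))).continuousOn
  refine hasFDerivAt_integral_of_dominated_of_fderiv_le (bound := fun _ => C)
    (F' := fun p y => (fderiv ℝ u (p, y)).comp (ContinuousLinearMap.inl ℝ E G))
    (Metric.ball_mem_nhds p one_pos) ?_ ?_ ?_ ?_ ?_ ?_
  · exact Filter.Eventually.of_forall fun q =>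
      (hcp q).aestronglyMeasurable_of_isCompact hK hK.measurableSet
  · exact (hcp p).integrableOn_compact hK
  · exact (hc.comp (by fun_prop : Continuous fun y : G => (p, y))).continuousOn
      |>.aestronglyMeasurable_of_isCompact hK hK.measurableSet
  · refine (ae_restrict_iff' hK.measurableSet).2 (Filter.Eventually.of_forall ?_)
    intro y hy q hq
    exact hC (q, y) ⟨Metric.ball_subset_closedBall hq, hy⟩
  · exact continuousOn_const.integrableOn_compact hK
  · refine Filter.Eventually.of_forall fun y q _ => ?_
    have h1 := (hu.differentiable_top (q, y)).hasFDerivAt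
    have h2 : HasFDerivAt (fun q : E => (q, y)) (ContinuousLinearMap.inl ℝ E G) q :=
      hasFDerivAt_prodMk_left q y
    exact h1.comp q h2

lemma contDiff_paramIntegral {F : Type} [NormedAddCommGroup F] [NormedSpace ℝ F]
    (hK : IsCompact K) {u : E × G → F} (hu : ContDiff ℝ (⊤ : ℕ∞) u) :
    ContDiff ℝ (⊤ : ℕ∞) (fun p => ∫ y in K, u (p, y) ∂μ) := by
  have key : ∀ n : ℕ, ∀ {F : Type} [NormedAddCommGroup F] [NormedSpace ℝ F] {u : E × G → F},
      ContDiff ℝ (⊤ : ℕ∞) u → ContDiff ℝ n (fun p => ∫ y in K, u (p, y) ∂μ) := by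
    intro n
    induction n with
    | zero =>
      intro F _ _ u hu
      have : Differentiable ℝ (fun p => ∫ y in K, u (p, y) ∂μ) := fun p =>
        (hasFDerivAt_paramIntegral hK hu p).differentiableAt
      exact contDiff_zero.2 this.continuous
    | succ n ih =>
      intro F _ _ u hu
      have hd := fun p => hasFDerivAt_paramIntegral (μ := μ) hK hu p
      have : ((n + 1 : ℕ) : WithTop ℕ∞) = n + 1 := by push_cast; rfl
      rw [this, contDiff_succ_iff_fderiv]
      refine ⟨fun p => (hd p).differentiableAt, by simp, ?_⟩
      have h2 : fderiv ℝ (fun p => ∫ y in K, u (p, y) ∂μ) = fun p =>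
          ∫ y in K, (fderiv ℝ u (p, y)).comp (ContinuousLinearMap.inl ℝ E G) ∂μ :=
        funext fun p => (hd p).fderiv
      rw [h2]
      exact ih (u := fun q => (fderiv ℝ u q).comp (ContinuousLinearMap.inl ℝ E G))
        ((hu.fderiv_right (by simp)).clm_comp contDiff_const)
  exact contDiff_infty.2 fun n => key n hu

lemma dd_paramIntegral {F : Type} [NormedAddCommGroup F] [NormedSpace ℝ F] [CompleteSpace F]
    (hK : IsCompact K) {u : E × G → F} (hu : ContDiff ℝ (⊤ : ℕ∞) u) (w p : E) :
    dd w (fun p => ∫ y in K, u (p, y) ∂μ) p = ∫ y in K, dd (w, 0) u (p, y) ∂μ := by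
  have hc : Continuous fun y : G =>
      (fderiv ℝ u (p, y)).comp (ContinuousLinearMap.inl ℝ E G) :=
    ((hu.continuous_fderiv (by simp)).comp (by fun_prop)).clm_comp continuous_const
  simp only [dd]
  rw [(hasFDerivAt_paramIntegral hK hu p).fderiv,
    ContinuousLinearMap.integral_apply (hc.continuousOn.integrableOn_compact hK)]
  rfl

end ParamIntegral

/-! ### Fourier coefficients on the torus -/

/-- The characters of the torus. -/
def ch (m : ℤ × ℤ) (x : V2) : ℂ :=
  Complex.exp ((2 * π * (m.1 * x.1 + m.2 * x.2) : ℝ) * Complex.I)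

/-- Fourier coefficients of a periodic function. -/
def FT (φ : V2 → ℂ) (m : ℤ × ℤ) : ℂ := ∫ x in unitSq, φ x * ch (-m) x

lemma ch_contDiff (m : ℤ × ℤ) : ContDiff ℝ (⊤ : ℕ∞) (ch m) := by
  unfold ch
  refine ContDiff.cexp (ContDiff.mul ?_ contDiff_const)
  have h : ContDiff ℝ (⊤ : ℕ∞) fun x : V2 => 2 * π * (m.1 * x.1 + m.2 * x.2) := by fun_prop
  exact Complex.ofRealCLM.contDiff.comp h

lemma norm_ch (m : ℤ × ℤ) (x : V2) : ‖ch m x‖ = 1 := Complex.norm_exp_ofReal_mul_I _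

lemma ch_add (m n : ℤ × ℤ) (x : V2) : ch (m + n) x = ch m x * ch n x := by
  simp only [ch, ← Complex.exp_add]
  congr 1
  push_cast [Prod.fst_add, Prod.snd_add]
  ring

lemma ch_zero (x : V2) : ch 0 x = 1 := by simp [ch]

lemma ch_add_right (m : ℤ × ℤ) (x y : V2) : ch m (x + y) = ch m x * ch m y := by
  simp only [ch, ← Complex.exp_add]
  congr 1
  push_cast [Prod.fst_add, Prod.snd_add]
  ring

lemma ch_int (m : ℤ × ℤ) (a b : ℤ) : ch m ((a : ℝ), (b : ℝ)) = 1 := by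
  simp only [ch]
  rw [Complex.exp_eq_one_iff]
  exact ⟨m.1 * a + m.2 * b, by push_cast; ring⟩

lemma ch_per (m : ℤ × ℤ) : Zper (ch m) := by
  intro x a b
  have := ch_add_right m x ((a : ℝ), (b : ℝ))
  rw [ch_int, mul_one] at this
  exact this

lemma dd_ch (m : ℤ × ℤ) (w : V2) : dd w (ch m) = fun x =>
    (2 * π * (m.1 * w.1 + m.2 * w.2) : ℝ) * Complex.I * ch m x := by
  funext x
  have h : HasDerivAt (fun s : ℝ => ch m (x + s • w))
      (dd w (ch m) (x + (0 : ℝ) • w)) 0 := by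
    refine dd_hasDerivAt (ch_contDiff m).differentiable_top ?_
    simpa using ((hasDerivAt_id (0 : ℝ)).smul_const w).const_add x
  have h2 : HasDerivAt (fun s : ℝ => ch m (x + s • w))
      ((2 * π * (m.1 * w.1 + m.2 * w.2) : ℝ) * Complex.I * ch m x) 0 := by
    have e : (fun s : ℝ => ch m (x + s • w)) = fun s : ℝ => ch m x *
        Complex.exp ((s : ℂ) * ((2 * π * (m.1 * w.1 + m.2 * w.2) : ℝ) * Complex.I)) := by
      funext s
      rw [ch_add_right]
      congr 1
      simp only [ch, Prod.smul_fst, Prod.smul_snd, smul_eq_mul]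
      congr 1
      push_cast
      ring
    rw [e]
    have := ((Complex.ofRealCLM.hasDerivAt (x := (0 : ℝ))).mul_const
      (((2 * π * (m.1 * w.1 + m.2 * w.2) : ℝ) : ℂ) * Complex.I)).cexp.const_mul (ch m x)
    convert! this using 1
    simp
    ring
  simpa using h.unique h2

lemma unitSq_eq_prod : unitSq = Set.Icc (0 : ℝ) 1 ×ˢ Set.Icc (0 : ℝ) 1 := by
  ext x
  simp only [unitSq, Set.mem_Icc, Set.mem_prod, Prod.le_def]
  tauto

lemma unitSq_measure : volume.real unitSq = 1 := by
  rw [unitSq_eq_prod, measureReal_def, Measure.volume_eq_prod, Measure.prod_prod]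
  simp

lemma norm_setIntegral_unitSq_le {F : Type*} [NormedAddCommGroup F] [NormedSpace ℝ F]
    {φ : V2 → F} {C : ℝ} (h : ∀ x, ‖φ x‖ ≤ C) : ‖∫ x in unitSq, φ x‖ ≤ C := by
  have := norm_setIntegral_le_of_norm_le_const (μ := volume) (s := unitSq) (f := φ) (C := C)
    (unitSq_compact.measure_lt_top) (fun x _ => h x)
  rwa [unitSq_measure, mul_one] at this

lemma norm_FT_le {φ : V2 → ℂ} {C : ℝ} (h : ∀ x, ‖φ x‖ ≤ C) (m : ℤ × ℤ) : ‖FT φ m‖ ≤ C :=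
  norm_setIntegral_unitSq_le fun x => by simpa [norm_ch] using h x

lemma Zper.mul {A : Type*} [Mul A] {f g : V2 → A} (hf : Zper f) (hg : Zper g) :
    Zper fun x => f x * g x :=
  fun x m n => by simp only [hf x m n, hg x m n]

lemma integral_dd_eq_zero {F : Type*} [NormedAddCommGroup F] [NormedSpace ℝ F] {f : V2 → F}
    (hf : ContDiff ℝ (⊤ : ℕ∞) f) (pf : Zper f) (w : V2) : ∫ x in unitSq, dd w f x = 0 := by
  have hc : ∀ a : ℝ, ContDiff ℝ (⊤ : ℕ∞) (fun x => a • f x) := fun a => contDiff_const.smul hf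
  have hp : ∀ a : ℝ, Zper (fun x => a • f x) := fun a x m n => by simp only [pf x m n]
  have h := intT2_div_eq_zero (hc w.1) (hc w.2) (hp w.1) (hp w.2)
  rw [← h]
  congr 1
  funext x
  have e : w = w.1 • ((1 : ℝ), (0 : ℝ)) + w.2 • ((0 : ℝ), (1 : ℝ)) := by ext <;> simp
  conv_lhs => rw [e, dd_lin]
  simp only [dd]
  rw [fderiv_fun_const_smul (hf.differentiable_top x), fderiv_fun_const_smul (hf.differentiable_top x)]
  simp

lemma FT_dd {φ : V2 → ℂ} (hf : ContDiff ℝ (⊤ : ℕ∞) φ) (pf : Zper φ) (w : V2) (m : ℤ × ℤ) :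
    FT (dd w φ) m = (2 * π * (m.1 * w.1 + m.2 * w.2) : ℝ) * Complex.I * FT φ m := by
  have h := integral_dd_eq_zero (hf.mul (ch_contDiff (-m))) (pf.mul (ch_per (-m))) w
  rw [dd_mul hf.differentiable_top (ch_contDiff (-m)).differentiable_top, dd_ch] at h
  have i1 : IntegrableOn (fun x => dd w φ x * ch (-m) x) unitSq :=
    ((hf.dd_top w).continuous.mul (ch_contDiff _).continuous).continuousOn.integrableOn_compact
      unitSq_compact
  have i2 : IntegrableOn (fun x => φ x * ch (-m) x) unitSq :=
    (hf.continuous.mul (ch_contDiff _).continuous).continuousOn.integrableOn_compact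
      unitSq_compact
  have e : ∀ x, φ x * (((2 * π * ((-m).1 * w.1 + (-m).2 * w.2) : ℝ) : ℂ) * Complex.I *
      ch (-m) x) = -(((2 * π * (m.1 * w.1 + m.2 * w.2) : ℝ) : ℂ) * Complex.I) *
      (φ x * ch (-m) x) := by
    intro x
    push_cast [Prod.fst_neg, Prod.snd_neg]
    ring
  simp only [e] at h
  rw [integral_add i1 (i2.const_mul _), integral_const_mul] at h
  simp only [FT]
  linear_combination h

lemma integral_unitSq_eq {F : Type*} [NormedAddCommGroup F] [NormedSpace ℝ F] {f : V2 → F}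
    (hf : Continuous f) :
    ∫ x in unitSq, f x = ∫ a in (0 : ℝ)..1, ∫ b in (0 : ℝ)..1, f (a, b) := by
  rw [unitSq_eq_prod, Measure.volume_eq_prod, setIntegral_prod]
  · simp only [intervalIntegral.integral_of_le zero_le_one, integral_Icc_eq_integral_Ioc]
  · exact hf.continuousOn.integrableOn_compact (isCompact_Icc.prod isCompact_Icc)

lemma integral_unitSq_add {F : Type*} [NormedAddCommGroup F] [NormedSpace ℝ F] {f : V2 → F}
    (hf : Continuous f) (pf : Zper f) (y : V2) :
    ∫ x in unitSq, f (x + y) = ∫ x in unitSq, f x := by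
  rw [integral_unitSq_eq hf, integral_unitSq_eq (f := fun x => f (x + y)) (by fun_prop)]
  have h1 : ∀ a, Function.Periodic (fun b => f (a, b)) 1 := fun a b => by
    simpa using pf (a, b) 0 1
  have h2 : Function.Periodic (fun a => ∫ b in (0 : ℝ)..1, f (a, b)) 1 := fun a => by
    have : ∀ b, f (a + 1, b) = f (a, b) := fun b => by simpa using pf (a, b) 1 0
    simp only [this]
  have e1 : ∀ a, ∫ b in (0 : ℝ)..1, f ((a, b) + y) = ∫ b in (0 : ℝ)..1, f (a + y.1, b) := by
    intro a
    have := intervalIntegral.integral_comp_add_right (a := 0) (b := 1)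
      (fun b => f (a + y.1, b)) y.2
    simp only [Prod.mk_add_mk, ← this, Prod.add_def]
    rw [this]
    simpa [add_comm] using (h1 (a + y.1)).intervalIntegral_add_eq y.2 0
  simp only [e1]
  rw [intervalIntegral.integral_comp_add_right (fun a => ∫ b in (0 : ℝ)..1, f (a, b)) y.1]
  simpa [add_comm] using h2.intervalIntegral_add_eq y.1 0

lemma eq_zero_of_fourier_eq_zero {f : ℝ → ℂ} (hf : Continuous f) (hp : Function.Periodic f 1)
    (h : ∀ n : ℤ, ∫ x in (0 : ℝ)..1,
      f x * Complex.exp ((2 * π * (-n * x) : ℝ) * Complex.I) = 0) (x : ℝ) : f x = 0 := by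
  have : Fact ((0 : ℝ) < 1) := ⟨one_pos⟩
  have hcont : Continuous (hp.lift) := by
    exact continuous_coinduced_dom.2 hf
  set g : C(AddCircle (1 : ℝ), ℂ) := ⟨hp.lift, hcont⟩ with hg
  have hz : ∀ n, fourierCoeff g n = 0 := by
    intro n
    rw [fourierCoeff_eq_intervalIntegral _ n 0]
    have : ∀ x : ℝ, fourier (-n) (x : AddCircle (1 : ℝ)) • g x =
        f x * Complex.exp ((2 * π * (-n * x) : ℝ) * Complex.I) := by
      intro x
      rw [fourier_coe_apply, smul_eq_mul, mul_comm]
      congr 2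
      push_cast
      ring
    simp only [this, zero_add, h n, smul_zero]
  have hs : Summable (fourierCoeff g) := by
    have : fourierCoeff (g : AddCircle (1 : ℝ) → ℂ) = fun _ => 0 := funext hz
    rw [this]; exact summable_zero
  have := has_pointwise_sum_fourier_series_of_summable hs (x : AddCircle (1 : ℝ))
  simp only [hz, zero_smul] at this
  exact (this.unique hasSum_zero)

lemma eq_zero_of_FT_eq_zero {φ : V2 → ℂ} (hf : Continuous φ) (pf : Zper φ)
    (h : ∀ m, FT φ m = 0) (x : V2) : φ x = 0 := by
  have key : ∀ n : ℤ, ∀ a : ℝ, ∫ b in (0 : ℝ)..1,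
      φ (a, b) * Complex.exp ((2 * π * (-n * b) : ℝ) * Complex.I) = 0 := by
    intro n
    refine eq_zero_of_fourier_eq_zero ?_ ?_ ?_
    · apply intervalIntegral.continuous_parametric_intervalIntegral_of_continuous' (by fun_prop)
    · intro a
      have : ∀ b, φ (a + 1, b) = φ (a, b) := fun b => by simpa using pf (a, b) 1 0
      simp only [this]
    · intro k
      rw [← h (k, n), FT, integral_unitSq_eq (f := fun x => φ x * ch (-(k, n)) x)
        (hf.mul (ch_contDiff _).continuous)]
      congr 1
      funext a
      rw [← intervalIntegral.integral_mul_const]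
      congr 1
      funext b
      rw [mul_assoc, ← Complex.exp_add, ch]
      congr 2
      push_cast [Prod.fst_neg, Prod.snd_neg]
      ring
  exact eq_zero_of_fourier_eq_zero (f := fun b => φ (x.1, b)) (by fun_prop)
    (fun b => by simpa using pf (x.1, b) 0 1) (fun n => key n x.1) x.2

lemma FT_ch (m l : ℤ × ℤ) : FT (ch m) l = if m = l then 1 else 0 := by
  simp only [FT, ← ch_add]
  split_ifs with h
  · simp only [h, add_neg_cancel, ch_zero]
    rw [setIntegral_const, unitSq_measure]
    simp
  · set k := m + -l with hk
    have hk0 : k.1 ≠ 0 ∨ k.2 ≠ 0 := by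
      by_contra! hcon
      apply h
      have : k = 0 := Prod.ext hcon.1 hcon.2
      rwa [hk, add_neg_eq_zero] at this
    have h1 := integral_dd_eq_zero (ch_contDiff k) (ch_per k) ((k.1 : ℝ), (k.2 : ℝ))
    rw [dd_ch, integral_const_mul] at h1
    rcases mul_eq_zero.1 h1 with h2 | h2
    · exfalso
      have h3 : (2 * π * (k.1 * (k.1 : ℝ) + k.2 * (k.2 : ℝ)) : ℝ) = 0 := by
        rcases mul_eq_zero.1 h2 with h2 | h2
        · exact Complex.ofReal_eq_zero.1 h2
        · exact absurd h2 Complex.I_ne_zero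
      have h4 : (k.1 : ℝ) * k.1 + (k.2 : ℝ) * k.2 = 0 := by
        rcases mul_eq_zero.1 h3 with h3 | h3
        · exact absurd h3 (by positivity)
        · exact h3
      have h5 : (k.1 : ℝ) = 0 := by nlinarith [mul_self_nonneg (k.1 : ℝ), mul_self_nonneg (k.2 : ℝ)]
      have h6 : (k.2 : ℝ) = 0 := by nlinarith [mul_self_nonneg (k.1 : ℝ), mul_self_nonneg (k.2 : ℝ)]
      rcases hk0 with hk0 | hk0
      · exact hk0 (by exact_mod_cast h5)
      · exact hk0 (by exact_mod_cast h6)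
    · exact h2

/-! ### Families of smooth functions with rapidly decaying or tame derivatives -/

section Families

variable {ι : Type*} {E E' : Type*} [NormedAddCommGroup E] [NormedSpace ℝ E]
  [NormedAddCommGroup E'] [NormedSpace ℝ E']

/-- All derivatives are uniformly bounded, with rapid decay with respect to the weight. -/
def Rapid (wt : ι → ℝ) (u : ι → E → ℂ) : Prop :=
  (∀ i, ContDiff ℝ (⊤ : ℕ∞) (u i)) ∧
    ∀ n M : ℕ, ∃ C, ∀ i p, ‖iteratedFDeriv ℝ n (u i) p‖ * wt i ^ M ≤ C

/-- All derivatives are uniformly bounded, with polynomial growth with respect to the weight. -/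
def Tame (wt : ι → ℝ) (u : ι → E → ℂ) : Prop :=
  (∀ i, ContDiff ℝ (⊤ : ℕ∞) (u i)) ∧
    ∀ n : ℕ, ∃ C, ∃ M : ℕ, ∀ i p, ‖iteratedFDeriv ℝ n (u i) p‖ ≤ C * wt i ^ M

variable {wt : ι → ℝ}

lemma Rapid.mul_tame (hw : ∀ i, 1 ≤ wt i) {u v : ι → E → ℂ} (hu : Rapid wt u) (hv : Tame wt v) :
    Rapid wt fun i p => u i p * v i p := by
  refine ⟨fun i => (hu.1 i).mul (hv.1 i), fun n M => ?_⟩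
  choose C' M' hC' using hv.2
  choose C hC using hu.2
  refine ⟨∑ j ∈ Finset.range (n + 1), (n.choose j : ℝ) * (C j (M' (n - j) + M) * |C' (n - j)|),
    fun i p => ?_⟩
  have hwi : 0 < wt i := one_pos.trans_le (hw i)
  refine (mul_le_mul_of_nonneg_right (norm_iteratedFDeriv_mul_le (hu.1 i) (hv.1 i) p
    (n := n) (by exact_mod_cast le_top)) (by positivity)).trans ?_
  rw [Finset.sum_mul]
  refine Finset.sum_le_sum fun j _ => ?_
  have h1 := hC j (M' (n - j) + M) i p
  have h2 : ‖iteratedFDeriv ℝ (n - j) (v i) p‖ ≤ |C' (n - j)| * wt i ^ M' (n - j) :=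
    (hC' (n - j) i p).trans (mul_le_mul_of_nonneg_right (le_abs_self _) (by positivity))
  calc (n.choose j : ℝ) * ‖iteratedFDeriv ℝ j (u i) p‖ * ‖iteratedFDeriv ℝ (n - j) (v i) p‖ * wt i ^ M
      ≤ (n.choose j : ℝ) * ‖iteratedFDeriv ℝ j (u i) p‖ * (|C' (n - j)| * wt i ^ M' (n - j))
        * wt i ^ M := by gcongr
    _ = (n.choose j : ℝ) * ((‖iteratedFDeriv ℝ j (u i) p‖ * wt i ^ (M' (n - j) + M)) *
        |C' (n - j)|) := by rw [pow_add]; ring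
    _ ≤ _ := by gcongr

lemma Tame.mul (hw : ∀ i, 1 ≤ wt i) {u v : ι → E → ℂ} (hu : Tame wt u) (hv : Tame wt v) :
    Tame wt fun i p => u i p * v i p := by
  refine ⟨fun i => (hu.1 i).mul (hv.1 i), fun n => ?_⟩
  choose C' M' hC' using hv.2
  choose C M hC using hu.2
  refine ⟨∑ j ∈ Finset.range (n + 1), (n.choose j : ℝ) * (|C j| * |C' (n - j)|),
    ∑ j ∈ Finset.range (n + 1), (M j + M' (n - j)), fun i p => ?_⟩
  have hwi : 0 < wt i := one_pos.trans_le (hw i)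
  refine (norm_iteratedFDeriv_mul_le (hu.1 i) (hv.1 i) p
    (n := n) (by exact_mod_cast le_top)).trans ?_
  rw [Finset.sum_mul]
  refine Finset.sum_le_sum fun j hj => ?_
  have h1 : ‖iteratedFDeriv ℝ j (u i) p‖ ≤ |C j| * wt i ^ M j :=
    (hC j i p).trans (mul_le_mul_of_nonneg_right (le_abs_self _) (by positivity))
  have h2 : ‖iteratedFDeriv ℝ (n - j) (v i) p‖ ≤ |C' (n - j)| * wt i ^ M' (n - j) :=
    (hC' (n - j) i p).trans (mul_le_mul_of_nonneg_right (le_abs_self _) (by positivity))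
  calc (n.choose j : ℝ) * ‖iteratedFDeriv ℝ j (u i) p‖ * ‖iteratedFDeriv ℝ (n - j) (v i) p‖
      ≤ (n.choose j : ℝ) * (|C j| * wt i ^ M j) * (|C' (n - j)| * wt i ^ M' (n - j)) := by gcongr
    _ = (n.choose j : ℝ) * (|C j| * |C' (n - j)|) * wt i ^ (M j + M' (n - j)) := by
        rw [pow_add]; ring
    _ ≤ _ := by
        refine mul_le_mul_of_nonneg_left (pow_le_pow_right₀ (hw i) ?_) (by positivity)
        exact Finset.single_le_sum (f := fun j => M j + M' (n - j)) (fun _ _ => Nat.zero_le _) hj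

lemma Rapid.dd {u : ι → E → ℂ} (hw : ∀ i, 1 ≤ wt i) (hu : Rapid wt u) (w : E) :
    Rapid wt fun i => dd w (u i) := by
  refine ⟨fun i => (hu.1 i).dd_top w, fun n M => ?_⟩
  obtain ⟨C, hC⟩ := hu.2 (n + 1) M
  refine ⟨‖w‖ * C, fun i p => ?_⟩
  have hwi : 0 < wt i := one_pos.trans_le (hw i)
  have h1 : ContDiff ℝ (⊤ : ℕ∞) (fderiv ℝ (u i)) := (hu.1 i).fderiv_right (by simp)
  have h2 := norm_iteratedFDeriv_clm_apply_const (c := w) (x := p) (n := n) h1.contDiffAt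
    (by exact_mod_cast le_top)
  rw [norm_iteratedFDeriv_fderiv] at h2
  calc _ ≤ (‖w‖ * ‖iteratedFDeriv ℝ (n + 1) (u i) p‖) * wt i ^ M := by
        gcongr; exact h2
    _ = ‖w‖ * (‖iteratedFDeriv ℝ (n + 1) (u i) p‖ * wt i ^ M) := by ring
    _ ≤ _ := by gcongr; exact hC i p

lemma norm_iteratedFDeriv_comp_clm_le {F : Type*} [NormedAddCommGroup F] [NormedSpace ℝ F]
    {f : E → F} (hf : ContDiff ℝ (⊤ : ℕ∞) f) (L : E' →L[ℝ] E) (n : ℕ) (p : E') :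
    ‖iteratedFDeriv ℝ n (fun q => f (L q)) p‖ ≤ ‖iteratedFDeriv ℝ n f (L p)‖ * ‖L‖ ^ n := by
  have := L.iteratedFDeriv_comp_right hf p (i := n) (by exact_mod_cast le_top)
  change ‖iteratedFDeriv ℝ n (f ∘ L) p‖ ≤ _
  rw [this]
  refine (ContinuousMultilinearMap.norm_compContinuousLinearMap_le _ _).trans ?_
  simp

lemma Rapid.comp_clm (hw : ∀ i, 1 ≤ wt i) {u : ι → E → ℂ} (hu : Rapid wt u) (L : E' →L[ℝ] E) :
    Rapid wt fun i p => u i (L p) := by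
  refine ⟨fun i => (hu.1 i).comp L.contDiff, fun n M => ?_⟩
  obtain ⟨C, hC⟩ := hu.2 n M
  refine ⟨‖L‖ ^ n * C, fun i p => ?_⟩
  have hwi : 0 < wt i := one_pos.trans_le (hw i)
  calc _ ≤ (‖iteratedFDeriv ℝ n (u i) (L p)‖ * ‖L‖ ^ n) * wt i ^ M := by
        gcongr; exact norm_iteratedFDeriv_comp_clm_le (hu.1 i) L n p
    _ = ‖L‖ ^ n * (‖iteratedFDeriv ℝ n (u i) (L p)‖ * wt i ^ M) := by ring
    _ ≤ _ := by gcongr; exact hC i _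

lemma rapid_const {a : ι → ℂ} (h : ∀ M : ℕ, ∃ C, ∀ i, ‖a i‖ * wt i ^ M ≤ C) :
    Rapid wt fun i (_ : E) => a i := by
  refine ⟨fun i => contDiff_const, fun n M => ?_⟩
  obtain ⟨C, hC⟩ := h M
  rcases Nat.eq_zero_or_pos n with rfl | hn
  · exact ⟨C, fun i p => by simpa using hC i⟩
  · refine ⟨0, fun i p => ?_⟩
    rw [iteratedFDeriv_const_of_ne hn.ne']
    simp

lemma tame_const {a : ι → ℂ} {C : ℝ} {M : ℕ} (h : ∀ i, ‖a i‖ ≤ C * wt i ^ M) :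
    Tame wt fun i (_ : E) => a i := by
  refine ⟨fun i => contDiff_const, fun n => ?_⟩
  rcases Nat.eq_zero_or_pos n with rfl | hn
  · exact ⟨C, M, fun i p => by simpa using h i⟩
  · refine ⟨0, 0, fun i p => ?_⟩
    rw [iteratedFDeriv_const_of_ne hn.ne']
    simp

/-- The unitary exponential. -/
def ue (s : ℝ) : ℂ := Complex.exp ((s : ℂ) * Complex.I)

lemma norm_ue (s : ℝ) : ‖ue s‖ = 1 := Complex.norm_exp_ofReal_mul_I s

lemma ue_add (s t : ℝ) : ue (s + t) = ue s * ue t := by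
  simp only [ue, ← Complex.exp_add]; congr 1; push_cast; ring

lemma ue_zero : ue 0 = 1 := by simp [ue]

lemma ue_contDiff : ContDiff ℝ (⊤ : ℕ∞) ue :=
  (Complex.ofRealCLM.contDiff.mul contDiff_const).cexp

lemma ue_hasDerivAt (s : ℝ) : HasDerivAt ue (Complex.I * ue s) s := by
  have := ((Complex.ofRealCLM.hasDerivAt (x := s)).mul_const Complex.I).cexp
  convert! this using 1
  simp [ue]
  ring

lemma iteratedDeriv_ue (n : ℕ) : iteratedDeriv n ue = fun s => Complex.I ^ n * ue s := by
  induction n with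
  | zero => simp
  | succ n ih =>
    rw [iteratedDeriv_succ, ih]
    funext s
    rw [((ue_hasDerivAt s).const_mul _).deriv, pow_succ, mul_assoc]

lemma tame_ue (hw : ∀ i, 1 ≤ wt i) {L : ι → E →L[ℝ] ℝ} {C : ℝ} (h : ∀ i, ‖L i‖ ≤ C * wt i) :
    Tame wt fun i p => ue (L i p) := by
  refine ⟨fun i => ue_contDiff.comp (L i).contDiff, fun n => ⟨C ^ n, n, fun i p => ?_⟩⟩
  have hwi : 0 < wt i := one_pos.trans_le (hw i)
  refine (norm_iteratedFDeriv_comp_clm_le ue_contDiff (L i) n p).trans ?_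
  rw [norm_iteratedFDeriv_eq_norm_iteratedDeriv, iteratedDeriv_ue, norm_mul, norm_ue, norm_pow,
    Complex.norm_I, one_pow, one_mul, one_mul, ← mul_pow]
  gcongr
  exact h i

lemma Rapid.bound {M₀ : ℕ} (hw : ∀ i, 1 ≤ wt i)
    (hs : Summable fun i => (wt i ^ M₀)⁻¹) {u : ι → E → ℂ} (hu : Rapid wt u) (n : ℕ) :
    ∃ v : ι → ℝ, Summable v ∧ ∀ i p, ‖iteratedFDeriv ℝ n (u i) p‖ ≤ v i := by
  obtain ⟨C, hC⟩ := hu.2 n M₀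
  refine ⟨fun i => C * (wt i ^ M₀)⁻¹, hs.mul_left C, fun i p => ?_⟩
  have hwi : 0 < wt i ^ M₀ := pow_pos (one_pos.trans_le (hw i)) _
  beta_reduce
  rw [← div_eq_mul_inv, le_div_iff₀ hwi]
  exact hC i p

lemma Rapid.norm_bound {M₀ : ℕ} (hw : ∀ i, 1 ≤ wt i)
    (hs : Summable fun i => (wt i ^ M₀)⁻¹) {u : ι → E → ℂ} (hu : Rapid wt u) :
    ∃ v : ι → ℝ, Summable v ∧ ∀ i p, ‖u i p‖ ≤ v i := by
  simpa using hu.bound hw hs 0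

lemma Rapid.contDiff_tsum {M₀ : ℕ} (hw : ∀ i, 1 ≤ wt i)
    (hs : Summable fun i => (wt i ^ M₀)⁻¹) {u : ι → E → ℂ} (hu : Rapid wt u) :
    ContDiff ℝ (⊤ : ℕ∞) fun p => ∑' i, u i p := by
  choose v hv hv' using fun n => hu.bound hw hs n
  exact _root_.contDiff_tsum hu.1 (fun k _ => hv k) fun k i x _ => hv' k i x

lemma Rapid.dd_tsum {M₀ : ℕ} (hw : ∀ i, 1 ≤ wt i)
    (hs : Summable fun i => (wt i ^ M₀)⁻¹) {u : ι → E → ℂ} (hu : Rapid wt u) (w : E) :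
    _root_.dd w (fun p => ∑' i, u i p) = fun p => ∑' i, _root_.dd w (u i) p := by
  funext p
  obtain ⟨v, hv, hv'⟩ := hu.bound hw hs 1
  obtain ⟨v₀, hv₀, hv₀'⟩ := hu.norm_bound hw hs
  have hb : ∀ i q, ‖fderiv ℝ (u i) q‖ ≤ v i := fun i q => by
    have := hv' i q
    rwa [norm_iteratedFDeriv_one] at this
  have hsum : Summable fun i => u i p := Summable.of_norm_bounded hv₀ fun i => hv₀' i p
  have h := hasFDerivAt_tsum hv (fun i q => ((hu.1 i).differentiable_top q).hasFDerivAt)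
    hb hsum p
  simp only [_root_.dd]
  rw [h.fderiv]
  have hs' : Summable fun i => fderiv ℝ (u i) p := Summable.of_norm_bounded hv fun i => hb i p
  exact ((ContinuousLinearMap.apply ℝ ℂ w).hasSum hs'.hasSum).tsum_eq.symm

end Families

/-- Weight on the lattice of frequencies. -/
def lw (l : ℤ × ℤ) : ℝ := 1 + |(l.1 : ℝ)| + |(l.2 : ℝ)|

lemma one_le_lw (l : ℤ × ℤ) : 1 ≤ lw l := by
  unfold lw; linarith [abs_nonneg (l.1 : ℝ), abs_nonneg (l.2 : ℝ)]

lemma lw_pos (l : ℤ × ℤ) : 0 < lw l := one_pos.trans_le (one_le_lw l)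

lemma lw_add_le (l k : ℤ × ℤ) : lw (l + k) ≤ lw l * lw k := by
  simp only [lw, Prod.fst_add, Prod.snd_add]
  push_cast
  have h1 := abs_add_le (l.1 : ℝ) k.1
  have h2 := abs_add_le (l.2 : ℝ) k.2
  nlinarith [abs_nonneg (l.1 : ℝ), abs_nonneg (l.2 : ℝ), abs_nonneg (k.1 : ℝ),
    abs_nonneg (k.2 : ℝ), mul_nonneg (abs_nonneg (l.1 : ℝ)) (abs_nonneg (k.1 : ℝ)),
    mul_nonneg (abs_nonneg (l.1 : ℝ)) (abs_nonneg (k.2 : ℝ)),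
    mul_nonneg (abs_nonneg (l.2 : ℝ)) (abs_nonneg (k.1 : ℝ)),
    mul_nonneg (abs_nonneg (l.2 : ℝ)) (abs_nonneg (k.2 : ℝ))]

lemma summable_one_add_abs : Summable fun n : ℤ => ((1 + |(n : ℝ)|) ^ 2)⁻¹ := by
  have h : Summable fun n : ℕ => ((1 + (n : ℝ)) ^ 2)⁻¹ := by
    have := (summable_nat_add_iff 1).2 (Real.summable_nat_pow_inv.2 one_lt_two)
    refine this.congr fun n => ?_
    push_cast
    rw [add_comm]
  refine Summable.of_nat_of_neg ?_ ?_ <;> simpa using h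

lemma summable_lw : Summable fun l => (lw l ^ 4)⁻¹ := by
  have h := summable_one_add_abs.mul_of_nonneg summable_one_add_abs
    (fun n => by positivity) (fun n => by positivity)
  refine Summable.of_nonneg_of_le (fun l => by have := lw_pos l; positivity) (fun l => ?_) h
  rw [← mul_inv]
  have h1 : 1 + |(l.1 : ℝ)| ≤ lw l := by unfold lw; linarith [abs_nonneg (l.2 : ℝ)]
  have h2 : 1 + |(l.2 : ℝ)| ≤ lw l := by unfold lw; linarith [abs_nonneg (l.1 : ℝ)]
  gcongr
  calc (1 + |(l.1 : ℝ)|) ^ 2 * (1 + |(l.2 : ℝ)|) ^ 2 ≤ lw l ^ 2 * lw l ^ 2 := by gcongr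
    _ = lw l ^ 4 := by ring

/-! ### Fourier coefficients of functions with parameters -/

section ParamFourier

variable {E : Type} [NormedAddCommGroup E] [NormedSpace ℝ E]

lemma lw_mul_norm_le (l : ℤ × ℤ) (z : ℂ) : ‖z‖ * lw l ≤ ‖z‖ +
    ‖((2 * π * (l.1 * 1 + l.2 * 0) : ℝ) : ℂ) * Complex.I * z‖ +
    ‖((2 * π * (l.1 * 0 + l.2 * 1) : ℝ) : ℂ) * Complex.I * z‖ := by
  simp only [norm_mul, Complex.norm_real, Complex.norm_I, mul_one, mul_zero, add_zero, zero_add,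
    norm_eq_abs, abs_mul, abs_two, abs_of_pos pi_pos]
  unfold lw
  have hpi := pi_gt_three
  have h1 : |(l.1 : ℝ)| ≤ 2 * π * |(l.1 : ℝ)| :=
    le_mul_of_one_le_left (abs_nonneg _) (by linarith)
  have h2 : |(l.2 : ℝ)| ≤ 2 * π * |(l.2 : ℝ)| :=
    le_mul_of_one_le_left (abs_nonneg _) (by linarith)
  nlinarith [mul_le_mul_of_nonneg_left h1 (norm_nonneg z),
    mul_le_mul_of_nonneg_left h2 (norm_nonneg z)]

lemma FT_slice_dd {u : E × V2 → ℂ} (hu : ContDiff ℝ (⊤ : ℕ∞) u) (hp : SPer u) (p : E) (w : V2)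
    (l : ℤ × ℤ) : FT (fun x => dd ((0 : E), w) u (p, x)) l =
      (2 * π * (l.1 * w.1 + l.2 * w.2) : ℝ) * Complex.I * FT (fun x => u (p, x)) l := by
  rw [← FT_dd (φ := fun x => u (p, x)) (hu.comp (by fun_prop)) (hp p)]
  congr 1
  funext x
  exact (dd_slice hu.differentiable_top p w x).symm

lemma FT_decay {S : Set E} (hS : IsCompact S) (M : ℕ) : ∀ {u : E × V2 → ℂ},
    ContDiff ℝ (⊤ : ℕ∞) u → SPer u →
    ∃ C, 0 ≤ C ∧ ∀ p ∈ S, ∀ l, ‖FT (fun x => u (p, x)) l‖ * lw l ^ M ≤ C := by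
  induction M with
  | zero =>
    intro u hu hp
    obtain ⟨C, h0, hC⟩ := hp.bounded_compact hu.continuous hS
    exact ⟨C, h0, fun p hpS l => by simpa using norm_FT_le (hC p hpS) l⟩
  | succ M ih =>
    intro u hu hp
    obtain ⟨C, h0, hC⟩ := ih hu hp
    obtain ⟨C₁, h1, hC₁⟩ := ih (hu.dd_top ((0 : E), ((1 : ℝ), (0 : ℝ)))) (hp.dd _)
    obtain ⟨C₂, h2, hC₂⟩ := ih (hu.dd_top ((0 : E), ((0 : ℝ), (1 : ℝ)))) (hp.dd _)
    refine ⟨C + C₁ + C₂, by positivity, fun p hpS l => ?_⟩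
    have e1 := hC p hpS l
    have e2 := hC₁ p hpS l
    have e3 := hC₂ p hpS l
    rw [FT_slice_dd hu hp] at e2 e3
    have hl := lw_pos l
    calc _ = (‖FT (fun x => u (p, x)) l‖ * lw l) * lw l ^ M := by ring
      _ ≤ _ * lw l ^ M := mul_le_mul_of_nonneg_right (lw_mul_norm_le l _) (by positivity)
      _ ≤ _ := by rw [add_mul, add_mul]; linarith

lemma contDiff_FT [ProperSpace E] {u : E × V2 → ℂ} (hu : ContDiff ℝ (⊤ : ℕ∞) u) (l : ℤ × ℤ) :
    ContDiff ℝ (⊤ : ℕ∞) fun p => FT (fun x => u (p, x)) l :=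
  contDiff_paramIntegral unitSq_compact (u := fun q : E × V2 => u q * ch (-l) q.2)
    (hu.mul ((ch_contDiff _).comp contDiff_snd))

lemma dd_FT [ProperSpace E] {u : E × V2 → ℂ} (hu : ContDiff ℝ (⊤ : ℕ∞) u) (w : E) (l : ℤ × ℤ)
    (p : E) : dd w (fun p => FT (fun x => u (p, x)) l) p =
      FT (fun x => dd (w, (0 : V2)) u (p, x)) l := by
  have hc : ContDiff ℝ (⊤ : ℕ∞) fun q : E × V2 => ch (-l) q.2 :=
    (ch_contDiff _).comp contDiff_snd
  have h := dd_paramIntegral (μ := volume) unitSq_compact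
    (u := fun q : E × V2 => u q * ch (-l) q.2) (hu.mul hc) w p
  have e : dd (w, (0 : V2)) (fun q : E × V2 => ch (-l) q.2) = fun _ => 0 := by
    funext q
    have h1 : HasFDerivAt (fun q : E × V2 => ch (-l) q.2) _ q :=
      ((ch_contDiff (-l)).differentiable_top q.2).hasFDerivAt.comp q hasFDerivAt_snd
    simp only [dd]
    rw [h1.fderiv]; simp
  rw [dd_mul hu.differentiable_top hc.differentiable_top, e] at h
  simpa [FT] using h

end ParamFourier

lemma deriv_eq_dd {F : Type*} [NormedAddCommGroup F] [NormedSpace ℝ F] (f : ℝ → F) :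
    deriv f = dd (1 : ℝ) f := by
  funext t; simp [dd]

lemma dd_dT_eq_zero {u : ℝ × V2 → ℂ} {T : ℝ}
    (hz : ∀ t x, t < 0 ∨ T < t → u (t, x) = 0) (w : ℝ × V2) :
    ∀ t x, t < 0 ∨ T < t → dd w u (t, x) = 0 := by
  intro t x ht
  refine dd_eq_zero_of_eventually w ?_
  have : IsOpen {p : ℝ × V2 | p.1 < 0 ∨ T < p.1} :=
    (isOpen_lt continuous_fst continuous_const).union (isOpen_lt continuous_const continuous_fst)
  filter_upwards [this.mem_nhds (show (t, x) ∈ {p : ℝ × V2 | p.1 < 0 ∨ T < p.1} from ht)] with p hp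
  exact hz p.1 p.2 hp

lemma rapid_FT {T : ℝ} {u : ℝ × V2 → ℂ} (hu : ContDiff ℝ (⊤ : ℕ∞) u) (hp : SPer u)
    (hz : ∀ t x, t < 0 ∨ T < t → u (t, x) = 0) :
    Rapid lw fun l t => FT (fun x => u (t, x)) l := by
  refine ⟨fun l => contDiff_FT hu l, fun n M => ?_⟩
  simp only [norm_iteratedFDeriv_eq_norm_iteratedDeriv]
  induction n generalizing u with
  | zero =>
    obtain ⟨C, h0, hC⟩ := FT_decay (isCompact_Icc (a := 0) (b := T)) M hu hp
    refine ⟨C, fun l t => ?_⟩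
    rw [iteratedDeriv_zero]
    by_cases ht : t ∈ Set.Icc 0 T
    · exact hC t ht l
    · have : t < 0 ∨ T < t := by
        by_contra! h; exact ht h
      simp [hz _ _ this, FT, h0]
  | succ n ih =>
    obtain ⟨C, hC⟩ := ih (hu.dd_top dT) (hp.dd _) (dd_dT_eq_zero hz _)
    refine ⟨C, fun l t => ?_⟩
    rw [iteratedDeriv_succ', deriv_eq_dd]
    have : dd (1 : ℝ) (fun t => FT (fun x => u (t, x)) l) =
        fun t => FT (fun x => dd dT u (t, x)) l := by
      funext t; exact dd_FT hu 1 l t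
    rw [this]
    exact hC l t

lemma rapid_of_hasDerivAt {ι : Type*} {wt : ι → ℝ} {A a : ι → ℝ → ℂ}
    (hd : ∀ i t, HasDerivAt (A i) (a i t) t) (ha : Rapid wt a)
    (hA : ∀ M : ℕ, ∃ C, ∀ i t, ‖A i t‖ * wt i ^ M ≤ C) : Rapid wt A := by
  have hder : ∀ i, deriv (A i) = a i := fun i => funext fun t => (hd i t).deriv
  refine ⟨fun i => contDiff_infty_iff_deriv.2 ⟨fun t => (hd i t).differentiableAt, ?_⟩,
    fun n M => ?_⟩
  · rw [hder]; exact ha.1 i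
  · cases n with
    | zero => simpa using hA M
    | succ n =>
      obtain ⟨C, hC⟩ := ha.2 n M
      refine ⟨C, fun i t => ?_⟩
      have := hC i t
      rw [norm_iteratedFDeriv_eq_norm_iteratedDeriv] at this ⊢
      rwa [iteratedDeriv_succ', hder]

/-- Interchange of a series and an integral over a compact set. -/
lemma setIntegral_tsum {ι : Type*} [Countable ι] {G : Type*} [TopologicalSpace G]
    [MeasurableSpace G] [BorelSpace G] [T2Space G] {μ : Measure G} [IsFiniteMeasureOnCompacts μ]
    {K : Set G} (hK : IsCompact K) {u : ι → G → ℂ} (hu : ∀ i, Continuous (u i)) {v : ι → ℝ}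
    (hv : Summable v) (hb : ∀ i x, ‖u i x‖ ≤ v i) :
    ∫ x in K, ∑' i, u i x ∂μ = ∑' i, ∫ x in K, u i x ∂μ := by
  refine (integral_tsum_of_summable_integral_norm (fun i =>
    (hu i).continuousOn.integrableOn_compact hK) ?_).symm
  refine Summable.of_nonneg_of_le (fun i => integral_nonneg fun x => norm_nonneg _) (fun i => ?_)
    (hv.mul_right (μ.real K))
  refine (le_abs_self _).trans ?_
  refine norm_setIntegral_le_of_norm_le_const (f := fun x => ‖u i x‖) hK.measure_lt_top
    (fun x _ => ?_)
  simpa using hb i x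

lemma FT_tsum {ι : Type*} [Countable ι] {u : ι → V2 → ℂ} (hu : ∀ i, Continuous (u i)) {v : ι → ℝ}
    (hv : Summable v) (hb : ∀ i x, ‖u i x‖ ≤ v i) (m : ℤ × ℤ) :
    FT (fun x => ∑' i, u i x) m = ∑' i, FT (u i) m := by
  simp only [FT, ← tsum_mul_right]
  exact setIntegral_tsum unitSq_compact (fun i => (hu i).mul (ch_contDiff _).continuous) hv
    fun i x => by simpa [norm_ch] using hb i x

lemma FT_const_mul (a : ℂ) (φ : V2 → ℂ) (m : ℤ × ℤ) :
    FT (fun x => a * φ x) m = a * FT φ m := by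
  simp only [FT, mul_assoc, integral_const_mul]

lemma FT_sub {φ ψ : V2 → ℂ} (hf : Continuous φ) (hg : Continuous ψ) (m : ℤ × ℤ) :
    FT (fun x => φ x - ψ x) m = FT φ m - FT ψ m := by
  simp only [FT, sub_mul]
  exact integral_sub
    ((hf.mul (ch_contDiff _).continuous).continuousOn.integrableOn_compact unitSq_compact)
    ((hg.mul (ch_contDiff _).continuous).continuousOn.integrableOn_compact unitSq_compact)

lemma FT_add {φ ψ : V2 → ℂ} (hf : Continuous φ) (hg : Continuous ψ) (m : ℤ × ℤ) :
    FT (fun x => φ x + ψ x) m = FT φ m + FT ψ m := by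
  simp only [FT, add_mul]
  exact integral_add
    ((hf.mul (ch_contDiff _).continuous).continuousOn.integrableOn_compact unitSq_compact)
    ((hg.mul (ch_contDiff _).continuous).continuousOn.integrableOn_compact unitSq_compact)

lemma FT_tsum_ch {a : ℤ × ℤ → ℂ} (ha : Summable fun l => ‖a l‖) (m : ℤ × ℤ) :
    FT (fun x => ∑' l, a l * ch l x) m = a m := by
  rw [FT_tsum (u := fun l x => a l * ch l x) (fun i => continuous_const.mul (ch_contDiff _).continuous) ha
    (fun i x => by simp [norm_ch])]
  simp only [FT_const_mul, FT_ch]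
  rw [tsum_eq_single m (fun l hl => by simp [hl])]
  simp

lemma fourier_inversion {φ : V2 → ℂ} (hf : Continuous φ) (pf : Zper φ)
    (hs : Summable fun l => ‖FT φ l‖) (x : V2) : φ x = ∑' l, FT φ l * ch l x := by
  have hc : Continuous fun x => ∑' l, FT φ l * ch l x :=
    continuous_tsum (fun l => continuous_const.mul (ch_contDiff _).continuous) hs
      (fun i x => by simp [norm_ch])
  refine sub_eq_zero.1 (eq_zero_of_FT_eq_zero (φ := fun x => φ x - ∑' l, FT φ l * ch l x)
    (hf.sub hc) (fun x m n => ?_) (fun m => ?_) x)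
  · have h : ∀ l, ch l (x.1 + m, x.2 + n) = ch l x := fun l => ch_per l x m n
    simp only [pf x m n, h]
  · rw [FT_sub hf hc, FT_tsum_ch hs, sub_self]

/-! ### The wave equation on the torus with orthogonal sources -/

/-- Wave frequency of a Fourier mode. -/
def nu (c : ℝ) (l : ℤ × ℤ) : ℝ := 2 * π * c * en ((l.1 : ℝ), (l.2 : ℝ))

/-- Space-time Fourier coefficient. -/
def J (T : ℝ) (u : ℝ × V2 → ℂ) (l : ℤ × ℤ) (σ : ℝ) : ℂ :=
  ∫ t in (0 : ℝ)..T, FT (fun x => u (t, x)) l * ue (-(σ * t))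

lemma en_le_lw (l : ℤ × ℤ) : en ((l.1 : ℝ), (l.2 : ℝ)) ≤ lw l := by
  unfold en lw
  rw [sqrt_le_left (by positivity)]
  nlinarith [sq_abs (l.1 : ℝ), sq_abs (l.2 : ℝ), abs_nonneg (l.1 : ℝ), abs_nonneg (l.2 : ℝ),
    mul_nonneg (abs_nonneg (l.1 : ℝ)) (abs_nonneg (l.2 : ℝ))]

lemma nu_sq (c : ℝ) (l : ℤ × ℤ) : nu c l ^ 2 = (2 * π * c) ^ 2 * ((l.1 : ℝ) ^ 2 + (l.2 : ℝ) ^ 2) := by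
  unfold nu; rw [mul_pow, en_sq]

lemma one_le_en_int {l : ℤ × ℤ} (hl : l ≠ 0) : 1 ≤ en ((l.1 : ℝ), (l.2 : ℝ)) := by
  unfold en
  rw [one_le_sqrt]
  have h : 1 ≤ l.1 ^ 2 + l.2 ^ 2 := by
    by_contra! h
    have h1 : l.1 = 0 := by nlinarith [sq_nonneg l.1, sq_nonneg l.2]
    have h2 : l.2 = 0 := by nlinarith [sq_nonneg l.1, sq_nonneg l.2]
    exact hl (Prod.ext h1 h2)
  change (1 : ℝ) ≤ (l.1 : ℝ) ^ 2 + (l.2 : ℝ) ^ 2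
  exact_mod_cast h

lemma nu_pos {c : ℝ} (hc : 0 < c) {l : ℤ × ℤ} (hl : l ≠ 0) : 0 < nu c l := by
  have := one_le_en_int hl
  have := pi_pos
  unfold nu; positivity

lemma ue_mul_hasDerivAt (a t : ℝ) :
    HasDerivAt (fun t : ℝ => ue (a * t)) (a * Complex.I * ue (a * t)) t := by
  have := (ue_hasDerivAt (a * t)).scomp t ((hasDerivAt_id t).const_mul a)
  convert! this using 1
  simp
  ring

lemma tame_ue_time {a : ℤ × ℤ → ℝ} {C : ℝ} (h : ∀ l, |a l| ≤ C * lw l) :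
    Tame lw fun l (t : ℝ) => ue (a l * t) :=
  tame_ue one_le_lw (L := fun l => a l • ContinuousLinearMap.id ℝ ℝ) (C := C) fun l => by
    rw [norm_smul]
    refine (mul_le_mul_of_nonneg_left ContinuousLinearMap.norm_id_le (norm_nonneg _)).trans ?_
    simpa using h l

lemma tame_ch : Tame lw fun l (x : V2) => ch l x := by
  have := tame_ue (E := V2) one_le_lw (L := fun l : ℤ × ℤ =>
    (2 * π * l.1) • ContinuousLinearMap.fst ℝ ℝ ℝ + (2 * π * l.2) • ContinuousLinearMap.snd ℝ ℝ ℝ)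
    (C := 2 * π) fun l => by
      refine (norm_add_le _ _).trans ?_
      rw [norm_smul, norm_smul]
      have h1 := ContinuousLinearMap.norm_fst_le ℝ ℝ ℝ
      have h2 := ContinuousLinearMap.norm_snd_le ℝ ℝ ℝ
      have e1 : ‖2 * π * (l.1 : ℝ)‖ = 2 * π * |(l.1 : ℝ)| := by simp [abs_of_pos pi_pos]
      have e2 : ‖2 * π * (l.2 : ℝ)‖ = 2 * π * |(l.2 : ℝ)| := by simp [abs_of_pos pi_pos]
      rw [e1, e2]
      have := pi_pos
      unfold lw
      have h3 := mul_le_mul_of_nonneg_left h1 (by positivity : 0 ≤ 2 * π * |(l.1 : ℝ)|)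
      have h4 := mul_le_mul_of_nonneg_left h2 (by positivity : 0 ≤ 2 * π * |(l.2 : ℝ)|)
      nlinarith
  convert! this using 3 with l x
  simp only [ue, ch]
  congr 3
  simp
  ring

lemma Tame.comp_clm {ι E E' : Type*} [NormedAddCommGroup E] [NormedSpace ℝ E]
    [NormedAddCommGroup E'] [NormedSpace ℝ E'] {wt : ι → ℝ} {u : ι → E → ℂ} (hu : Tame wt u)
    (L : E' →L[ℝ] E) : Tame wt fun i p => u i (L p) := by
  refine ⟨fun i => (hu.1 i).comp L.contDiff, fun n => ?_⟩
  obtain ⟨C, M, hC⟩ := hu.2 n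
  refine ⟨C * ‖L‖ ^ n, M, fun i p => ?_⟩
  calc _ ≤ ‖iteratedFDeriv ℝ n (u i) (L p)‖ * ‖L‖ ^ n :=
        norm_iteratedFDeriv_comp_clm_le (hu.1 i) L n p
    _ ≤ (C * wt i ^ M) * ‖L‖ ^ n := by gcongr; exact hC i _
    _ = _ := by ring

/-- Time primitives of rapidly decaying families with compact support and vanishing integral. -/
lemma rapid_primitive {T : ℝ} (hT : 0 < T) {a : ℤ × ℤ → ℝ → ℂ} (ha : Rapid lw a)
    (hz : ∀ l t, t < 0 ∨ T < t → a l t = 0) (hi : ∀ l, ∫ t in (0 : ℝ)..T, a l t = 0) :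
    Rapid lw (fun l t => ∫ s in (0 : ℝ)..t, a l s) ∧
      (∀ l t, HasDerivAt (fun t => ∫ s in (0 : ℝ)..t, a l s) (a l t) t) ∧
      ∀ l t, t ≤ 0 ∨ T ≤ t → ∫ s in (0 : ℝ)..t, a l s = 0 := by
  have hco : ∀ l, Continuous (a l) := fun l => (ha.1 l).continuous
  have hd : ∀ l t, HasDerivAt (fun t => ∫ s in (0 : ℝ)..t, a l s) (a l t) t := fun l t =>
    intervalIntegral.integral_hasDerivAt_right ((hco l).intervalIntegrable _ _)
      ((hco l).stronglyMeasurableAtFilter _ _) (hco l).continuousAt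
  have hz0 : ∀ l t, t ≤ 0 ∨ T ≤ t → ∫ s in (0 : ℝ)..t, a l s = 0 := by
    intro l t ht
    rcases ht with ht | ht
    · rw [intervalIntegral.integral_symm, intervalIntegral.integral_of_le ht, ←
        integral_Ico_eq_integral_Ioc, integral_Ico_eq_integral_Ioo,
        setIntegral_eq_zero_of_forall_eq_zero fun s hs => hz l s (Or.inl hs.2), neg_zero]
    · rw [← intervalIntegral.integral_add_adjacent_intervals
        ((hco l).intervalIntegrable 0 T) ((hco l).intervalIntegrable T t), hi l, zero_add,
        intervalIntegral.integral_of_le ht,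
        setIntegral_eq_zero_of_forall_eq_zero fun s hs => hz l s (Or.inr hs.1)]
  refine ⟨rapid_of_hasDerivAt hd ha fun M => ?_, hd, hz0⟩
  obtain ⟨C, hC⟩ := ha.2 0 M
  simp only [norm_iteratedFDeriv_zero] at hC
  have hC0 : 0 ≤ C := (mul_nonneg (norm_nonneg _) (pow_nonneg (lw_pos 0).le M)).trans (hC 0 0)
  refine ⟨C * T, fun l t => ?_⟩
  have hl := pow_pos (lw_pos l) M
  by_cases ht : t ≤ 0 ∨ T ≤ t
  · rw [hz0 l t ht]; simp; positivity
  · push Not at ht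
    have h1 : ‖∫ s in (0 : ℝ)..t, a l s‖ ≤ (C / lw l ^ M) * |t - 0| :=
      intervalIntegral.norm_integral_le_of_norm_le_const fun s _ => by
        rw [le_div_iff₀ hl]; exact hC l s
    rw [sub_zero, abs_of_pos ht.1] at h1
    calc _ ≤ C / lw l ^ M * t * lw l ^ M := by gcongr
      _ = C * t := by field_simp
      _ ≤ _ := by gcongr; exact ht.2.le

lemma dd_sep {A : ℝ → ℂ} {A' : ℂ} {p : ℝ × V2} (hA : HasDerivAt A A' p.1) (l : ℤ × ℤ)
    (w : ℝ × V2) : dd w (fun p : ℝ × V2 => A p.1 * ch l p.2) p = w.1 * A' * ch l p.2 +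
      A p.1 * ((2 * π * (l.1 * w.2.1 + l.2 * w.2.2) : ℝ) * Complex.I * ch l p.2) := by
  have h1 : HasFDerivAt (fun p : ℝ × V2 => A p.1) _ p := hA.hasFDerivAt.comp p hasFDerivAt_fst
  have h2 : HasFDerivAt (fun p : ℝ × V2 => ch l p.2) _ p :=
    ((ch_contDiff l).differentiable_top p.2).hasFDerivAt.comp p hasFDerivAt_snd
  have h3 := congrFun (dd_ch l w.2) p.2
  simp only [dd] at h3 ⊢
  have h4 : HasFDerivAt (fun p : ℝ × V2 => A p.1 * ch l p.2) _ p := h1.mul h2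
  rw [h4.fderiv]
  simp [h3]
  ring

theorem exists_wave {c T : ℝ} (hc : 0 < c) (hT : 0 < T) {q : ℝ × V2 → ℂ}
    (hq : ContDiff ℝ (⊤ : ℕ∞) q) (pq : SPer q) (zq : ∀ t x, t < 0 ∨ T < t → q (t, x) = 0)
    (h0 : ∀ t, FT (fun x => q (t, x)) 0 = 0)
    (ho : ∀ l ≠ 0, J T q l (nu c l) = 0 ∧ J T q l (-nu c l) = 0) :
    ∃ Y : ℝ × V2 → ℂ, ContDiff ℝ (⊤ : ℕ∞) Y ∧ SPer Y ∧
      (∀ t x, t ≤ 0 ∨ T ≤ t → Y (t, x) = 0) ∧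
      ∀ p, dd dT (dd dT Y) p = (c : ℂ) ^ 2 * (dd dX (dd dX Y) p + dd dY (dd dY Y) p) + q p := by
  set ql : ℤ × ℤ → ℝ → ℂ := fun l t => FT (fun x => q (t, x)) l with hql
  have rq : Rapid lw ql := rapid_FT hq pq zq
  have hnu : ∀ l, |nu c l| ≤ 2 * π * c * lw l := fun l => by
    have h1 : 0 ≤ en ((l.1 : ℝ), (l.2 : ℝ)) := sqrt_nonneg _
    unfold nu
    have := pi_pos
    rw [abs_of_nonneg (by positivity)]
    gcongr
    exact en_le_lw l
  have hnu' : ∀ l, |-nu c l| ≤ 2 * π * c * lw l := fun l => by rw [abs_neg]; exact hnu l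
  have prim : ∀ s : ℤ × ℤ → ℝ, (∀ l, |s l| ≤ 2 * π * c * lw l) → (∀ l, J T q l (-s l) = 0) → _ :=
    fun s hs hJ => rapid_primitive hT (a := fun l t => ql l t * ue (s l * t))
      (rq.mul_tame one_le_lw (tame_ue_time hs))
      (fun l t ht => by simp [hql, FT, zq t _ ht]) (fun l => by simpa [J] using hJ l)
  have hJ0 : J T q 0 0 = 0 := by simp [J, h0]
  have nu0 : nu c 0 = 0 := by simp [nu, en]
  obtain ⟨rA, dA, zA⟩ := prim (fun l => -nu c l) hnu' fun l => by
    rw [neg_neg]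
    by_cases hl : l = 0
    · rw [hl, nu0, hJ0]
    · exact (ho l hl).1
  obtain ⟨rB, dB, zB⟩ := prim (nu c) hnu fun l => by
    by_cases hl : l = 0
    · rw [hl, nu0, neg_zero, hJ0]
    · exact (ho l hl).2
  set A : ℤ × ℤ → ℝ → ℂ := fun l t => ∫ s in (0 : ℝ)..t, ql l s * ue (-nu c l * s) with hA
  set B : ℤ × ℤ → ℝ → ℂ := fun l t => ∫ s in (0 : ℝ)..t, ql l s * ue (nu c l * s) with hB
  replace dA : ∀ l t, HasDerivAt (A l) (ql l t * ue (-nu c l * t)) t := dA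
  replace dB : ∀ l t, HasDerivAt (B l) (ql l t * ue (nu c l * t)) t := dB
  replace zA : ∀ l t, t ≤ 0 ∨ T ≤ t → A l t = 0 := zA
  replace zB : ∀ l t, t ≤ 0 ∨ T ≤ t → B l t = 0 := zB
  set κ : ℤ × ℤ → ℂ := fun l => (2 * Complex.I * nu c l)⁻¹ with hκ
  set y : ℤ × ℤ → ℝ → ℂ := fun l t =>
    (A l t * ue (nu c l * t) + -1 * (B l t * ue (-nu c l * t))) * κ l with hy
  set y' : ℤ × ℤ → ℝ → ℂ := fun l t =>
    if l = 0 then 0 else (A l t * ue (nu c l * t) + B l t * ue (-nu c l * t)) / 2 with hy'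
  have tκ : Tame lw fun l (_ : ℝ) => κ l := by
    refine tame_const (C := (2 * (2 * π * c))⁻¹) (M := 0) fun l => ?_
    rw [pow_zero, mul_one]
    have hp : 0 < 2 * (2 * π * c) := by have := pi_pos; positivity
    by_cases hl : l = 0
    · simp only [hκ, hl, nu0]; simp; positivity
    · simp only [hκ, norm_inv]
      gcongr
      have h1 := one_le_en_int hl
      have h2 := nu_pos hc hl
      simp only [norm_mul, Complex.norm_I, Complex.norm_real, norm_eq_abs, abs_of_pos h2]
      simp only [Complex.norm_ofNat, mul_one]
      unfold nu
      have := pi_pos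
      have h3 : 0 < 2 * π * c := by positivity
      nlinarith
  have rA' := rA.mul_tame one_le_lw (tame_ue_time hnu)
  have rB' := rB.mul_tame one_le_lw (tame_ue_time hnu')
  have ry1 : Rapid lw fun l t => (A l t * ue (nu c l * t)) * κ l := rA'.mul_tame one_le_lw tκ
  have ry2 : Rapid lw fun l t => (B l t * ue (-nu c l * t)) * κ l := rB'.mul_tame one_le_lw tκ
  have ry : Rapid lw y := by
    refine ⟨fun l => ?_, fun n M => ?_⟩
    · have e : y l = fun t => (A l t * ue (nu c l * t)) * κ l -
          (B l t * ue (-nu c l * t)) * κ l := by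
        funext t; simp only [hy]; ring
      rw [e]
      exact (ry1.1 l).sub (ry2.1 l)
    · obtain ⟨C1, hC1⟩ := ry1.2 n M
      obtain ⟨C2, hC2⟩ := ry2.2 n M
      refine ⟨C1 + C2, fun l t => ?_⟩
      have e : y l = (fun t => (A l t * ue (nu c l * t)) * κ l) -
          fun t => (B l t * ue (-nu c l * t)) * κ l := by
        funext t; simp only [hy, Pi.sub_apply]; ring
      rw [e, iteratedFDeriv_sub_apply ((ry1.1 l).of_le (by exact_mod_cast le_top)).contDiffAt
        ((ry2.1 l).of_le (by exact_mod_cast le_top)).contDiffAt]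
      have h := norm_sub_le (iteratedFDeriv ℝ n (fun t => (A l t * ue (nu c l * t)) * κ l) t)
        (iteratedFDeriv ℝ n (fun t => (B l t * ue (-nu c l * t)) * κ l) t)
      have hw := pow_pos (lw_pos l) M
      have := mul_le_mul_of_nonneg_right h hw.le
      rw [add_mul] at this
      linarith [hC1 l t, hC2 l t]
  have dy : ∀ l t, HasDerivAt (y l) (y' l t) t := by
    intro l t
    by_cases hl : l = 0
    · have : y l = fun _ => 0 := by funext t; simp [hy, hκ, hl, nu0]
      rw [this]; simp [hy', hl, hasDerivAt_const]
    · have hn : (nu c l : ℂ) ≠ 0 := by exact_mod_cast (nu_pos hc hl).ne'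
      have h := (((dA l t).mul (ue_mul_hasDerivAt (nu c l) t)).add
        (((dB l t).mul (ue_mul_hasDerivAt (-nu c l) t)).const_mul (-1))).mul_const (κ l)
      convert! h using 1
      simp only [hy', hl, if_false, hκ]
      have e : ue (-nu c l * t) * ue (nu c l * t) = 1 := by
        rw [← ue_add]; simp [ue_zero]
      have e' : (2 * Complex.I * nu c l) * (2 * Complex.I * nu c l)⁻¹ = 1 :=
        mul_inv_cancel₀ (by simp [hn])
      push_cast
      linear_combination (-(A l t * ue (nu c l * t) + B l t * ue (-nu c l * t)) / 2) * e'
  have dy' : ∀ l t, HasDerivAt (y' l) (ql l t - (nu c l : ℂ) ^ 2 * y l t) t := by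
    intro l t
    by_cases hl : l = 0
    · have : y' l = fun _ => 0 := by funext t; simp [hy', hl]
      rw [this]
      have e : ql l t = 0 := by rw [hl]; exact h0 t
      rw [e, hl, nu0]; simp [hasDerivAt_const]
    · have hn : (nu c l : ℂ) ≠ 0 := by exact_mod_cast (nu_pos hc hl).ne'
      have h := (((dA l t).mul (ue_mul_hasDerivAt (nu c l) t)).add
        ((dB l t).mul (ue_mul_hasDerivAt (-nu c l) t))).div_const 2
      convert! h using 1
      · funext t; simp [hy', hl]
      · simp only [hy, hκ]
        have e : ue (-nu c l * t) * ue (nu c l * t) = 1 := by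
          rw [← ue_add]; simp [ue_zero]
        have e' : (nu c l : ℂ) ^ 2 * (2 * Complex.I * nu c l)⁻¹ = -(Complex.I * nu c l / 2) := by
          field_simp
          rw [Complex.I_sq]; ring
        push_cast
        linear_combination (-(A l t * ue (nu c l * t) + -1 * (B l t * ue (-nu c l * t)))) * e'
          - ql l t * e
  have rU : Rapid lw fun l (p : ℝ × V2) => y l p.1 * ch l p.2 :=
    (ry.comp_clm one_le_lw (ContinuousLinearMap.fst ℝ ℝ V2)).mul_tame one_le_lw
      (tame_ch.comp_clm (ContinuousLinearMap.snd ℝ ℝ V2))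
  have rQ : Rapid lw fun l (p : ℝ × V2) => ql l p.1 * ch l p.2 :=
    (rq.comp_clm one_le_lw (ContinuousLinearMap.fst ℝ ℝ V2)).mul_tame one_le_lw
      (tame_ch.comp_clm (ContinuousLinearMap.snd ℝ ℝ V2))
  have dTU : ∀ l, dd dT (fun p : ℝ × V2 => y l p.1 * ch l p.2) =
      fun p => y' l p.1 * ch l p.2 := by
    intro l; funext p; rw [dd_sep (dy l p.1)]; simp [dT]
  have dXU : ∀ l, dd dX (fun p : ℝ × V2 => y l p.1 * ch l p.2) =
      fun p => (2 * π * l.1 : ℝ) * Complex.I * (y l p.1 * ch l p.2) := by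
    intro l; funext p; rw [dd_sep (dy l p.1)]; simp [dX]; ring
  have dYU : ∀ l, dd dY (fun p : ℝ × V2 => y l p.1 * ch l p.2) =
      fun p => (2 * π * l.2 : ℝ) * Complex.I * (y l p.1 * ch l p.2) := by
    intro l; funext p; rw [dd_sep (dy l p.1)]; simp [dY]; ring
  have second : ∀ w, dd w (dd w fun p => ∑' l, y l p.1 * ch l p.2) =
      fun p => ∑' l, dd w (dd w fun p : ℝ × V2 => y l p.1 * ch l p.2) p := by
    intro w
    rw [rU.dd_tsum one_le_lw summable_lw w, (rU.dd one_le_lw w).dd_tsum one_le_lw summable_lw w]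
  have sm : ∀ (u : ℤ × ℤ → ℝ × V2 → ℂ), Rapid lw u → ∀ p, Summable fun l => u l p := by
    intro u hu p
    obtain ⟨v, hv, hv'⟩ := hu.norm_bound one_le_lw summable_lw
    exact Summable.of_norm_bounded hv fun i => hv' i p
  refine ⟨fun p => ∑' l, y l p.1 * ch l p.2, rU.contDiff_tsum one_le_lw summable_lw, ?_, ?_, ?_⟩
  · intro t x m n
    have h : ∀ l, ch l (x.1 + m, x.2 + n) = ch l x := fun l => ch_per l x m n
    simp only [h]
  · intro t x ht
    have : ∀ l, y l t = 0 := fun l => by simp only [hy, zA l t ht, zB l t ht]; simp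
    simp [this]
  · intro p
    have hinv : q p = ∑' l, ql l p.1 * ch l p.2 := by
      refine fourier_inversion (φ := fun x => q (p.1, x)) (hq.continuous.comp (by fun_prop))
        (pq p.1) ?_ p.2
      obtain ⟨v, hv, hv'⟩ := rq.norm_bound one_le_lw summable_lw
      exact Summable.of_nonneg_of_le (fun _ => norm_nonneg _) (fun l => hv' l p.1) hv
    have s2 := fun w => sm _ ((rU.dd one_le_lw w).dd one_le_lw w) p
    rw [second, second, second, hinv]
    beta_reduce
    rw [← (s2 dX).tsum_add (s2 dY), ← tsum_mul_left,
      ← (((s2 dX).add (s2 dY)).mul_left _).tsum_add (sm _ rQ p)]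
    congr 1
    funext l
    rw [dTU, dXU, dYU]
    have e1 : dd dT (fun p : ℝ × V2 => y' l p.1 * ch l p.2) p =
        (ql l p.1 - (nu c l : ℂ) ^ 2 * y l p.1) * ch l p.2 := by
      rw [dd_sep (dy' l p.1)]; simp [dT]
    have hd := (rU.1 l).differentiable_top
    rw [e1, dd_const_mul hd, dd_const_mul hd, dXU, dYU]
    have e2 : (nu c l : ℂ) ^ 2 = ((2 * π * c) ^ 2 * ((l.1 : ℝ) ^ 2 + (l.2 : ℝ) ^ 2) : ℝ) := by
      rw [← nu_sq]; push_cast; rfl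
    rw [e2]
    push_cast
    linear_combination (-(c : ℂ) ^ 2 * 4 * π ^ 2 * (l.1 ^ 2 + l.2 ^ 2) * y l p.1 * ch l p.2) * Complex.I_sq

/-! ### Electromagnetic pulses generated by orthogonal sources -/

lemma harmonic_eq_zero {u v : V2 → ℂ} (hu : ContDiff ℝ (⊤ : ℕ∞) u) (hv : ContDiff ℝ (⊤ : ℕ∞) v)
    (pu : Zper u) (pv : Zper v)
    (hdiv : ∀ x, dd ((1 : ℝ), (0 : ℝ)) u x + dd ((0 : ℝ), (1 : ℝ)) v x = 0)
    (hcurl : ∀ x, dd ((1 : ℝ), (0 : ℝ)) v x - dd ((0 : ℝ), (1 : ℝ)) u x = 0)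
    (mu : FT u 0 = 0) (mv : FT v 0 = 0) (x : V2) : u x = 0 ∧ v x = 0 := by
  have key : ∀ l, FT u l = 0 ∧ FT v l = 0 := by
    intro l
    by_cases hl : l = 0
    · rw [hl]; exact ⟨mu, mv⟩
    have h1 := FT_add (hu.dd_top ((1 : ℝ), (0 : ℝ))).continuous
      (hv.dd_top ((0 : ℝ), (1 : ℝ))).continuous l
    have h2 := FT_sub (hv.dd_top ((1 : ℝ), (0 : ℝ))).continuous
      (hu.dd_top ((0 : ℝ), (1 : ℝ))).continuous l
    have e1 : FT (fun x => dd ((1 : ℝ), (0 : ℝ)) u x + dd ((0 : ℝ), (1 : ℝ)) v x) l = 0 := by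
      simp [hdiv, FT]
    have e2 : FT (fun x => dd ((1 : ℝ), (0 : ℝ)) v x - dd ((0 : ℝ), (1 : ℝ)) u x) l = 0 := by
      simp [hcurl, FT]
    rw [e1, FT_dd hu pu, FT_dd hv pv] at h1
    rw [e2, FT_dd hv pv, FT_dd hu pu] at h2
    simp only [mul_one, mul_zero, add_zero, zero_add] at h1 h2
    push_cast at h1 h2
    have hpi : (2 * π * Complex.I : ℂ) ≠ 0 := by simp [pi_ne_zero]
    have a1 : (l.1 : ℂ) * FT u l + l.2 * FT v l = 0 :=
      (mul_eq_zero.1 (by linear_combination -h1 :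
        (2 * π * Complex.I : ℂ) * ((l.1 : ℂ) * FT u l + l.2 * FT v l) = 0)).resolve_left hpi
    have a2 : (l.1 : ℂ) * FT v l - l.2 * FT u l = 0 :=
      (mul_eq_zero.1 (by linear_combination -h2 :
        (2 * π * Complex.I : ℂ) * ((l.1 : ℂ) * FT v l - l.2 * FT u l) = 0)).resolve_left hpi
    have hn : ((l.1 : ℂ) ^ 2 + (l.2 : ℂ) ^ 2) ≠ 0 := by
      have h : l.1 ^ 2 + l.2 ^ 2 ≠ 0 := by
        intro h
        have h1 : l.1 = 0 := by nlinarith [sq_nonneg l.1, sq_nonneg l.2]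
        have h2 : l.2 = 0 := by nlinarith [sq_nonneg l.1, sq_nonneg l.2]
        exact hl (Prod.ext h1 h2)
      exact_mod_cast h
    exact ⟨(mul_eq_zero.1 (by linear_combination l.1 * a1 - l.2 * a2 :
        ((l.1 : ℂ) ^ 2 + (l.2 : ℂ) ^ 2) * FT u l = 0)).resolve_left hn,
      (mul_eq_zero.1 (by linear_combination l.2 * a1 + l.1 * a2 :
        ((l.1 : ℂ) ^ 2 + (l.2 : ℂ) ^ 2) * FT v l = 0)).resolve_left hn⟩
  exact ⟨eq_zero_of_FT_eq_zero hu.continuous pu (fun m => (key m).1) x,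
    eq_zero_of_FT_eq_zero hv.continuous pv (fun m => (key m).2) x⟩

section TimeIntegral

variable {T : ℝ} {u : ℝ × V2 → ℂ}

lemma contDiff_timeIntegral (hT : 0 ≤ T) (hu : ContDiff ℝ (⊤ : ℕ∞) u) :
    ContDiff ℝ (⊤ : ℕ∞) fun x => ∫ t in (0 : ℝ)..T, u (t, x) := by
  simp only [intervalIntegral.integral_of_le hT, ← integral_Icc_eq_integral_Ioc]
  exact contDiff_paramIntegral isCompact_Icc (u := fun q : V2 × ℝ => u (q.2, q.1))
    (hu.comp (by fun_prop))

lemma dd_timeIntegral (hT : 0 ≤ T) (hu : ContDiff ℝ (⊤ : ℕ∞) u) (w x : V2) :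
    dd w (fun x => ∫ t in (0 : ℝ)..T, u (t, x)) x =
      ∫ t in (0 : ℝ)..T, dd ((0 : ℝ), w) u (t, x) := by
  simp only [intervalIntegral.integral_of_le hT, ← integral_Icc_eq_integral_Ioc]
  have hs : ContDiff ℝ (⊤ : ℕ∞) fun q : V2 × ℝ => u (q.2, q.1) := hu.comp (by fun_prop)
  rw [dd_paramIntegral isCompact_Icc (u := fun q : V2 × ℝ => u (q.2, q.1)) hs w x]
  congr 1
  funext t
  have h : HasFDerivAt (fun q : V2 × ℝ => u (q.2, q.1)) _ (x, t) :=
    (hu.differentiable_top (t, x)).hasFDerivAt.comp (x, t)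
      (hasFDerivAt_snd.prodMk hasFDerivAt_fst)
  simp only [dd]
  rw [h.fderiv]
  simp

lemma timeIntegral_dT (hu : ContDiff ℝ (⊤ : ℕ∞) u) (x : V2) :
    ∫ t in (0 : ℝ)..T, dd dT u (t, x) = u (T, x) - u (0, x) := by
  refine intervalIntegral.integral_eq_sub_of_hasDerivAt (f := fun t => u (t, x)) (fun t _ => ?_)
    (((hu.dd_top dT).continuous.comp (by fun_prop : Continuous fun t : ℝ => (t, x))).intervalIntegrable
      _ _)
  exact dd_hasDerivAt hu.differentiable_top ((hasDerivAt_id t).prodMk (hasDerivAt_const t x))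

end TimeIntegral

lemma dd_re {E : Type*} [NormedAddCommGroup E] [NormedSpace ℝ E] {u : E → ℂ}
    (hu : Differentiable ℝ u) (w p : E) : dd w (fun p => (u p).re) p = (dd w u p).re := by
  have h : HasFDerivAt (fun p => (u p).re) _ p :=
    Complex.reCLM.hasFDerivAt.comp p (hu p).hasFDerivAt
  simp only [dd]
  rw [h.fderiv]
  simp

lemma dd_zero_off {u : ℝ × V2 → ℂ} {T : ℝ} (hu : ContDiff ℝ (⊤ : ℕ∞) u)
    (hz : ∀ t x, t ≤ 0 ∨ T ≤ t → u (t, x) = 0) (w : ℝ × V2) (t : ℝ) (x : V2)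
    (ht : t ≤ 0 ∨ T ≤ t) : dd w u (t, x) = 0 := by
  have h := dd_dT_eq_zero (u := u) (T := T) (fun t x h => hz t x (h.imp le_of_lt le_of_lt)) w
  have hc : Continuous fun s => dd w u (s, x) := (hu.dd_top w).continuous.comp (by fun_prop)
  have hcl : IsClosed {s | dd w u (s, x) = 0} := isClosed_eq hc continuous_const
  rcases ht with ht | ht
  · have : closure (Set.Iio (0 : ℝ)) ⊆ {s | dd w u (s, x) = 0} :=
      closure_minimal (fun s hs => h s x (Or.inl hs)) hcl
    exact this (by rw [closure_Iio]; exact ht)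
  · have : closure (Set.Ioi T) ⊆ {s | dd w u (s, x) = 0} :=
      closure_minimal (fun s hs => h s x (Or.inr hs)) hcl
    exact this (by rw [closure_Ioi]; exact ht)

lemma J_curl {T : ℝ} {w₁ w₂ : ℝ × V2 → ℂ} (h1 : ContDiff ℝ (⊤ : ℕ∞) w₁)
    (h2 : ContDiff ℝ (⊤ : ℕ∞) w₂) (p1 : SPer w₁) (p2 : SPer w₂) (c : ℂ) (l : ℤ × ℤ) :
    (∀ t, FT (fun x => c * (dd dX w₂ (t, x) - dd dY w₁ (t, x))) l =
      c * (2 * π * Complex.I) * (l.1 * FT (fun x => w₂ (t, x)) l - l.2 * FT (fun x => w₁ (t, x)) l)) ∧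
    ∀ σ, J T (fun p => c * (dd dX w₂ p - dd dY w₁ p)) l σ =
      c * (2 * π * Complex.I) * (l.1 * J T w₂ l σ - l.2 * J T w₁ l σ) := by
  have key : ∀ t, FT (fun x => c * (dd dX w₂ (t, x) - dd dY w₁ (t, x))) l = c *
      (2 * π * Complex.I) * (l.1 * FT (fun x => w₂ (t, x)) l - l.2 * FT (fun x => w₁ (t, x)) l) := by
    intro t
    rw [FT_const_mul, FT_sub (φ := fun x => dd dX w₂ (t, x)) (ψ := fun x => dd dY w₁ (t, x))
      ((h2.dd_top dX).continuous.comp (by fun_prop : Continuous fun x : V2 => (t, x)))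
      ((h1.dd_top dY).continuous.comp (by fun_prop : Continuous fun x : V2 => (t, x)))]
    have e1 := FT_slice_dd h2 p2 t ((1 : ℝ), (0 : ℝ)) l
    have e2 := FT_slice_dd h1 p1 t ((0 : ℝ), (1 : ℝ)) l
    change FT (fun x => dd dX w₂ (t, x)) l = _ at e1
    change FT (fun x => dd dY w₁ (t, x)) l = _ at e2
    rw [e1, e2]
    push_cast
    ring
  refine ⟨key, fun σ => ?_⟩
  have hi : ∀ {w : ℝ × V2 → ℂ}, ContDiff ℝ (⊤ : ℕ∞) w →
      IntervalIntegrable (fun t => FT (fun x => w (t, x)) l * ue (-(σ * t))) volume 0 T :=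
    fun hw => ((contDiff_FT hw l).continuous.mul
      (ue_contDiff.continuous.comp (by fun_prop))).intervalIntegrable _ _
  simp only [J, key]
  rw [← intervalIntegral.integral_const_mul (l.1 : ℂ), ← intervalIntegral.integral_const_mul (l.2 : ℂ),
    ← intervalIntegral.integral_sub ((hi h2).const_mul _) ((hi h1).const_mul _),
    ← intervalIntegral.integral_const_mul]
  congr 1
  funext t
  ring

theorem exists_pulse_of_source {c T : ℝ} (hc : 0 < c) (hT : 0 < T) {K : Set V2} (hK : IsClosed K)
    {w₁ w₂ : ℝ × V2 → ℂ} (h1 : ContDiff ℝ (⊤ : ℕ∞) w₁) (h2 : ContDiff ℝ (⊤ : ℕ∞) w₂)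
    (p1 : SPer w₁) (p2 : SPer w₂) (z1 : ∀ t x, t ≤ 0 ∨ T ≤ t → w₁ (t, x) = 0)
    (z2 : ∀ t x, t ≤ 0 ∨ T ≤ t → w₂ (t, x) = 0) (k1 : ∀ t x, x ∉ K → w₁ (t, x) = 0)
    (k2 : ∀ t x, x ∉ K → w₂ (t, x) = 0)
    (ho : ∀ l ≠ 0, ∀ r : ℝ, r = 1 ∨ r = -1 →
      (l.1 : ℂ) * J T w₂ l (r * nu c l) - l.2 * J T w₁ l (r * nu c l) = 0)
    {W₁ W₂ P₁ P₂ : V2 → ℂ} (hW1 : ∀ x, ∫ t in (0 : ℝ)..T, w₁ (t, x) = W₁ x)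
    (hW2 : ∀ x, ∫ t in (0 : ℝ)..T, w₂ (t, x) = W₂ x)
    (hP1 : ContDiff ℝ (⊤ : ℕ∞) P₁) (hP2 : ContDiff ℝ (⊤ : ℕ∞) P₂) (pP1 : Zper P₁) (pP2 : Zper P₂)
    (hcurl : ∀ x, dd ((1 : ℝ), (0 : ℝ)) P₂ x - dd ((0 : ℝ), (1 : ℝ)) P₁ x = 0)
    (hdiv : ∀ x, dd ((1 : ℝ), (0 : ℝ)) P₁ x + dd ((0 : ℝ), (1 : ℝ)) P₂ x +
      (dd ((1 : ℝ), (0 : ℝ)) W₁ x + dd ((0 : ℝ), (1 : ℝ)) W₂ x) = 0)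
    (m1 : FT P₁ 0 + FT W₁ 0 = 0) (m2 : FT P₂ 0 + FT W₂ 0 = 0) :
    ∃ e₁ e₂ b : ℝ × V2 → ℝ, Adm c K e₁ e₂ b ∧
      (∀ t x, t ≤ 0 ∨ T ≤ t → e₁ (t, x) = 0 ∧ e₂ (t, x) = 0 ∧ b (t, x) = 0) ∧
      ∀ x, ∫ t in (0 : ℝ)..T, e₁ (t, x) = (P₁ x).re ∧ ∫ t in (0 : ℝ)..T, e₂ (t, x) = (P₂ x).re := by
  have hJ := fun l => J_curl (T := T) h1 h2 p1 p2 (c : ℂ) l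
  obtain ⟨Y, hY, pY, zY, eY⟩ := exists_wave hc hT
    (q := fun p => (c : ℂ) * (dd dX w₂ p - dd dY w₁ p))
    (contDiff_const.mul ((h2.dd_top dX).sub (h1.dd_top dY)))
    (fun t x m n => by
      have a := p2.dd dX t x m n
      have b := p1.dd dY t x m n
      simp only at a b ⊢
      rw [a, b])
    (fun t x ht => by
      have ht' : t ≤ 0 ∨ T ≤ t := ht.imp le_of_lt le_of_lt
      simp only [dd_zero_off h2 z2 _ t x ht', dd_zero_off h1 z1 _ t x ht', sub_zero, mul_zero])
    (fun t => by rw [(hJ 0).1 t]; simp)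
    (fun l hl => ⟨by
      rw [(hJ l).2, ← one_mul (nu c l), ho l hl 1 (Or.inl rfl), mul_zero], by
      rw [(hJ l).2, ← neg_one_mul (nu c l), ho l hl (-1) (Or.inr rfl), mul_zero]⟩)
  have cY : ∀ w w' p, dd w (dd w' Y) p = dd w' (dd w Y) p := fun w w' p =>
    congrFun (dd_comm hY w w') p
  set E₁ : ℝ × V2 → ℂ := fun p => c * dd dY Y p - w₁ p with hE1
  set E₂ : ℝ × V2 → ℂ := fun p => -c * dd dX Y p - w₂ p with hE2
  have sY : ∀ w, ContDiff ℝ (⊤ : ℕ∞) (dd w Y) := fun w => hY.dd_top w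
  have sE1 : ContDiff ℝ (⊤ : ℕ∞) E₁ := (contDiff_const.mul (sY dY)).sub h1
  have sE2 : ContDiff ℝ (⊤ : ℕ∞) E₂ := (contDiff_const.mul (sY dX)).sub h2
  have pE1 : SPer E₁ := fun t x m n => by
    have a := pY.dd dY t x m n
    have b := p1 t x m n
    simp only [hE1] at a b ⊢
    rw [a, b]
  have pE2 : SPer E₂ := fun t x m n => by
    have a := pY.dd dX t x m n
    have b := p2 t x m n
    simp only [hE2] at a b ⊢
    rw [a, b]
  have dE1 : ∀ w p, dd w E₁ p = c * dd w (dd dY Y) p - dd w w₁ p := fun w p => by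
    have e : E₁ = fun p => (fun p => (c : ℂ) * dd dY Y p) p - w₁ p := rfl
    rw [e, dd_sub (contDiff_const.mul (sY dY)).differentiable_top h1.differentiable_top]
    rw [dd_const_mul (sY dY).differentiable_top]
  have dE2 : ∀ w p, dd w E₂ p = -c * dd w (dd dX Y) p - dd w w₂ p := fun w p => by
    have e : E₂ = fun p => (fun p => (-c : ℂ) * dd dX Y p) p - w₂ p := rfl
    rw [e, dd_sub (contDiff_const.mul (sY dX)).differentiable_top h2.differentiable_top]
    rw [dd_const_mul (sY dX).differentiable_top]
  have offK : ∀ {w : ℝ × V2 → ℂ}, (∀ t x, x ∉ K → w (t, x) = 0) → ∀ v (p : ℝ × V2), p.2 ∉ K →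
      dd v w p = 0 := fun {w} hw v p hp => by
    refine dd_eq_zero_of_eventually v ?_
    have : IsOpen {p : ℝ × V2 | p.2 ∉ K} := hK.isOpen_compl.preimage continuous_snd
    filter_upwards [this.mem_nhds hp] with q hq
    exact hw q.1 q.2 hq
  have far : ∀ p, dd dT (dd dT Y) p + c * (dd dX E₂ p - dd dY E₁ p) = 0 := fun p => by
    rw [eY, dE1, dE2]; ring
  have zE1 : ∀ t x, t ≤ 0 ∨ T ≤ t → E₁ (t, x) = 0 := fun t x ht => by
    simp only [hE1, dd_zero_off hY zY _ t x ht, z1 t x ht, mul_zero, sub_zero]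
  have zE2 : ∀ t x, t ≤ 0 ∨ T ≤ t → E₂ (t, x) = 0 := fun t x ht => by
    simp only [hE2, dd_zero_off hY zY _ t x ht, z2 t x ht, mul_zero, sub_zero]
  have reS : ∀ {u : ℝ × V2 → ℂ}, ContDiff ℝ (⊤ : ℕ∞) u →
      ContDiff ℝ (⊤ : ℕ∞) fun p => (u p).re := fun hu => Complex.reCLM.contDiff.comp hu
  have reP : ∀ {u : ℝ × V2 → ℂ}, SPer u → SPer fun p => (u p).re :=
    fun {u} hu t x m n => congrArg Complex.re (hu t x m n)
  have dif : ∀ {u : ℝ × V2 → ℂ}, ContDiff ℝ (⊤ : ℕ∞) u → Differentiable ℝ u :=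
    fun hu => hu.differentiable_top
  have ofc : ∀ z : ℂ, c * z.re = ((c : ℂ) * z).re := fun z => by simp
  refine ⟨fun p => (E₁ p).re, fun p => (E₂ p).re, fun p => (dd dT Y p).re,
    ⟨reS sE1, reS sE2, reS (sY dT), reP pE1, reP pE2, reP (pY.dd dT), fun p => ?_, fun p hp => ?_,
      fun p hp => ?_, fun p hp => ?_⟩, fun t x ht => ?_, ?_⟩
  · rw [dd_re (dif (sY dT)), dd_re (dif sE1), dd_re (dif sE2), ← Complex.sub_re, ofc,
      ← Complex.add_re, far]; rfl
  · rw [dd_re (dif sE1), dd_re (dif sE2), ← Complex.add_re, dE1, dE2, offK k1 _ p hp,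
      offK k2 _ p hp, cY dX dY]
    have : (c : ℂ) * dd dY (dd dX Y) p - 0 + (-c * dd dY (dd dX Y) p - 0) = 0 := by ring
    rw [this]; rfl
  · rw [dd_re (dif sE1), dd_re (dif (sY dT)), ofc, ← Complex.sub_re, dE1, offK k1 _ p hp, cY dT dY]
    have : (c : ℂ) * dd dY (dd dT Y) p - 0 - c * dd dY (dd dT Y) p = 0 := by ring
    rw [this]; rfl
  · rw [dd_re (dif sE2), dd_re (dif (sY dT)), ofc, ← Complex.add_re, dE2, offK k2 _ p hp, cY dT dX]
    have : -(c : ℂ) * dd dX (dd dT Y) p - 0 + c * dd dX (dd dT Y) p = 0 := by ring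
    rw [this]; rfl
  · simp only [zE1 t x ht, zE2 t x ht, dd_zero_off hY zY _ t x ht, Complex.zero_re, and_self]
  · set V₁ : V2 → ℂ := fun x => ∫ t in (0 : ℝ)..T, E₁ (t, x) with hV1
    set V₂ : V2 → ℂ := fun x => ∫ t in (0 : ℝ)..T, E₂ (t, x) with hV2
    have sV1 : ContDiff ℝ (⊤ : ℕ∞) V₁ := contDiff_timeIntegral hT.le sE1
    have sV2 : ContDiff ℝ (⊤ : ℕ∞) V₂ := contDiff_timeIntegral hT.le sE2
    have ci : ∀ {u : ℝ × V2 → ℂ}, ContDiff ℝ (⊤ : ℕ∞) u → ∀ x,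
        IntervalIntegrable (fun t => u (t, x)) volume 0 T := fun hu x =>
      (hu.continuous.comp (by fun_prop : Continuous fun t : ℝ => (t, x))).intervalIntegrable _ _
    have eW1 : W₁ = fun x => ∫ t in (0 : ℝ)..T, w₁ (t, x) := funext fun x => (hW1 x).symm
    have eW2 : W₂ = fun x => ∫ t in (0 : ℝ)..T, w₂ (t, x) := funext fun x => (hW2 x).symm
    have pV1 : Zper V₁ := fun x m n => by
      have : ∀ t, E₁ (t, (x.1 + m, x.2 + n)) = E₁ (t, x) := fun t => pE1 t x m n
      simp only [hV1, this]
    have pV2 : Zper V₂ := fun x m n => by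
      have : ∀ t, E₂ (t, (x.1 + m, x.2 + n)) = E₂ (t, x) := fun t => pE2 t x m n
      simp only [hV2, this]
    have split1 : V₁ = fun x => c * dd ((0 : ℝ), (1 : ℝ)) (fun x => ∫ t in (0 : ℝ)..T, Y (t, x)) x
        - W₁ x := by
      funext x
      rw [dd_timeIntegral hT.le hY, ← hW1, ← intervalIntegral.integral_const_mul,
        ← intervalIntegral.integral_sub ((ci (sY ((0 : ℝ), ((0 : ℝ), (1 : ℝ)))) x).const_mul _)
          (ci h1 x)]
      rfl
    have split2 : V₂ = fun x => -c * dd ((1 : ℝ), (0 : ℝ)) (fun x => ∫ t in (0 : ℝ)..T, Y (t, x)) x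
        - W₂ x := by
      funext x
      rw [dd_timeIntegral hT.le hY, ← hW2, ← intervalIntegral.integral_const_mul,
        ← intervalIntegral.integral_sub ((ci (sY ((0 : ℝ), ((1 : ℝ), (0 : ℝ)))) x).const_mul _)
          (ci h2 x)]
      rfl
    have sZ : ContDiff ℝ (⊤ : ℕ∞) fun x => ∫ t in (0 : ℝ)..T, Y (t, x) :=
      contDiff_timeIntegral hT.le hY
    have pZ : Zper fun x => ∫ t in (0 : ℝ)..T, Y (t, x) := fun x m n => by
      have : ∀ t, Y (t, (x.1 + m, x.2 + n)) = Y (t, x) := fun t => pY t x m n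
      simp only [this]
    have cW1 : ContDiff ℝ (⊤ : ℕ∞) W₁ := eW1 ▸ contDiff_timeIntegral hT.le h1
    have cW2 : ContDiff ℝ (⊤ : ℕ∞) W₂ := eW2 ▸ contDiff_timeIntegral hT.le h2
    have fV1 : FT V₁ 0 = -FT W₁ 0 := by
      rw [split1, FT_sub (φ := fun x => (c : ℂ) * dd ((0 : ℝ), (1 : ℝ))
        (fun x => ∫ t in (0 : ℝ)..T, Y (t, x)) x) (continuous_const.mul (sZ.dd_top _).continuous)
        cW1.continuous,
        FT_const_mul, FT_dd sZ pZ]; simp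
    have fV2 : FT V₂ 0 = -FT W₂ 0 := by
      rw [split2, FT_sub (φ := fun x => -(c : ℂ) * dd ((1 : ℝ), (0 : ℝ))
        (fun x => ∫ t in (0 : ℝ)..T, Y (t, x)) x) (continuous_const.mul (sZ.dd_top _).continuous)
        cW2.continuous,
        FT_const_mul, FT_dd sZ pZ]; simp
    have hV := harmonic_eq_zero (u := fun x => V₁ x - P₁ x) (v := fun x => V₂ x - P₂ x)
      (sV1.sub hP1) (sV2.sub hP2)
      (fun x m n => by simp only [pV1 x m n, pP1 x m n])
      (fun x m n => by simp only [pV2 x m n, pP2 x m n])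
      (fun x => by
        rw [dd_sub sV1.differentiable_top hP1.differentiable_top,
          dd_sub sV2.differentiable_top hP2.differentiable_top]
        have a : dd ((1 : ℝ), (0 : ℝ)) V₁ x + dd ((0 : ℝ), (1 : ℝ)) V₂ x =
            -(dd ((1 : ℝ), (0 : ℝ)) W₁ x + dd ((0 : ℝ), (1 : ℝ)) W₂ x) := by
          rw [hV1, hV2, dd_timeIntegral hT.le sE1, dd_timeIntegral hT.le sE2, eW1, eW2,
            dd_timeIntegral hT.le h1, dd_timeIntegral hT.le h2,
            ← intervalIntegral.integral_add (ci (sE1.dd_top _) x) (ci (sE2.dd_top _) x),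
            ← intervalIntegral.integral_add (ci (h1.dd_top _) x) (ci (h2.dd_top _) x),
            ← intervalIntegral.integral_neg]
          congr 1
          funext t
          have := cY dX dY (t, x)
          simp only [dX, dY] at this
          rw [dE1, dE2]
          simp only [dX, dY, this]
          ring
        linear_combination a - hdiv x)
      (fun x => by
        rw [dd_sub sV1.differentiable_top hP1.differentiable_top,
          dd_sub sV2.differentiable_top hP2.differentiable_top]
        have a : dd ((1 : ℝ), (0 : ℝ)) V₂ x - dd ((0 : ℝ), (1 : ℝ)) V₁ x = 0 := by
          rw [hV1, hV2, dd_timeIntegral hT.le sE1, dd_timeIntegral hT.le sE2,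
            ← intervalIntegral.integral_sub (ci (sE2.dd_top _) x) (ci (sE1.dd_top _) x)]
          have e : ∀ t, dd ((0 : ℝ), ((1 : ℝ), (0 : ℝ))) E₂ (t, x) -
              dd ((0 : ℝ), ((0 : ℝ), (1 : ℝ))) E₁ (t, x) =
              (-(c : ℂ)⁻¹) * dd dT (dd dT Y) (t, x) := fun t => by
            have hc' : (c : ℂ) ≠ 0 := by exact_mod_cast hc.ne'
            have := far (t, x)
            simp only [dX, dY] at this
            field_simp
            linear_combination this
          simp only [e]
          rw [intervalIntegral.integral_const_mul, timeIntegral_dT (sY dT),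
            dd_zero_off hY zY _ T x (Or.inr le_rfl), dd_zero_off hY zY _ 0 x (Or.inl le_rfl)]
          simp
        linear_combination a - hcurl x)
      (by rw [FT_sub sV1.continuous hP1.continuous, fV1]; linear_combination -m1)
      (by rw [FT_sub sV2.continuous hP2.continuous, fV2]; linear_combination -m2)
    intro x
    have a := sub_eq_zero.1 (hV x).1
    have b := sub_eq_zero.1 (hV x).2
    rw [← a, ← b]
    exact ⟨(intervalIntegral.intervalIntegral_re (ci sE1 x)),
      (intervalIntegral.intervalIntegral_re (ci sE2 x))⟩

/-! ### Time windows adapted to rays, and elementary properties of space-time Fourier coefficients -/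

/-- A smooth function, positive exactly on `(0, T)`. -/
def hat (T t : ℝ) : ℝ := expNegInvGlue t * expNegInvGlue (T - t)

lemma hat_contDiff (T : ℝ) : ContDiff ℝ (⊤ : ℕ∞) (hat T) :=
  expNegInvGlue.contDiff.mul (expNegInvGlue.contDiff.comp (contDiff_const.sub contDiff_id))

lemma hat_nonneg (T t : ℝ) : 0 ≤ hat T t :=
  mul_nonneg (expNegInvGlue.nonneg _) (expNegInvGlue.nonneg _)

lemma hat_pos {T t : ℝ} (h0 : 0 < t) (hT : t < T) : 0 < hat T t :=
  mul_pos (expNegInvGlue.pos_of_pos h0) (expNegInvGlue.pos_of_pos (by linarith))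

lemma hat_eq_zero {T t : ℝ} (h : t ≤ 0 ∨ T ≤ t) : hat T t = 0 := by
  rcases h with h | h
  · simp [hat, expNegInvGlue.zero_of_nonpos h]
  · simp [hat, expNegInvGlue.zero_of_nonpos (show T - t ≤ 0 by linarith)]

lemma integral_pos_of_exists {T : ℝ} (hT : 0 < T) {f : ℝ → ℝ} (hf : Continuous f)
    (h0 : ∀ t, 0 ≤ f t) (h : ∃ t ∈ Set.Icc 0 T, 0 < f t) : 0 < ∫ t in (0 : ℝ)..T, f t :=
  intervalIntegral.integral_pos hT hf.continuousOn (fun t _ => h0 t) h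

lemma exists_time_bump {T : ℝ} (hT : 0 < T) : ∃ η : ℝ → ℝ, ContDiff ℝ (⊤ : ℕ∞) η ∧
    (∀ t, t ≤ 0 ∨ T ≤ t → η t = 0) ∧ ∫ t in (0 : ℝ)..T, η t = 1 := by
  have hp : 0 < ∫ t in (0 : ℝ)..T, hat T t := integral_pos_of_exists hT (hat_contDiff T).continuous
    (hat_nonneg T) ⟨T / 2, ⟨by linarith, by linarith⟩, hat_pos (by linarith) (by linarith)⟩
  refine ⟨fun t => (∫ t in (0 : ℝ)..T, hat T t)⁻¹ * hat T t, contDiff_const.mul (hat_contDiff T),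
    fun t ht => ?_, ?_⟩
  · simp only [hat_eq_zero ht, mul_zero]
  · rw [intervalIntegral.integral_const_mul, inv_mul_cancel₀ hp.ne']

theorem exists_window {c : ℝ} (hc : 0 < c) {χ : V2 → ℝ} (hχ : ContDiff ℝ (⊤ : ℕ∞) χ) (pχ : Zper χ)
    (nχ : ∀ x, 0 ≤ χ x) {L : ℝ} (hG : ∀ x e : V2, en e = 1 → ∃ s, 0 ≤ s ∧ s ≤ L ∧ 0 < χ (x + s • e)) :
    ∃ T, 0 < T ∧ ∃ H : (ℝ × ℝ) × V2 → ℂ, ContDiff ℝ (⊤ : ℕ∞) H ∧ SPer H ∧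
      (∀ α t x, t ≤ 0 ∨ T ≤ t → H ((α, t), x) = 0) ∧ (∀ α t x, χ x = 0 → H ((α, t), x) = 0) ∧
      ∀ α y, ∫ t in (0 : ℝ)..T, H ((α, t), y - t • (c * cos α, c * sin α)) = 1 := by
  have hL : 0 ≤ L := by
    obtain ⟨s, h0, h1, -⟩ := hG 0 (1, 0) (by simp [en])
    linarith
  set T := L / c + 2 with hTdef
  have hT : 0 < T := by positivity
  set g : ℝ × V2 → ℝ := fun q => ∫ t in (0 : ℝ)..T, hat T t *
    χ (q.2 - t • (c * cos q.1, c * sin q.1)) with hg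
  have hh := hat_contDiff T
  have sg : ContDiff ℝ (⊤ : ℕ∞) g := by
    have : g = fun q => ∫ t in Set.Icc (0 : ℝ) T, hat T t *
        χ (q.2 - t • (c * cos q.1, c * sin q.1)) := by
      funext q
      rw [hg, integral_Icc_eq_integral_Ioc, ← intervalIntegral.integral_of_le hT.le]
    rw [this]
    refine contDiff_paramIntegral (E := ℝ × V2) (G := ℝ) isCompact_Icc (u := fun q => hat T q.2 *
        χ (q.1.2 - q.2 • (c * cos q.1.1, c * sin q.1.1))) ?_
    fun_prop
  have gpos : ∀ q, 0 < g q := by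
    rintro ⟨α, y⟩
    refine integral_pos_of_exists hT (by have := hh.continuous; have := hχ.continuous; fun_prop)
      (fun t => mul_nonneg (hat_nonneg _ _) (nχ _)) ?_
    obtain ⟨s, h0, h1, h2⟩ := hG (y - (c * cos α, c * sin α)) (-cos α, -sin α) (by simp [en])
    have h3 : s / c ≤ L / c := by gcongr
    have h4 : 0 ≤ s / c := by positivity
    refine ⟨1 + s / c, ⟨by linarith, by linarith⟩,
      mul_pos (hat_pos (by linarith) (by linarith)) ?_⟩
    have e : y - (1 + s / c) • (c * cos α, c * sin α) =
        y - (c * cos α, c * sin α) + s • (-cos α, -sin α) := by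
      ext <;> simp <;> field_simp <;> ring
    beta_reduce
    rwa [e]
  have pg : ∀ α, Zper fun x => g (α, x) := fun α x m n => by
    simp only [hg]
    congr 1
    funext t
    have := pχ (x - t • (c * cos α, c * sin α)) m n
    rw [← this]
    congr 2
    ext <;> simp <;> ring
  refine ⟨T, hT, fun q => ((hat T q.1.2 * χ q.2 /
    g (q.1.1, q.2 + q.1.2 • (c * cos q.1.1, c * sin q.1.1)) : ℝ) : ℂ), ?_, ?_, ?_, ?_, ?_⟩
  · refine Complex.ofRealCLM.contDiff.comp (ContDiff.div ?_ ?_ fun q => (gpos _).ne')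
    · fun_prop
    · fun_prop
  · intro p x m n
    have h1 := pχ x m n
    have h2 := pg p.1 (x + p.2 • (c * cos p.1, c * sin p.1)) m n
    simp only at h1 h2 ⊢
    rw [h1, ← h2]
    congr 4
    ext <;> simp <;> ring
  · intro α t x ht
    simp [hat_eq_zero ht]
  · intro α t x hx
    simp [hx]
  · intro α y
    simp only [sub_add_cancel]
    have : ∀ t, ((hat T t * χ (y - t • (c * cos α, c * sin α)) / g (α, y) : ℝ) : ℂ) =
        ((g (α, y) : ℝ) : ℂ)⁻¹ * ((hat T t * χ (y - t • (c * cos α, c * sin α)) : ℝ) : ℂ) := by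
      intro t
      push_cast
      ring
    simp only [this]
    rw [intervalIntegral.integral_const_mul, intervalIntegral.integral_ofReal]
    exact inv_mul_cancel₀ (by exact_mod_cast (gpos (α, y)).ne')

lemma SPer.iteratedFDeriv {E F : Type*} [NormedAddCommGroup E] [NormedSpace ℝ E]
    [NormedAddCommGroup F] [NormedSpace ℝ F] {u : E × V2 → F} (hp : SPer u) (n : ℕ) :
    SPer (iteratedFDeriv ℝ n u) := by
  intro t x a b
  have e : (fun q : E × V2 => u (q + (0, ((a : ℝ), (b : ℝ))))) = u := by
    funext q
    have := hp q.1 q.2 a b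
    simp only at this
    rw [← this]
    congr 1
    ext <;> simp
  have h := iteratedFDeriv_comp_add_right (𝕜 := ℝ) (f := u) n (0, ((a : ℝ), (b : ℝ))) (t, x)
  rw [e] at h
  simp only [h]
  congr 1
  ext <;> simp

lemma tame_window {ι : Type*} {wt : ι → ℝ} (hw : ∀ i, 1 ≤ wt i) {T : ℝ} {H : (ℝ × ℝ) × V2 → ℂ}
    (hH : ContDiff ℝ (⊤ : ℕ∞) H) (pH : SPer H)
    (zH : ∀ α t x, t ≤ 0 ∨ T ≤ t → H ((α, t), x) = 0) {α : ι → ℝ}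
    (hα : ∀ i, α i ∈ Set.Icc (-π) π) :
    Tame wt fun i (p : ℝ × V2) => H ((α i, p.1), p.2) := by
  refine ⟨fun i => by fun_prop, fun n => ?_⟩
  obtain ⟨M, hM0, hM⟩ := SPer.bounded_compact (hH.continuous_iteratedFDeriv (m := n)
    (by exact_mod_cast le_top)) (pH.iteratedFDeriv n)
    ((isCompact_Icc (a := -π) (b := π)).prod (isCompact_Icc (a := (0 : ℝ)) (b := T)))
  set Lm : ℝ × V2 →L[ℝ] (ℝ × ℝ) × V2 := (ContinuousLinearMap.prod (ContinuousLinearMap.prod 0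
    (ContinuousLinearMap.fst ℝ ℝ V2)) (ContinuousLinearMap.snd ℝ ℝ V2)) with hLm
  refine ⟨M * ‖Lm‖ ^ n, 0, fun i p => ?_⟩
  rw [pow_zero, mul_one]
  beta_reduce
  by_cases hp : p.1 ∈ Set.Icc 0 T
  · have e : (fun p : ℝ × V2 => H ((α i, p.1), p.2)) =
        fun p => (fun q => H (q + ((α i, 0), 0))) (Lm p) := by
      funext p; simp [hLm]
    have hf : ContDiff ℝ (⊤ : ℕ∞) fun q => H (q + ((α i, 0), 0)) := by fun_prop
    rw [e]
    refine (norm_iteratedFDeriv_comp_clm_le hf Lm n p).trans ?_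
    gcongr
    rw [iteratedFDeriv_comp_add_right]
    have e2 : Lm p + ((α i, 0), 0) = ((α i, p.1), p.2) := by simp [hLm]
    rw [e2]
    exact hM (α i, p.1) ⟨hα i, hp⟩ p.2
  · have : (fun p : ℝ × V2 => H ((α i, p.1), p.2)) =ᶠ[nhds p] fun _ => 0 := by
      have ho : IsOpen {q : ℝ × V2 | q.1 ∉ Set.Icc 0 T} :=
        (isClosed_Icc.preimage continuous_fst).isOpen_compl
      filter_upwards [ho.mem_nhds hp] with q hq
      refine zH _ _ _ ?_
      by_contra hcon
      push Not at hcon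
      exact hq ⟨hcon.1.le, hcon.2.le⟩
    rw [this.iteratedFDeriv ℝ n |>.self_of_nhds]
    have h0 : iteratedFDeriv ℝ n (fun _ : ℝ × V2 => (0 : ℂ)) p = 0 := by
      rw [iteratedFDeriv_fun_zero]; rfl
    rw [h0, norm_zero]
    positivity

section SpaceTime

variable {T : ℝ} {u : ℝ × V2 → ℂ}

lemma FT_time_continuous (hu : ContDiff ℝ (⊤ : ℕ∞) u) (l : ℤ × ℤ) (σ : ℝ) :
    Continuous fun t => FT (fun x => u (t, x)) l * ue (-(σ * t)) :=
  (contDiff_FT hu l).continuous.mul (ue_contDiff.continuous.comp (by fun_prop))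

lemma J_dT (hu : ContDiff ℝ (⊤ : ℕ∞) u) (h0 : ∀ x, u (0, x) = 0) (hT : ∀ x, u (T, x) = 0)
    (l : ℤ × ℤ) (σ : ℝ) : J T (dd dT u) l σ = σ * Complex.I * J T u l σ := by
  have hd : ∀ t, HasDerivAt (fun t => FT (fun x => u (t, x)) l)
      (FT (fun x => dd dT u (t, x)) l) t := fun t => by
    have h1 := ((contDiff_FT hu l).differentiable_top t).hasDerivAt
    rw [deriv_eq_dd, dd_FT hu] at h1
    exact h1
  have hv : ∀ t, HasDerivAt (fun t : ℝ => ue (-(σ * t))) (-σ * Complex.I * ue (-(σ * t))) t :=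
    fun t => by
      have := ue_mul_hasDerivAt (-σ) t
      simpa only [neg_mul, Complex.ofReal_neg] using this
  have key := intervalIntegral.integral_mul_deriv_eq_deriv_mul (a := 0) (b := T)
    (fun t _ => hd t) (fun t _ => hv t)
    ((contDiff_FT (hu.dd_top dT) l).continuous.intervalIntegrable _ _)
    ((continuous_const.mul (ue_contDiff.continuous.comp (by fun_prop))).intervalIntegrable _ _)
  have z : FT (fun _ : V2 => (0 : ℂ)) l = 0 := by simp [FT]
  simp only [h0, hT, z, zero_mul, sub_zero, zero_sub] at key
  have e : ∀ t : ℝ, FT (fun x => u (t, x)) l * (-σ * Complex.I * ue (-(σ * t))) =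
      (-(σ * Complex.I)) * (FT (fun x => u (t, x)) l * ue (-(σ * t))) := fun t => by ring
  simp only [e] at key
  rw [intervalIntegral.integral_const_mul] at key
  simp only [J]
  linear_combination key

lemma J_mul_wave (k l : ℤ × ℤ) (τ σ : ℝ) :
    J T (fun p => u p * (ch k p.2 * ue (τ * p.1))) l σ = J T u (l - k) (σ - τ) := by
  simp only [J]
  congr 1
  funext t
  have e : FT (fun x => u (t, x) * (ch k x * ue (τ * t))) l =
      ue (τ * t) * FT (fun x => u (t, x)) (l - k) := by
    rw [← FT_const_mul]
    simp only [FT]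
    congr 1
    funext x
    have : ch (-(l - k)) x = ch k x * ch (-l) x := by rw [← ch_add]; congr 1; ring
    rw [this]
    ring
  have : ue (-((σ - τ) * t)) = ue (τ * t) * ue (-(σ * t)) := by
    rw [← ue_add]; congr 1; ring
  rw [e, this]
  ring

lemma norm_J_le (hT : 0 ≤ T) {C : ℝ} {l : ℤ × ℤ}
    (h : ∀ t ∈ Set.Icc 0 T, ‖FT (fun x => u (t, x)) l‖ ≤ C) (σ : ℝ) : ‖J T u l σ‖ ≤ C * T := by
  have := intervalIntegral.norm_integral_le_of_norm_le_const (a := 0) (b := T)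
    (f := fun t => FT (fun x => u (t, x)) l * ue (-(σ * t))) (C := C) (fun t ht => by
      rw [norm_mul, norm_ue, mul_one]
      rw [Set.uIoc_of_le hT] at ht
      exact h t ⟨ht.1.le, ht.2⟩)
  rwa [sub_zero, abs_of_nonneg hT] at this

lemma norm_ue_sub_le (a b : ℝ) : ‖ue a - ue b‖ ≤ |a - b| := by
  have h := Convex.norm_image_sub_le_of_norm_hasDerivWithin_le (f := ue)
    (f' := fun s => Complex.I * ue s) (s := Set.univ) (C := 1) (x := b) (y := a)
    (fun s _ => (ue_hasDerivAt s).hasDerivWithinAt)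
    (fun s _ => by simp [norm_ue]) convex_univ trivial trivial
  simpa using h

lemma norm_J_sub_le (hu : ContDiff ℝ (⊤ : ℕ∞) u) (hT : 0 ≤ T) {C : ℝ} {l : ℤ × ℤ}
    (h : ∀ t ∈ Set.Icc 0 T, ‖FT (fun x => u (t, x)) l‖ ≤ C) (σ σ₀ : ℝ) :
    ‖J T u l σ - J T u l σ₀‖ ≤ C * (|σ - σ₀| * T) * T := by
  simp only [J]
  rw [← intervalIntegral.integral_sub ((FT_time_continuous hu l σ).intervalIntegrable _ _)
    ((FT_time_continuous hu l σ₀).intervalIntegrable _ _)]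
  have := intervalIntegral.norm_integral_le_of_norm_le_const (a := 0) (b := T)
    (f := fun t => FT (fun x => u (t, x)) l * ue (-(σ * t)) -
      FT (fun x => u (t, x)) l * ue (-(σ₀ * t))) (C := C * (|σ - σ₀| * T)) (fun t ht => by
      rw [Set.uIoc_of_le hT] at ht
      have h1 := h t ⟨ht.1.le, ht.2⟩
      rw [← mul_sub, norm_mul]
      have h2 := norm_ue_sub_le (-(σ * t)) (-(σ₀ * t))
      have h3 : |-(σ * t) - -(σ₀ * t)| = |σ - σ₀| * t := by
        rw [show -(σ * t) - -(σ₀ * t) = -((σ - σ₀) * t) by ring, abs_neg, abs_mul,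
          abs_of_nonneg ht.1.le]
      rw [h3] at h2
      have h4 : |σ - σ₀| * t ≤ |σ - σ₀| * T := by gcongr; exact ht.2
      have h5 := (norm_nonneg _).trans h1
      gcongr
      exact h2.trans h4)
  rwa [sub_zero, abs_of_nonneg hT] at this

lemma J_ray (hu : ContDiff ℝ (⊤ : ℕ∞) u) (pu : SPer u) (hT : 0 ≤ T) {e : V2}
    (h : ∀ y, ∫ t in (0 : ℝ)..T, u (t, y - t • e) = 1) (m : ℤ × ℤ) :
    J T u m (2 * π * (m.1 * e.1 + m.2 * e.2)) = if m = 0 then 1 else 0 := by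
  have h1 : ∀ t : ℝ, FT (fun x => u (t, x)) m * ue (-(2 * π * (m.1 * e.1 + m.2 * e.2) * t)) =
      ∫ y in unitSq, u (t, y - t • e) * ch (-m) y := by
    intro t
    have pf : Zper fun y => u (t, y) * ch (-m) y := Zper.mul (pu t) (ch_per (-m))
    have cf : Continuous fun y => u (t, y) * ch (-m) y :=
      (hu.continuous.comp (by fun_prop)).mul (ch_contDiff (-m)).continuous
    rw [FT, ← integral_unitSq_add cf pf (-(t • e)), ← integral_mul_const]
    congr 1
    funext y
    have : ch (-m) y = ch (-m) (y + -(t • e)) * ue (-(2 * π * (m.1 * e.1 + m.2 * e.2) * t)) := by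
      rw [ch_add_right, mul_assoc]
      have : ch (-m) (-(t • e)) * ue (-(2 * π * (m.1 * e.1 + m.2 * e.2) * t)) = 1 := by
        simp only [ch, ue, ← Complex.exp_add]
        rw [← Complex.exp_zero]
        congr 1
        simp
        ring
      rw [this, mul_one]
    rw [this, sub_eq_add_neg]
    ring
  simp only [J, h1]
  rw [intervalIntegral.integral_of_le hT, ← integral_Icc_eq_integral_Ioc,
    integral_integral_swap]
  · have h2 : ∀ y, ∫ t in Set.Icc (0 : ℝ) T, u (t, y - t • e) * ch (-m) y = ch (-m) y := by
      intro y
      rw [integral_mul_const, integral_Icc_eq_integral_Ioc, ← intervalIntegral.integral_of_le hT,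
        h y, one_mul]
    simp only [h2]
    have := FT_ch 0 m
    simp only [FT, ch_zero, one_mul] at this
    rw [this]
    simp only [eq_comm]
  · have cc : Continuous fun q : ℝ × V2 => u (q.1, q.2 - q.1 • e) * ch (-m) q.2 := by
      have := hu.continuous
      have := (ch_contDiff (-m)).continuous
      fun_prop
    rw [Measure.prod_restrict]
    exact cc.continuousOn.integrableOn_compact (isCompact_Icc.prod unitSq_compact)

lemma J_tsum {ι : Type*} [Countable ι] {v : ι → ℝ × V2 → ℂ} (hv : ∀ i, ContDiff ℝ (⊤ : ℕ∞) (v i))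
    {a : ι → ℝ} (ha : Summable a) (hb : ∀ i p, ‖v i p‖ ≤ a i) (hT : 0 ≤ T) (l : ℤ × ℤ) (σ : ℝ) :
    J T (fun p => ∑' i, v i p) l σ = ∑' i, J T (v i) l σ := by
  have e : ∀ t, FT (fun x => ∑' i, v i (t, x)) l * ue (-(σ * t)) =
      ∑' i, FT (fun x => v i (t, x)) l * ue (-(σ * t)) := fun t => by
    rw [FT_tsum (u := fun i x => v i (t, x)) (fun i => (hv i).continuous.comp (by fun_prop)) ha
      (fun i x => hb i _), tsum_mul_right]
  simp only [J, e, intervalIntegral.integral_of_le hT, ← integral_Icc_eq_integral_Ioc]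
  refine setIntegral_tsum isCompact_Icc (fun i => FT_time_continuous (hv i) l σ) ha fun i t => ?_
  rw [norm_mul, norm_ue, mul_one]
  exact norm_FT_le (fun x => hb i _) l

end SpaceTime

/-! ### Solving almost diagonal systems of moment equations -/

/-- Frequencies together with a sign. -/
abbrev SFreq := (ℤ × ℤ) × Bool

lemma summable_lw_sfreq : Summable fun j : SFreq => (lw j.1 ^ 4)⁻¹ := by
  have h : Summable fun b : Bool => (1 : ℝ) := Summable.of_finite
  have := summable_lw.mul_of_nonneg h
    (fun l => by have := lw_pos l; positivity) (fun _ => zero_le_one)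
  simpa using this

/-- Reflection of the frequency about a center. -/
def sfreqReflect (l : ℤ × ℤ) : SFreq ≃ SFreq :=
  (Equiv.subLeft l).prodCongr (Equiv.refl Bool)

lemma summable_lw_sub (l : ℤ × ℤ) : Summable fun j : SFreq => (lw (l - j.1) ^ 4)⁻¹ :=
  (sfreqReflect l).summable_iff.2 summable_lw_sfreq

lemma tsum_lw_sub (l : ℤ × ℤ) : ∑' j : SFreq, (lw (l - j.1) ^ 4)⁻¹ =
    ∑' j : SFreq, (lw j.1 ^ 4)⁻¹ :=
  (sfreqReflect l).tsum_eq fun j : SFreq => (lw j.1 ^ 4)⁻¹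

section Neumann

variable {R : SFreq → SFreq → ℂ}

lemma norm_tsum_row_le {δ B : ℝ} (hδ : ∀ i j, ‖R i j‖ ≤ δ * (lw (i.1 - j.1) ^ 4)⁻¹)
    {x : SFreq → ℂ} (hx : ∀ j, ‖x j‖ ≤ B) (i : SFreq) :
    (Summable fun j => R i j * x j) ∧
      ‖∑' j, R i j * x j‖ ≤ δ * (∑' j : SFreq, (lw j.1 ^ 4)⁻¹) * B := by
  have hs := ((summable_lw_sub i.1).mul_left δ).mul_right B
  have hb : ∀ j, ‖R i j * x j‖ ≤ δ * (lw (i.1 - j.1) ^ 4)⁻¹ * B := fun j => by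
    rw [norm_mul]
    exact mul_le_mul (hδ i j) (hx j) (norm_nonneg _) ((norm_nonneg _).trans (hδ i j))
  refine ⟨hs.of_norm_bounded hb, (tsum_of_norm_bounded hs.hasSum hb).trans_eq ?_⟩
  rw [tsum_mul_right, tsum_mul_left, tsum_lw_sub]

lemma exists_bounded_solution {δ : ℝ} (hδ : ∀ i j, ‖R i j‖ ≤ δ * (lw (i.1 - j.1) ^ 4)⁻¹)
    (hS : δ * (∑' j : SFreq, (lw j.1 ^ 4)⁻¹) ≤ 1 / 2) {z : SFreq → ℂ} {C : ℝ}
    (hz : ∀ i, ‖z i‖ ≤ C) :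
    ∃ x : SFreq → ℂ, (∃ B, ∀ i, ‖x i‖ ≤ B) ∧ ∀ i, x i + ∑' j, R i j * x j = z i := by
  have hx : ∀ x : BoundedContinuousFunction SFreq ℂ, ∀ j, ‖x j‖ ≤ ‖x‖ :=
    fun x j => x.norm_coe_le_norm j
  let Φ : BoundedContinuousFunction SFreq ℂ → BoundedContinuousFunction SFreq ℂ := fun x =>
    BoundedContinuousFunction.ofNormedAddCommGroupDiscrete (fun i => z i - ∑' j, R i j * x j)
      (C + 1 / 2 * ‖x‖) fun i => (norm_sub_le _ _).trans (add_le_add (hz i)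
        ((norm_tsum_row_le hδ (hx x) i).2.trans
          (mul_le_mul_of_nonneg_right hS (norm_nonneg _))))
  have hΦ : ContractingWith (1 / 2) Φ := by
    refine ⟨by rw [div_lt_one (by norm_num)]; norm_num, LipschitzWith.of_dist_le_mul fun x y => ?_⟩
    rw [BoundedContinuousFunction.dist_le (by positivity)]
    intro i
    have e : Φ x i - Φ y i = ∑' j, R i j * (y - x) j := by
      change (z i - ∑' j, R i j * x j) - (z i - ∑' j, R i j * y j) = _
      rw [sub_sub_sub_cancel_left, ← (norm_tsum_row_le hδ (hx y) i).1.tsum_sub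
        (norm_tsum_row_le hδ (hx x) i).1]
      congr 1
      funext j
      rw [BoundedContinuousFunction.sub_apply]
      ring
    rw [dist_eq_norm, e, dist_comm x y, dist_eq_norm]
    refine (norm_tsum_row_le hδ (hx (y - x)) i).2.trans ?_
    have := mul_le_mul_of_nonneg_right hS (norm_nonneg (y - x))
    simpa using this
  obtain ⟨x, hfix⟩ : ∃ x, Φ x = x := ⟨_, hΦ.fixedPoint_isFixedPt⟩
  refine ⟨x, ⟨‖x‖, hx x⟩, fun i => ?_⟩
  have : z i - ∑' j, R i j * x j = x i := congrArg (fun f => f i) hfix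
  rw [← this]
  ring

theorem exists_rapid_solution {δ : ℝ} (hδ : ∀ i j, ‖R i j‖ ≤ δ * (lw (i.1 - j.1) ^ 4)⁻¹)
    (hS : δ * (∑' j : SFreq, (lw j.1 ^ 4)⁻¹) ≤ 1 / 2)
    (hR : ∀ M : ℕ, ∃ C, ∀ i j, ‖R i j‖ * lw (i.1 - j.1) ^ M * lw j.1 ≤ C) {z : SFreq → ℂ}
    (hz : ∀ M : ℕ, ∃ C, ∀ i, ‖z i‖ * lw i.1 ^ M ≤ C) :
    ∃ x : SFreq → ℂ, (∀ M : ℕ, ∃ C, ∀ i, ‖x i‖ * lw i.1 ^ M ≤ C) ∧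
      ∀ i, x i + ∑' j, R i j * x j = z i := by
  obtain ⟨C, hC⟩ := hz 0
  obtain ⟨x, ⟨B, hB⟩, hx⟩ := exists_bounded_solution hδ hS (fun i => by simpa using hC i)
  refine ⟨x, fun M => ?_, hx⟩
  induction M with
  | zero => exact ⟨B, fun i => by simpa using hB i⟩
  | succ M ih =>
    obtain ⟨C₀, h₀⟩ := ih
    obtain ⟨C₁, h₁⟩ := hz (M + 1)
    obtain ⟨C₂, h₂⟩ := hR (M + 1 + 4)
    have hC₂ : 0 ≤ C₂ := (mul_nonneg (mul_nonneg (norm_nonneg _) (pow_nonneg (lw_pos _).le _))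
      (lw_pos _).le).trans (h₂ (0, true) (0, true))
    have hC₀ : 0 ≤ C₀ := (mul_nonneg (norm_nonneg _) (pow_nonneg (lw_pos _).le _)).trans
      (h₀ (0, true))
    refine ⟨C₁ + C₂ * C₀ * ∑' j : SFreq, (lw j.1 ^ 4)⁻¹, fun i => ?_⟩
    have hli := lw_pos i.1
    have e : x i = z i - ∑' j, R i j * x j := by rw [← hx i]; ring
    have hb : ∀ j, ‖(lw i.1 ^ (M + 1) : ℂ) * (R i j * x j)‖ ≤
        C₂ * C₀ * (lw (i.1 - j.1) ^ 4)⁻¹ := fun j => by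
      have hlj := lw_pos j.1
      have hld := lw_pos (i.1 - j.1)
      have hle : lw i.1 ≤ lw (i.1 - j.1) * lw j.1 := by
        have := lw_add_le (i.1 - j.1) j.1
        rwa [sub_add_cancel] at this
      rw [norm_mul, norm_mul, norm_pow, Complex.norm_real, norm_of_nonneg hli.le]
      calc lw i.1 ^ (M + 1) * (‖R i j‖ * ‖x j‖)
          ≤ (lw (i.1 - j.1) * lw j.1) ^ (M + 1) * (‖R i j‖ * ‖x j‖) := by gcongr
        _ = (‖R i j‖ * lw (i.1 - j.1) ^ (M + 1 + 4) * lw j.1) * (‖x j‖ * lw j.1 ^ M) *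
            (lw (i.1 - j.1) ^ 4)⁻¹ := by
          field_simp
          ring
        _ ≤ C₂ * C₀ * (lw (i.1 - j.1) ^ 4)⁻¹ := by
          gcongr
          · exact h₂ i j
          · exact h₀ j
    have hsum := tsum_of_norm_bounded ((summable_lw_sub i.1).mul_left (C₂ * C₀)).hasSum hb
    rw [tsum_mul_left, tsum_mul_left, tsum_lw_sub, norm_mul, norm_pow, Complex.norm_real,
      norm_of_nonneg hli.le] at hsum
    calc ‖x i‖ * lw i.1 ^ (M + 1)
        ≤ (‖z i‖ + ‖∑' j, R i j * x j‖) * lw i.1 ^ (M + 1) := by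
          gcongr
          rw [e]
          refine (norm_sub_le _ _).trans_eq ?_
          rfl
      _ = ‖z i‖ * lw i.1 ^ (M + 1) + lw i.1 ^ (M + 1) * ‖∑' j, R i j * x j‖ := by ring
      _ ≤ _ := add_le_add (h₁ i) hsum

end Neumann

/-! ### Almost diagonality of the moment matrix -/

/-- The sign attached to a Boolean. -/
def sgb (b : Bool) : ℝ := if b then 1 else -1

lemma sgb_sq (b : Bool) : sgb b * sgb b = 1 := by cases b <;> simp [sgb]

lemma abs_sgb (b : Bool) : |sgb b| = 1 := by cases b <;> simp [sgb]

lemma sgb_ne {b b' : Bool} (h : b ≠ b') : sgb b' = -sgb b := by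
  cases b <;> cases b' <;> simp_all [sgb]

/-- Euclidean length of a frequency. -/
def el (l : ℤ × ℤ) : ℝ := en ((l.1 : ℝ), (l.2 : ℝ))

lemma el_sq (l : ℤ × ℤ) : el l ^ 2 = (l.1 : ℝ) ^ 2 + (l.2 : ℝ) ^ 2 := en_sq _

lemma el_nonneg (l : ℤ × ℤ) : 0 ≤ el l := en_nonneg _

lemma el_pos {l : ℤ × ℤ} (hl : l ≠ 0) : 0 < el l := one_pos.trans_le (one_le_en_int hl)

lemma nu_eq (c : ℝ) (l : ℤ × ℤ) : nu c l = 2 * π * c * el l := rfl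

lemma el_le_lw (l : ℤ × ℤ) : el l ≤ lw l := en_le_lw l

lemma one_add_el_le_lw (l : ℤ × ℤ) : 1 + el l ≤ lw l := by
  have : el l ≤ |(l.1 : ℝ)| + |(l.2 : ℝ)| := by
    refine abs_le_of_sq_le_sq' ?_ (by positivity) |>.2
    rw [el_sq, ← sq_abs (l.1 : ℝ), ← sq_abs (l.2 : ℝ)]
    nlinarith [abs_nonneg (l.1 : ℝ), abs_nonneg (l.2 : ℝ)]
  unfold lw
  linarith

lemma lw_le_el {l : ℤ × ℤ} (hl : l ≠ 0) : lw l ≤ 3 * el l := by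
  have h := one_le_en_int hl
  have h1 := abs_le_en ((l.1 : ℝ), (l.2 : ℝ))
  change 1 ≤ el l at h
  have : |(l.1 : ℝ)| ≤ el l := h1.1
  have : |(l.2 : ℝ)| ≤ el l := h1.2
  unfold lw
  linarith

/-- The direction angle of a signed frequency. -/
def ang (j : SFreq) : ℝ := Complex.arg ⟨sgb j.2 * j.1.1, sgb j.2 * j.1.2⟩

lemma ang_mem (j : SFreq) : ang j ∈ Set.Icc (-π) π :=
  ⟨(Complex.neg_pi_lt_arg _).le, Complex.arg_le_pi _⟩

lemma ang_spec (j : SFreq) : el j.1 * cos (ang j) = sgb j.2 * j.1.1 ∧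
    el j.1 * sin (ang j) = sgb j.2 * j.1.2 := by
  have h : el j.1 = ‖(⟨sgb j.2 * j.1.1, sgb j.2 * j.1.2⟩ : ℂ)‖ := by
    rw [← en_eq_norm ((sgb j.2 * j.1.1, sgb j.2 * j.1.2))]
    have e : ((sgb j.2 * j.1.1, sgb j.2 * j.1.2) : V2) = sgb j.2 • ((j.1.1 : ℝ), (j.1.2 : ℝ)) := by
      simp
    rw [e, en_smul, abs_sgb, one_mul, el]
  rw [h]
  exact ⟨Complex.norm_mul_cos_arg _, Complex.norm_mul_sin_arg _⟩

/-- The inner product of two frequencies. -/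
def dotp (k l : ℤ × ℤ) : ℝ := k.1 * l.1 + k.2 * l.2

lemma abs_dotp_le (k l : ℤ × ℤ) : |dotp k l| ≤ el k * el l := by
  refine abs_le_of_sq_le_sq ?_ (mul_nonneg (el_nonneg _) (el_nonneg _))
  rw [mul_pow, el_sq, el_sq, dotp]
  nlinarith [sq_nonneg ((k.1 : ℝ) * l.2 - k.2 * l.1)]

lemma dotp_div_le {k : ℤ × ℤ} (hk : k ≠ 0) (l : ℤ × ℤ) :
    |dotp k l| / el k ^ 2 ≤ lw (l - k) := by
  have hk0 := one_le_en_int hk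
  change 1 ≤ el k at hk0
  have h1 : dotp k l = el k ^ 2 + dotp k (l - k) := by
    rw [el_sq]; simp only [dotp, Prod.fst_sub, Prod.snd_sub]; push_cast; ring
  have h2 := abs_dotp_le k (l - k)
  have h3 := one_add_el_le_lw (l - k)
  have h4 := el_nonneg (l - k)
  rw [div_le_iff₀ (by positivity), h1]
  calc |el k ^ 2 + dotp k (l - k)| ≤ el k ^ 2 + el k * el (l - k) :=
        (abs_add_le _ _).trans (add_le_add (abs_of_nonneg (by positivity)).le h2)
    _ ≤ el k ^ 2 + el k ^ 2 * el (l - k) := by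
      have : el k * el (l - k) ≤ el k ^ 2 * el (l - k) := by
        have : el k ≤ el k ^ 2 := by nlinarith
        gcongr
      linarith
    _ = (1 + el (l - k)) * el k ^ 2 := by ring
    _ ≤ _ := by gcongr

lemma phase_le {k : ℤ × ℤ} (hk : k ≠ 0) (l : ℤ × ℤ) :
    |el l - el k - dotp k (l - k) / el k| ≤ lw (l - k) ^ 2 / el k := by
  have hk0 := el_pos hk
  have h1 : el l - el k - dotp k (l - k) / el k = (el l * el k - dotp k l) / el k := by
    have : dotp k (l - k) = dotp k l - el k ^ 2 := by
      rw [el_sq]; simp only [dotp, Prod.fst_sub, Prod.snd_sub]; push_cast; ring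
    rw [this]
    field_simp
    ring
  rw [h1, abs_div, abs_of_pos hk0]
  gcongr
  have h2 := abs_le.1 (abs_dotp_le k l)
  rw [abs_of_nonneg (by linarith)]
  have h3 := el_le_lw (l - k)
  have h4 : el (l - k) ^ 2 = el l ^ 2 + el k ^ 2 - 2 * dotp k l := by
    simp only [el_sq, dotp, Prod.fst_sub, Prod.snd_sub]; push_cast; ring
  have h5 : el (l - k) ^ 2 ≤ lw (l - k) ^ 2 := by
    have := el_nonneg (l - k); gcongr
  nlinarith [sq_nonneg (el l - el k), sq_nonneg (el (l - k))]

/-- The moment matrix. -/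
def momMat (c T : ℝ) (H : (ℝ × ℝ) × V2 → ℂ) (i j : SFreq) : ℂ :=
  ((sgb i.2 * sgb j.2 * (dotp j.1 i.1 / el j.1 ^ 2) : ℝ) : ℂ) *
    J T (fun p => H ((ang j, p.1), p.2)) (i.1 - j.1) (sgb i.2 * nu c i.1 - sgb j.2 * nu c j.1)

theorem momMat_sub_one_le {c T : ℝ} (hc : 0 < c) (hT : 0 < T) {H : (ℝ × ℝ) × V2 → ℂ}
    (hH : ContDiff ℝ (⊤ : ℕ∞) H) (pH : SPer H)
    (zH : ∀ α t x, t ≤ 0 ∨ T ≤ t → H ((α, t), x) = 0)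
    (rH : ∀ α y, ∫ t in (0 : ℝ)..T, H ((α, t), y - t • (c * cos α, c * sin α)) = 1) (M : ℕ) :
    ∃ C, ∀ i j : SFreq, j.1 ≠ 0 →
      ‖momMat c T H i j - if i = j then 1 else 0‖ * lw (i.1 - j.1) ^ M * lw j.1 ≤ C := by
  have hcomp := (isCompact_Icc (a := -π) (b := π)).prod (isCompact_Icc (a := (0 : ℝ)) (b := T))
  obtain ⟨C₁, h01, hC₁⟩ := FT_decay hcomp (M + 3) hH pH
  obtain ⟨C₂, h02, hC₂⟩ := FT_decay hcomp (M + 3) (hH.dd_top (((0 : ℝ), (1 : ℝ)), (0 : V2)))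
    (pH.dd _)
  refine ⟨max (C₁ * T * T * (2 * π * c) * 3) (C₂ * T / (2 * π * c) * 3), fun i j hj => ?_⟩
  set m := i.1 - j.1 with hm
  have hlw := lw_pos m
  have hlj := lw_pos j.1
  have hek := el_pos hj
  have hle := lw_le_el hj
  have hpre : ‖((sgb i.2 * sgb j.2 * (dotp j.1 i.1 / el j.1 ^ 2) : ℝ) : ℂ)‖ ≤ lw m := by
    rw [Complex.norm_real, norm_eq_abs, abs_mul, abs_mul, abs_sgb, abs_sgb, one_mul, one_mul,
      abs_div, abs_of_nonneg (by positivity : 0 ≤ el j.1 ^ 2)]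
    exact dotp_div_le hj _
  set u : ℝ × V2 → ℂ := fun p => H ((ang j, p.1), p.2) with hu
  have su : ContDiff ℝ (⊤ : ℕ∞) u := by rw [hu]; fun_prop
  have pu : SPer u := fun t => pH (ang j, t)
  have b1 : ∀ t ∈ Set.Icc 0 T, ‖FT (fun x => u (t, x)) m‖ ≤ C₁ / lw m ^ (M + 3) := fun t ht => by
    rw [le_div_iff₀ (by positivity)]
    exact hC₁ (ang j, t) ⟨ang_mem j, ht⟩ m
  by_cases hs : i.2 = j.2
  · refine le_trans ?_ (le_max_left _ _)
    have ray := J_ray su pu hT.le (e := (c * cos (ang j), c * sin (ang j))) (rH (ang j)) m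
    set σ := sgb i.2 * nu c i.1 - sgb j.2 * nu c j.1 with hσ
    set σ₀ := 2 * π * (m.1 * (c * cos (ang j)) + m.2 * (c * sin (ang j))) with hσ₀
    change J T u m σ₀ = _ at ray
    have e0 : |σ - σ₀| ≤ 2 * π * c * (lw m ^ 2 / el j.1) := by
      have hsp := ang_spec j
      have e1 : cos (ang j) = sgb j.2 * j.1.1 / el j.1 := by
        rw [eq_div_iff hek.ne', ← hsp.1]; ring
      have e2 : sin (ang j) = sgb j.2 * j.1.2 / el j.1 := by
        rw [eq_div_iff hek.ne', ← hsp.2]; ring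
      have : σ - σ₀ = sgb j.2 * (2 * π * c) * (el i.1 - el j.1 - dotp j.1 m / el j.1) := by
        rw [hσ, hσ₀, e1, e2, hs, nu_eq, nu_eq, dotp]
        field_simp
      rw [this, abs_mul, abs_mul, abs_sgb, one_mul, abs_of_pos (by positivity)]
      gcongr
      exact phase_le hj i.1
    have e1 := norm_J_sub_le su hT.le b1 σ σ₀
    rw [ray] at e1
    have e2 : momMat c T H i j - (if i = j then 1 else 0) =
        ((sgb i.2 * sgb j.2 * (dotp j.1 i.1 / el j.1 ^ 2) : ℝ) : ℂ) *
          (J T u m σ - if m = 0 then 1 else 0) := by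
      rw [mul_sub]
      congr 1
      by_cases h : m = 0
      · have h' : i.1 = j.1 := sub_eq_zero.1 h
        rw [if_pos h, if_pos (Prod.ext h' hs), h', hs, sgb_sq, dotp, el_sq]
        have := el_sq j.1 ▸ (by positivity : el j.1 ^ 2 ≠ 0)
        rw [← sq, ← sq, div_self this]
        simp
      · rw [if_neg h, if_neg, mul_zero]
        rintro rfl
        exact h (sub_self _)
    rw [e2, norm_mul]
    calc _ ≤ lw m * (C₁ / lw m ^ (M + 3) * (2 * π * c * (lw m ^ 2 / el j.1) * T) * T) *
          lw m ^ M * (3 * el j.1) := by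
          gcongr
          refine e1.trans ?_
          gcongr
      _ = C₁ * T * T * (2 * π * c) * 3 := by field_simp; ring
  · refine le_trans ?_ (le_max_right _ _)
    set σ := sgb i.2 * nu c i.1 - sgb j.2 * nu c j.1 with hσ
    have hnu : 0 < nu c j.1 := nu_pos hc hj
    have hnu' : 0 ≤ nu c i.1 := by rw [nu_eq]; have := el_nonneg i.1; positivity
    have hσ1 : nu c j.1 ≤ |σ| := by
      rw [hσ, sgb_ne hs, neg_mul, sub_neg_eq_add, ← mul_add, abs_mul, abs_sgb, one_mul]
      exact (by linarith : nu c j.1 ≤ nu c i.1 + nu c j.1).trans (le_abs_self _)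
    have hd : ∀ p : ℝ × V2, dd dT u p = dd (((0 : ℝ), (1 : ℝ)), (0 : V2)) H ((ang j, p.1), p.2) := by
      intro p
      have ha : HasFDerivAt (fun p : ℝ × V2 => p.1) (ContinuousLinearMap.fst ℝ ℝ V2) p :=
        hasFDerivAt_fst
      have hb : HasFDerivAt (fun p : ℝ × V2 => p.2) (ContinuousLinearMap.snd ℝ ℝ V2) p :=
        hasFDerivAt_snd
      have h1 := ((hasFDerivAt_const (𝕜 := ℝ) (ang j) p).prodMk ha).prodMk hb
      have h2 := (hH.differentiable_top ((ang j, p.1), p.2)).hasFDerivAt.comp p h1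
      simp only [dd]
      rw [show u = H ∘ fun p : ℝ × V2 => ((ang j, p.1), p.2) from rfl, h2.fderiv]
      simp [dT]
      rfl
    have b2 : ∀ t ∈ Set.Icc 0 T, ‖FT (fun x => dd dT u (t, x)) m‖ ≤ C₂ / lw m ^ (M + 3) :=
      fun t ht => by
        rw [le_div_iff₀ (by positivity)]
        simp only [hd]
        exact hC₂ (ang j, t) ⟨ang_mem j, ht⟩ m
    have e1 := norm_J_le hT.le b2 σ
    rw [J_dT su (fun x => zH _ _ _ (Or.inl le_rfl)) (fun x => zH _ _ _ (Or.inr le_rfl)), norm_mul,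
      norm_mul, Complex.norm_I, mul_one, Complex.norm_real, norm_eq_abs] at e1
    have e2 : ‖J T u m σ‖ ≤ C₂ / lw m ^ (M + 3) * T / nu c j.1 := by
      rw [le_div_iff₀ hnu]
      refine le_trans ?_ e1
      rw [mul_comm]
      gcongr
    have hij : i ≠ j := fun h => hs (h ▸ rfl)
    rw [if_neg hij, sub_zero, momMat, norm_mul]
    calc _ ≤ lw m * (C₂ / lw m ^ (M + 3) * T / nu c j.1) * lw m ^ M * (3 * el j.1) := by gcongr
      _ = C₂ * T / (2 * π * c) * 3 * (1 / lw m ^ 2) := by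
        rw [nu_eq]
        field_simp
        ring
      _ ≤ C₂ * T / (2 * π * c) * 3 * 1 := by
        gcongr
        rw [div_le_one (by positivity)]
        exact one_le_pow₀ (one_le_lw m)
      _ = _ := mul_one _

/-! ### Controlled sources: orthogonality to high frequency waves -/

lemma J_sub {T : ℝ} {u v : ℝ × V2 → ℂ} (hu : ContDiff ℝ (⊤ : ℕ∞) u) (hv : ContDiff ℝ (⊤ : ℕ∞) v)
    (l : ℤ × ℤ) (σ : ℝ) : J T (fun p => u p - v p) l σ = J T u l σ - J T v l σ := by
  simp only [J]
  rw [← intervalIntegral.integral_sub ((FT_time_continuous hu l σ).intervalIntegrable _ _)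
    ((FT_time_continuous hv l σ).intervalIntegrable _ _)]
  congr 1
  funext t
  rw [FT_sub (φ := fun x => u (t, x)) (ψ := fun x => v (t, x))
    (hu.continuous.comp (by fun_prop : Continuous fun x : V2 => (t, x)))
    (hv.continuous.comp (by fun_prop : Continuous fun x : V2 => (t, x)))]
  ring

lemma J_const_mul (T : ℝ) (a : ℂ) (u : ℝ × V2 → ℂ) (l : ℤ × ℤ) (σ : ℝ) :
    J T (fun p => a * u p) l σ = a * J T u l σ := by
  simp only [J, FT_const_mul, mul_assoc, intervalIntegral.integral_const_mul]

lemma J_decay {T : ℝ} (hT : 0 ≤ T) {u : ℝ × V2 → ℂ} (hu : ContDiff ℝ (⊤ : ℕ∞) u) (pu : SPer u)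
    (M : ℕ) : ∃ C, ∀ l σ, ‖J T u l σ‖ * lw l ^ M ≤ C := by
  obtain ⟨C, -, hC⟩ := FT_decay (isCompact_Icc (a := (0 : ℝ)) (b := T)) M hu pu
  refine ⟨C * T, fun l σ => ?_⟩
  have hl := lw_pos l
  have := norm_J_le hT (u := u) (C := C / lw l ^ M) (l := l) (fun t ht => by
    rw [le_div_iff₀ (by positivity)]; exact hC t ht l) σ
  calc _ ≤ C / lw l ^ M * T * lw l ^ M := by gcongr
    _ = C * T := by field_simp

lemma abs_fst_le_el (l : ℤ × ℤ) : |(l.1 : ℝ)| ≤ el l := (abs_le_en ((l.1 : ℝ), (l.2 : ℝ))).1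

lemma abs_snd_le_el (l : ℤ × ℤ) : |(l.2 : ℝ)| ≤ el l := (abs_le_en ((l.1 : ℝ), (l.2 : ℝ))).2

lemma abs_fst_le_lw (l : ℤ × ℤ) : |(l.1 : ℝ)| ≤ lw l := (abs_fst_le_el l).trans (el_le_lw l)

lemma abs_snd_le_lw (l : ℤ × ℤ) : |(l.2 : ℝ)| ≤ lw l := (abs_snd_le_el l).trans (el_le_lw l)

/-- The wave packets used as correctors. -/
def packet (c : ℝ) (H : (ℝ × ℝ) × V2 → ℂ) (j : SFreq) (p : ℝ × V2) : ℂ :=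
  H ((ang j, p.1), p.2) * (ch j.1 p.2 * ue (sgb j.2 * nu c j.1 * p.1))

lemma tame_packet {c T : ℝ} (hc : 0 < c) {H : (ℝ × ℝ) × V2 → ℂ}
    (hH : ContDiff ℝ (⊤ : ℕ∞) H) (pH : SPer H)
    (zH : ∀ α t x, t ≤ 0 ∨ T ≤ t → H ((α, t), x) = 0) :
    Tame (fun j : SFreq => lw j.1) (packet c H) := by
  have hw : ∀ j : SFreq, 1 ≤ lw j.1 := fun j => one_le_lw _
  have h1 := tame_window hw hH pH zH (α := ang) ang_mem
  have h2 : Tame (fun j : SFreq => lw j.1) fun j (p : ℝ × V2) => ch j.1 p.2 := by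
    have h := tame_ch.comp_clm (ContinuousLinearMap.snd ℝ ℝ V2)
    exact ⟨fun j => h.1 j.1, fun n => by
      obtain ⟨C, M, hC⟩ := h.2 n
      exact ⟨C, M, fun j => hC j.1⟩⟩
  have h3 : Tame (fun j : SFreq => lw j.1) fun j (p : ℝ × V2) =>
      ue (sgb j.2 * nu c j.1 * p.1) := by
    refine tame_ue hw (L := fun j : SFreq => (sgb j.2 * nu c j.1) •
      ContinuousLinearMap.fst ℝ ℝ V2) (C := 2 * π * c) fun j => ?_
    rw [norm_smul]
    have h := ContinuousLinearMap.norm_fst_le ℝ ℝ V2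
    have hn : ‖sgb j.2 * nu c j.1‖ ≤ 2 * π * c * lw j.1 := by
      rw [norm_eq_abs, abs_mul, abs_sgb, one_mul, nu_eq, abs_of_nonneg
        (by have := el_nonneg j.1; positivity)]
      have := el_le_lw j.1
      gcongr
    calc _ ≤ 2 * π * c * lw j.1 * 1 := mul_le_mul hn h (norm_nonneg _) ((norm_nonneg _).trans hn)
      _ = _ := mul_one _
  exact h1.mul hw (h2.mul hw h3)

lemma J_packet (c T : ℝ) (H : (ℝ × ℝ) × V2 → ℂ) (j : SFreq) (l : ℤ × ℤ) (σ : ℝ) :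
    J T (packet c H j) l σ =
      J T (fun p => H ((ang j, p.1), p.2)) (l - j.1) (σ - sgb j.2 * nu c j.1) :=
  J_mul_wave j.1 l _ σ

section Superposition

variable {c T : ℝ} {K : Set V2} {H : (ℝ × ℝ) × V2 → ℂ}

lemma superposition (hc : 0 < c) (hT : 0 ≤ T)
    (hH : ContDiff ℝ (⊤ : ℕ∞) H) (pH : SPer H)
    (zH : ∀ α t x, t ≤ 0 ∨ T ≤ t → H ((α, t), x) = 0)
    (kH : ∀ α t x, x ∉ K → H ((α, t), x) = 0) {a : SFreq → ℂ}
    (ha : ∀ M : ℕ, ∃ C, ∀ j, ‖a j‖ * lw j.1 ^ M ≤ C) :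
    ∃ D : ℝ × V2 → ℂ, ContDiff ℝ (⊤ : ℕ∞) D ∧ SPer D ∧ (∀ t x, t ≤ 0 ∨ T ≤ t → D (t, x) = 0) ∧
      (∀ t x, x ∉ K → D (t, x) = 0) ∧
      ∀ l σ, HasSum (fun j : SFreq => a j *
        J T (fun p => H ((ang j, p.1), p.2)) (l - j.1) (σ - sgb j.2 * nu c j.1)) (J T D l σ) := by
  have hw : ∀ j : SFreq, 1 ≤ lw j.1 := fun j => one_le_lw _
  have hr : Rapid (fun j : SFreq => lw j.1) fun j p => a j * packet c H j p :=
    (rapid_const ha).mul_tame hw (tame_packet hc hH pH zH)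
  obtain ⟨v, hv, hb⟩ := hr.norm_bound hw summable_lw_sfreq
  refine ⟨fun p => ∑' j, a j * packet c H j p, hr.contDiff_tsum hw summable_lw_sfreq,
    fun t x m n => ?_, fun t x ht => ?_, fun t x hx => ?_, fun l σ => ?_⟩
  · have e : ∀ j, packet c H j (t, (x.1 + m, x.2 + n)) = packet c H j (t, x) := fun j => by
      have h1 := pH (ang j, t) x m n
      have h2 := ch_per j.1 x m n
      simp only at h1
      simp only [packet, h1, h2]
    simp only [e]
  · simp [packet, zH _ t x ht]
  · simp [packet, kH _ t x hx]
  · have hs : Summable fun j => J T (fun p => a j * packet c H j p) l σ :=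
      (hv.mul_right T).of_norm_bounded fun j => norm_J_le hT (fun t _ => norm_FT_le
        (fun x => hb j (t, x)) l) σ
    have := hs.hasSum
    rw [← J_tsum (fun j => hr.1 j) hv hb hT] at this
    simpa only [J_const_mul, J_packet] using this

theorem exists_source_high (hc : 0 < c) (hT : 0 < T) (hK : IsClosed K)
    (hH : ContDiff ℝ (⊤ : ℕ∞) H) (pH : SPer H)
    (zH : ∀ α t x, t ≤ 0 ∨ T ≤ t → H ((α, t), x) = 0)
    (kH : ∀ α t x, x ∉ K → H ((α, t), x) = 0)
    (rH : ∀ α y, ∫ t in (0 : ℝ)..T, H ((α, t), y - t • (c * cos α, c * sin α)) = 1)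
    {W₁ W₂ : V2 → ℂ} (hW1 : ContDiff ℝ (⊤ : ℕ∞) W₁) (hW2 : ContDiff ℝ (⊤ : ℕ∞) W₂)
    (pW1 : Zper W₁) (pW2 : Zper W₂) (kW1 : ∀ x, x ∉ K → W₁ x = 0) (kW2 : ∀ x, x ∉ K → W₂ x = 0) :
    ∃ N : ℝ, ∃ w₁ w₂ : ℝ × V2 → ℂ, ContDiff ℝ (⊤ : ℕ∞) w₁ ∧ ContDiff ℝ (⊤ : ℕ∞) w₂ ∧
      SPer w₁ ∧ SPer w₂ ∧ (∀ t x, t ≤ 0 ∨ T ≤ t → w₁ (t, x) = 0 ∧ w₂ (t, x) = 0) ∧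
      (∀ t x, x ∉ K → w₁ (t, x) = 0 ∧ w₂ (t, x) = 0) ∧
      (∀ x, ∫ t in (0 : ℝ)..T, w₁ (t, x) = W₁ x ∧ ∫ t in (0 : ℝ)..T, w₂ (t, x) = W₂ x) ∧
      ∀ l, N ≤ lw l → ∀ r : ℝ, r = 1 ∨ r = -1 →
        (l.1 : ℂ) * J T w₂ l (r * nu c l) - l.2 * J T w₁ l (r * nu c l) = 0 := by
  obtain ⟨η, hη, zη, iη⟩ := exists_time_bump hT
  set q : (V2 → ℂ) → ℝ × V2 → ℂ := fun W p => (η p.1 : ℂ) * W p.2 with hq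
  have sq : ∀ {W : V2 → ℂ}, ContDiff ℝ (⊤ : ℕ∞) W → ContDiff ℝ (⊤ : ℕ∞) (q W) := fun {W} hW =>
    (Complex.ofRealCLM.contDiff.comp (hη.comp contDiff_fst)).mul (hW.comp contDiff_snd)
  have pq : ∀ {W : V2 → ℂ}, Zper W → SPer (q W) := fun {W} hW t x m n => by
    simp only [hq, hW x m n]
  have cq : ∀ (W : V2 → ℂ) x, ∫ t in (0 : ℝ)..T, q W (t, x) = W x := fun W x => by
    simp only [hq]
    rw [intervalIntegral.integral_mul_const, intervalIntegral.integral_ofReal, iη]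
    simp
  have hM := momMat_sub_one_le hc hT hH pH zH rH
  obtain ⟨C₄, hC₄⟩ := hM 4
  set S := ∑' j : SFreq, (lw j.1 ^ 4)⁻¹ with hS
  have hS0 : 0 ≤ S := tsum_nonneg fun j => by have := lw_pos j.1; positivity
  have hC₄0 : 0 ≤ C₄ := (mul_nonneg (mul_nonneg (norm_nonneg _) (pow_nonneg (lw_pos _).le _))
      (lw_pos _).le).trans (hC₄ ((1, 0), true) ((1, 0), true) (by simp))
  set N : ℝ := 2 + 2 * C₄ * S with hN
  have hN2 : 2 ≤ N := by rw [hN]; linarith [mul_nonneg hC₄0 hS0]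
  have hN0 : ∀ {l : ℤ × ℤ}, N ≤ lw l → l ≠ 0 := by
    rintro l hl rfl
    have : lw 0 = 1 := by simp [lw]
    linarith
  set R : SFreq → SFreq → ℂ := fun i j => if N ≤ lw i.1 ∧ N ≤ lw j.1 then
    momMat c T H i j - (if i = j then 1 else 0) else 0 with hR
  set Lam : SFreq → ℂ := fun i => (i.1.1 : ℂ) * J T (q W₂) i.1 (sgb i.2 * nu c i.1) -
    i.1.2 * J T (q W₁) i.1 (sgb i.2 * nu c i.1) with hLam
  set z : SFreq → ℂ := fun i => if N ≤ lw i.1 then Lam i / el i.1 else 0 with hz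
  have hzd : ∀ M : ℕ, ∃ C, ∀ i, ‖z i‖ * lw i.1 ^ M ≤ C := fun M => by
    obtain ⟨C₁, h₁⟩ := J_decay hT.le (sq hW1) (pq pW1) M
    obtain ⟨C₂, h₂⟩ := J_decay hT.le (sq hW2) (pq pW2) M
    have hC₁ : 0 ≤ C₁ := (mul_nonneg (norm_nonneg _) (pow_nonneg (lw_pos _).le _)).trans (h₁ 0 0)
    have hC₂ : 0 ≤ C₂ := (mul_nonneg (norm_nonneg _) (pow_nonneg (lw_pos _).le _)).trans (h₂ 0 0)
    refine ⟨C₂ + C₁, fun i => ?_⟩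
    simp only [hz]
    split_ifs with h
    · have he := el_pos (hN0 h)
      have hl := lw_pos i.1
      rw [norm_div, Complex.norm_real, norm_of_nonneg he.le, div_mul_eq_mul_div, div_le_iff₀ he]
      have a1 := abs_fst_le_el i.1
      have a2 := abs_snd_le_el i.1
      have b1 : ‖Lam i‖ ≤ el i.1 * ‖J T (q W₂) i.1 (sgb i.2 * nu c i.1)‖ +
          el i.1 * ‖J T (q W₁) i.1 (sgb i.2 * nu c i.1)‖ := by
        refine (norm_sub_le _ _).trans ?_
        rw [norm_mul, norm_mul, Complex.norm_intCast, Complex.norm_intCast]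
        gcongr
      calc ‖Lam i‖ * lw i.1 ^ M ≤ (el i.1 * ‖J T (q W₂) i.1 (sgb i.2 * nu c i.1)‖ +
          el i.1 * ‖J T (q W₁) i.1 (sgb i.2 * nu c i.1)‖) * lw i.1 ^ M := by gcongr
        _ = (‖J T (q W₂) i.1 (sgb i.2 * nu c i.1)‖ * lw i.1 ^ M +
          ‖J T (q W₁) i.1 (sgb i.2 * nu c i.1)‖ * lw i.1 ^ M) * el i.1 := by ring
        _ ≤ _ := by gcongr; exacts [h₂ _ _, h₁ _ _]
    · simp only [norm_zero, zero_mul]; positivity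
  have hδ : ∀ i j, ‖R i j‖ ≤ C₄ / N * (lw (i.1 - j.1) ^ 4)⁻¹ := fun i j => by
    have := lw_pos (i.1 - j.1)
    simp only [hR]
    by_cases h : N ≤ lw i.1 ∧ N ≤ lw j.1
    · rw [if_pos h]
      have h4 := hC₄ i j (hN0 h.2)
      rw [div_mul_eq_mul_div, ← div_eq_mul_inv, div_div, le_div_iff₀ (by positivity)]
      refine le_trans ?_ h4
      rw [← mul_assoc]
      gcongr
      exact h.2
    · rw [if_neg h, norm_zero]; positivity
  obtain ⟨x, hx, ex⟩ := exists_rapid_solution (R := R) (δ := C₄ / N) (z := z) hδ (by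
      rw [div_mul_eq_mul_div, div_le_iff₀ (by linarith)]
      rw [hN]; linarith) (fun M => by
      obtain ⟨C, hC⟩ := hM M
      have hC0 : 0 ≤ C := (mul_nonneg (mul_nonneg (norm_nonneg _) (pow_nonneg (lw_pos _).le _))
        (lw_pos _).le).trans (hC ((1, 0), true) ((1, 0), true) (by simp))
      refine ⟨C, fun i j => ?_⟩
      simp only [hR]
      by_cases h : N ≤ lw i.1 ∧ N ≤ lw j.1
      · rw [if_pos h]
        exact hC i j (hN0 h.2)
      · rw [if_neg h]
        simpa using hC0) hzd
  have xlow : ∀ i : SFreq, ¬ N ≤ lw i.1 → x i = 0 := fun i hi => by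
    have := ex i
    simp only [hR, hz, hi, false_and, if_false, zero_mul, tsum_zero, add_zero] at this
    exact this
  set y : SFreq → ℂ := fun j => x j / (Complex.I * (sgb j.2 * nu c j.1 * el j.1 : ℝ)) with hy
  have hyx : ∀ j, ‖y j‖ ≤ (2 * π * c)⁻¹ * ‖x j‖ := fun j => by
    by_cases hj : N ≤ lw j.1
    · have he : 1 ≤ el j.1 := one_le_en_int (hN0 hj)
      simp only [hy]
      rw [norm_div, norm_mul, Complex.norm_I, one_mul, Complex.norm_real, norm_eq_abs, abs_mul,
        abs_mul, abs_sgb, one_mul, nu_eq, abs_of_nonneg (by positivity), abs_of_nonneg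
        (by positivity), inv_mul_eq_div]
      have : 2 * π * c * 1 * 1 ≤ 2 * π * c * el j.1 * el j.1 := by gcongr
      exact div_le_div_of_nonneg_left (norm_nonneg _) (by positivity) (by linarith)
    · simp [hy, xlow j hj]
  have hyd : ∀ {κ : SFreq → ℂ}, (∀ j, ‖κ j‖ ≤ lw j.1) →
      ∀ M : ℕ, ∃ C, ∀ j, ‖κ j * y j‖ * lw j.1 ^ M ≤ C := fun {κ} hκ M => by
    obtain ⟨C, hC⟩ := hx (M + 1)
    refine ⟨(2 * π * c)⁻¹ * C, fun j => ?_⟩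
    have hl := lw_pos j.1
    rw [norm_mul]
    calc _ ≤ lw j.1 * ((2 * π * c)⁻¹ * ‖x j‖) * lw j.1 ^ M := by gcongr; exacts [hκ j, hyx j]
      _ = (2 * π * c)⁻¹ * (‖x j‖ * lw j.1 ^ (M + 1)) := by ring
      _ ≤ _ := by gcongr; exact hC j
  obtain ⟨D₁, sD1, pD1, zD1, kD1, jD1⟩ := superposition (K := K) hc hT.le hH pH zH kH
    (a := fun j => (-(j.1.2 : ℂ)) * y j) (hyd fun j => by
      rw [norm_neg, Complex.norm_intCast]; exact abs_snd_le_lw _)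
  obtain ⟨D₂, sD2, pD2, zD2, kD2, jD2⟩ := superposition (K := K) hc hT.le hH pH zH kH
    (a := fun j => (j.1.1 : ℂ) * y j) (hyd fun j => by
      rw [Complex.norm_intCast]; exact abs_fst_le_lw _)
  have offK : ∀ {D : ℝ × V2 → ℂ}, (∀ t x, x ∉ K → D (t, x) = 0) → ∀ t x, x ∉ K →
      dd dT D (t, x) = 0 := fun {D} hD t x hx => by
    refine dd_eq_zero_of_eventually _ ?_
    filter_upwards [(hK.isOpen_compl.preimage continuous_snd).mem_nhds hx] with p hp
    exact hD p.1 p.2 hp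
  have int : ∀ {W : V2 → ℂ} {D : ℝ × V2 → ℂ}, ContDiff ℝ (⊤ : ℕ∞) W → ContDiff ℝ (⊤ : ℕ∞) D →
      (∀ t x, t ≤ 0 ∨ T ≤ t → D (t, x) = 0) → ∀ x,
      ∫ t in (0 : ℝ)..T, (q W (t, x) - dd dT D (t, x)) = W x := fun {W D} hW hD zD x => by
    rw [intervalIntegral.integral_sub (f := fun t => q W (t, x)) (g := fun t => dd dT D (t, x))
      (((sq hW).continuous.comp (by fun_prop : Continuous fun t : ℝ => (t, x))).intervalIntegrable
        _ _)
      (((hD.dd_top dT).continuous.comp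
        (by fun_prop : Continuous fun t : ℝ => (t, x))).intervalIntegrable _ _), cq,
      timeIntegral_dT hD, zD T x (Or.inr le_rfl), zD 0 x (Or.inl le_rfl)]
    simp
  refine ⟨N, fun p => q W₁ p - dd dT D₁ p, fun p => q W₂ p - dd dT D₂ p,
    (sq hW1).sub (sD1.dd_top dT), (sq hW2).sub (sD2.dd_top dT),
    fun t x m n => congrArg₂ (· - ·) (pq pW1 t x m n) (pD1.dd dT t x m n),
    fun t x m n => congrArg₂ (· - ·) (pq pW2 t x m n) (pD2.dd dT t x m n),
    fun t x ht => ?_, fun t x hx => ?_, fun x => ⟨int hW1 sD1 zD1 x, int hW2 sD2 zD2 x⟩,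
    fun l hl r hr => ?_⟩
  · beta_reduce
    rw [dd_zero_off sD1 zD1 dT t x ht, dd_zero_off sD2 zD2 dT t x ht]
    simp [hq, zη t ht]
  · beta_reduce
    rw [offK kD1 t x hx, offK kD2 t x hx]
    simp [hq, kW1 x hx, kW2 x hx]
  · obtain ⟨b, rfl⟩ : ∃ b, r = sgb b := by
      rcases hr with rfl | rfl
      · exact ⟨true, rfl⟩
      · exact ⟨false, rfl⟩
    rw [J_sub (sq hW1) (sD1.dd_top dT), J_sub (sq hW2) (sD2.dd_top dT),
      J_dT sD1 (fun x => zD1 0 x (Or.inl le_rfl)) (fun x => zD1 T x (Or.inr le_rfl)),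
      J_dT sD2 (fun x => zD2 0 x (Or.inl le_rfl)) (fun x => zD2 T x (Or.inr le_rfl))]
    have he := el_pos (hN0 hl)
    have key : HasSum (fun j => (el l : ℂ) * (momMat c T H (l, b) j * x j))
        (((sgb b * nu c l : ℝ) : ℂ) * Complex.I * ((l.1 : ℂ) * J T D₂ l (sgb b * nu c l) -
          l.2 * J T D₁ l (sgb b * nu c l))) := by
      refine ((((jD2 l (sgb b * nu c l)).mul_left (l.1 : ℂ)).sub
        ((jD1 l (sgb b * nu c l)).mul_left (l.2 : ℂ))).mul_left
          (((sgb b * nu c l : ℝ) : ℂ) * Complex.I)).congr_fun fun j => ?_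
      by_cases hj : N ≤ lw j.1
      · have hk := el_pos (hN0 hj)
        have hs : sgb j.2 * sgb j.2 = 1 := sgb_sq _
        have hs0 : sgb j.2 ≠ 0 := fun h => by simp [h] at hs
        have hsi : (sgb j.2)⁻¹ = sgb j.2 := by rw [inv_eq_iff_eq_inv]; field_simp; linarith
        have hy' : y j = (((sgb j.2 * (2 * π * c * el j.1 * el j.1)⁻¹ : ℝ) : ℂ)) *
            (-Complex.I) * x j := by
          simp only [hy]
          rw [nu_eq, ← Complex.inv_I, div_eq_mul_inv, mul_inv, ← Complex.ofReal_inv, mul_assoc,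
            mul_inv, hsi]
          ring
        have hr : (sgb b * nu c l) * (sgb j.2 * (2 * π * c * el j.1 * el j.1)⁻¹) * dotp j.1 l =
            el l * (sgb b * sgb j.2 * (dotp j.1 l / el j.1 ^ 2)) := by
          rw [nu_eq]
          field_simp
        have hr' := congrArg (fun u : ℝ => (u : ℂ)) hr
        simp only [Complex.ofReal_mul] at hr'
        rw [hy', momMat]
        simp only [Complex.ofReal_mul] at *
        have hd : ((dotp j.1 l : ℝ) : ℂ) = j.1.1 * l.1 + j.1.2 * l.2 := by simp [dotp]
        rw [hd] at hr'
        set Q := J T (fun p => H ((ang j, p.1), p.2)) (l - j.1) (sgb b * nu c l - sgb j.2 * nu c j.1)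
        linear_combination (-hr') * x j * Q + (sgb b : ℂ) * sgb j.2 * Q * x j * nu c l *
          ((2 * π * c * el j.1 * el j.1)⁻¹ : ℝ) * (j.1.1 * l.1 + j.1.2 * l.2) * Complex.I_sq
      · simp [hy, xlow j hj]
    have hR1 : ∑' j, R (l, b) j * x j + x (l, b) = ∑' j, momMat c T H (l, b) j * x j := by
      obtain ⟨B, hB⟩ := hx 0
      have h1 := (norm_tsum_row_le hδ (x := x) (B := B) (fun j => by simpa using hB j) (l, b)).1
      have h2 : HasSum (fun j => if j = (l, b) then x j else 0) (x (l, b)) := by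
        convert hasSum_ite_eq (l, b) (x (l, b)) using 2 with j
        split_ifs with h
        · rw [h]
        · rfl
      refine ((h1.hasSum.add h2).congr_fun fun j => ?_).tsum_eq.symm
      by_cases hj : N ≤ lw j.1
      · simp only [hR]
        rw [if_pos ⟨hl, hj⟩]
        by_cases h : j = (l, b)
        · rw [if_pos h, if_pos h.symm]; ring
        · rw [if_neg h, if_neg (Ne.symm h)]; ring
      · simp [xlow j hj]
    have e1 := key.tsum_eq
    rw [tsum_mul_left, ← hR1, add_comm, ex (l, b)] at e1
    have e2 : z (l, b) * el l = Lam (l, b) := by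
      simp only [hz]
      rw [if_pos hl, div_mul_cancel₀ _ (by exact_mod_cast he.ne')]
    simp only [hLam] at e2
    linear_combination e1 - e2

end Superposition

/-! ### Removal of the low modes and existence of the pulse -/

lemma integral_extend {T τ : ℝ} (hτ : 0 ≤ τ) {g : ℝ → ℂ} (hg : Continuous g)
    (z : ∀ t, T ≤ t → g t = 0) : ∫ t in (0 : ℝ)..T + τ, g t = ∫ t in (0 : ℝ)..T, g t := by
  rw [← intervalIntegral.integral_add_adjacent_intervals (hg.intervalIntegrable 0 T)
    (hg.intervalIntegrable T (T + τ))]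
  have : ∫ t in T..T + τ, g t = 0 := by
    rw [intervalIntegral.integral_congr (g := fun _ => (0 : ℂ)) fun t ht => ?_]
    · simp
    · rw [Set.uIcc_of_le (by linarith)] at ht
      exact z t ht.1
  rw [this, add_zero]

lemma integral_delay {T τ : ℝ} (hτ : 0 ≤ τ) {g : ℝ → ℂ} (hg : Continuous g)
    (z : ∀ t, t ≤ 0 → g t = 0) : ∫ t in (0 : ℝ)..T + τ, g (t - τ) = ∫ t in (0 : ℝ)..T, g t := by
  rw [intervalIntegral.integral_comp_sub_right (fun t => g t), zero_sub, add_sub_cancel_right,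
    ← intervalIntegral.integral_add_adjacent_intervals (hg.intervalIntegrable (-τ) 0)
      (hg.intervalIntegrable 0 T)]
  have : ∫ t in -τ..(0 : ℝ), g t = 0 := by
    rw [intervalIntegral.integral_congr (g := fun _ => (0 : ℂ)) fun t ht => ?_]
    · simp
    · rw [Set.uIcc_of_le (by linarith)] at ht
      exact z t ht.2
  rw [this, zero_add]

/-- Average of a function with its delay by `τ`. -/
def avg (τ : ℝ) (u : ℝ × V2 → ℂ) (p : ℝ × V2) : ℂ := 2⁻¹ * (u p + u (p.1 - τ, p.2))

lemma avg_contDiff (τ : ℝ) {u : ℝ × V2 → ℂ} (hu : ContDiff ℝ (⊤ : ℕ∞) u) :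
    ContDiff ℝ (⊤ : ℕ∞) (avg τ u) :=
  contDiff_const.mul (hu.add (hu.comp ((contDiff_fst.sub contDiff_const).prodMk contDiff_snd)))

lemma avg_per (τ : ℝ) {u : ℝ × V2 → ℂ} (hu : SPer u) : SPer (avg τ u) := fun t x m n => by
  have h1 := hu t x m n
  have h2 := hu (t - τ) x m n
  simp only at h1 h2
  simp only [avg, h1, h2]

lemma avg_zero {T τ : ℝ} (hτ : 0 ≤ τ) {u : ℝ × V2 → ℂ}
    (z : ∀ t x, t ≤ 0 ∨ T ≤ t → u (t, x) = 0) (t : ℝ) (x : V2) (ht : t ≤ 0 ∨ T + τ ≤ t) :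
    avg τ u (t, x) = 0 := by
  have h1 := z t x (ht.imp id fun h => by linarith)
  have h2 := z (t - τ) x (ht.imp (fun h => by linarith) fun h => by linarith)
  simp [avg, h1, h2]

lemma integral_avg {T τ : ℝ} (hτ : 0 ≤ τ) {u : ℝ × V2 → ℂ} (hu : ContDiff ℝ (⊤ : ℕ∞) u)
    (z : ∀ t x, t ≤ 0 ∨ T ≤ t → u (t, x) = 0) (x : V2) :
    ∫ t in (0 : ℝ)..T + τ, avg τ u (t, x) = ∫ t in (0 : ℝ)..T, u (t, x) := by
  have hc : Continuous fun t => u (t, x) := hu.continuous.comp (by fun_prop)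
  simp only [avg]
  rw [intervalIntegral.integral_const_mul, intervalIntegral.integral_add
    (f := fun t => u (t, x)) (g := fun t => u (t - τ, x)) (hc.intervalIntegrable _ _)
      ((hc.comp (continuous_sub_right τ)).intervalIntegrable _ _),
    integral_extend hτ hc fun t ht => z t x (Or.inr ht),
    integral_delay (g := fun t => u (t, x)) hτ hc fun t ht => z t x (Or.inl ht)]
  ring

lemma J_avg {T τ : ℝ} (hτ : 0 ≤ τ) {u : ℝ × V2 → ℂ} (hu : ContDiff ℝ (⊤ : ℕ∞) u)
    (z : ∀ t x, t ≤ 0 ∨ T ≤ t → u (t, x) = 0) (l : ℤ × ℤ) (σ : ℝ) :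
    J (T + τ) (avg τ u) l σ = 2⁻¹ * (1 + ue (-(σ * τ))) * J T u l σ := by
  set g : ℝ → ℂ := fun t => FT (fun x => u (t, x)) l * ue (-(σ * t)) with hg
  have gc : Continuous g := FT_time_continuous hu l σ
  have gz : ∀ t, t ≤ 0 ∨ T ≤ t → g t = 0 := fun t ht => by
    have : (fun x => u (t, x)) = fun _ => 0 := funext fun x => z t x ht
    simp only [hg, this]
    simp [FT]
  have e : ∀ t, FT (fun x => avg τ u (t, x)) l * ue (-(σ * t)) =
      2⁻¹ * (g t + ue (-(σ * τ)) * g (t - τ)) := fun t => by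
    have h1 := FT_add (φ := fun x => u (t, x)) (ψ := fun x => u (t - τ, x))
      (hu.continuous.comp (by fun_prop : Continuous fun x : V2 => (t, x)))
      (hu.continuous.comp (by fun_prop : Continuous fun x : V2 => (t - τ, x))) l
    have h2 : ue (-(σ * t)) = ue (-(σ * τ)) * ue (-(σ * (t - τ))) := by
      rw [← ue_add]; congr 1; ring
    simp only [avg, hg]
    rw [FT_const_mul, h1, h2]
    ring
  rw [J]
  simp only [e]
  rw [intervalIntegral.integral_const_mul, intervalIntegral.integral_add
    (f := g) (g := fun t => ue (-(σ * τ)) * g (t - τ)) (gc.intervalIntegrable _ _)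
      (((gc.comp (continuous_sub_right τ)).const_mul _).intervalIntegrable
      _ _), intervalIntegral.integral_const_mul, integral_extend hτ gc fun t ht => gz t (Or.inr ht),
    integral_delay hτ gc fun t ht => gz t (Or.inl ht)]
  rw [J]
  ring

lemma ue_pi (r : ℝ) (hr : r = 1 ∨ r = -1) : ue (-(r * π)) = -1 := by
  rcases hr with rfl | rfl <;> simp [ue, Complex.exp_neg]

/-- A source of duration `T` with prescribed time integral, carried by `K` and orthogonal to the
free waves with wave vector in `A`. -/
def HasSource (c T : ℝ) (K : Set V2) (W₁ W₂ : V2 → ℂ) (A : Set (ℤ × ℤ)) : Prop :=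
  ∃ w₁ w₂ : ℝ × V2 → ℂ, ContDiff ℝ (⊤ : ℕ∞) w₁ ∧ ContDiff ℝ (⊤ : ℕ∞) w₂ ∧
    SPer w₁ ∧ SPer w₂ ∧ (∀ t x, t ≤ 0 ∨ T ≤ t → w₁ (t, x) = 0 ∧ w₂ (t, x) = 0) ∧
    (∀ t x, x ∉ K → w₁ (t, x) = 0 ∧ w₂ (t, x) = 0) ∧
    (∀ x, ∫ t in (0 : ℝ)..T, w₁ (t, x) = W₁ x ∧ ∫ t in (0 : ℝ)..T, w₂ (t, x) = W₂ x) ∧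
    ∀ l ∈ A, ∀ r : ℝ, r = 1 ∨ r = -1 →
      (l.1 : ℂ) * J T w₂ l (r * nu c l) - l.2 * J T w₁ l (r * nu c l) = 0

lemma HasSource.insert {c T : ℝ} (hc : 0 < c) {K : Set V2} {W₁ W₂ : V2 → ℂ}
    {A : Set (ℤ × ℤ)} (h : HasSource c T K W₁ W₂ A) {k : ℤ × ℤ} (hk : k ≠ 0) :
    HasSource c (T + π / nu c k) K W₁ W₂ (insert k A) := by
  obtain ⟨w₁, w₂, h1, h2, p1, p2, hz, hk', hW, ho⟩ := h
  have hν := nu_pos hc hk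
  have hτ : 0 ≤ π / nu c k := by positivity
  have z1 := fun t x ht => (hz t x ht).1
  have z2 := fun t x ht => (hz t x ht).2
  refine ⟨avg _ w₁, avg _ w₂, avg_contDiff _ h1, avg_contDiff _ h2, avg_per _ p1, avg_per _ p2,
    fun t x ht => ⟨avg_zero hτ z1 t x ht, avg_zero hτ z2 t x ht⟩, fun t x hx => ?_, fun x => ?_,
    fun l hl r hr => ?_⟩
  · simp [avg, hk' _ x hx]
  · rw [integral_avg hτ h1 z1, integral_avg hτ h2 z2]
    exact hW x
  · rw [J_avg hτ h1 z1, J_avg hτ h2 z2]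
    rcases hl with rfl | hl
    · have : r * nu c l * (π / nu c l) = r * π := by field_simp
      rw [this, ue_pi r hr]
      ring
    · linear_combination 2⁻¹ * (1 + ue (-(r * nu c l * (π / nu c k)))) * ho l hl r hr

lemma finite_lw_lt (N : ℝ) : {l : ℤ × ℤ | lw l < N}.Finite := by
  obtain ⟨n, hn⟩ := exists_nat_gt N
  refine ((Set.finite_Icc (-(n : ℤ)) n).prod (Set.finite_Icc (-(n : ℤ)) n)).subset fun l hl => ?_
  have h1 := abs_fst_le_lw l
  have h2 := abs_snd_le_lw l
  have hl : lw l < N := hl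
  have a1 : |(l.1 : ℝ)| ≤ n := by linarith
  have a2 : |(l.2 : ℝ)| ≤ n := by linarith
  rw [abs_le] at a1 a2
  refine ⟨⟨?_, ?_⟩, ?_, ?_⟩
  · exact_mod_cast a1.1
  · exact_mod_cast a1.2
  · exact_mod_cast a2.1
  · exact_mod_cast a2.2

lemma HasSource.low {c T : ℝ} (hc : 0 < c) (hT : 0 < T) {K : Set V2} {W₁ W₂ : V2 → ℂ}
    {A : Set (ℤ × ℤ)} (h : HasSource c T K W₁ W₂ A) (s : Finset (ℤ × ℤ)) (hs : ∀ l ∈ s, l ≠ 0) :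
    ∃ T', 0 < T' ∧ HasSource c T' K W₁ W₂ (A ∪ s) := by
  induction s using Finset.induction_on with
  | empty => exact ⟨T, hT, by simpa using h⟩
  | insert k s _ ih =>
    obtain ⟨T', hT', h'⟩ := ih fun l hl => hs l (Finset.mem_insert_of_mem hl)
    have hk := hs k (Finset.mem_insert_self k s)
    have := nu_pos hc hk
    refine ⟨T' + π / nu c k, by positivity, ?_⟩
    have := h'.insert hc hk
    rwa [Finset.coe_insert, Set.union_insert]

theorem exists_pulse {c : ℝ} (hc : 0 < c) {χ : V2 → ℝ} (hχ : ContDiff ℝ (⊤ : ℕ∞) χ) (pχ : Zper χ)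
    (nχ : ∀ x, 0 ≤ χ x) {L : ℝ}
    (hG : ∀ x e : V2, en e = 1 → ∃ s, 0 ≤ s ∧ s ≤ L ∧ 0 < χ (x + s • e))
    {K : Set V2} (hK : IsClosed K) (kχ : ∀ x, x ∉ K → χ x = 0)
    {W₁ W₂ P₁ P₂ : V2 → ℂ} (hW1 : ContDiff ℝ (⊤ : ℕ∞) W₁) (hW2 : ContDiff ℝ (⊤ : ℕ∞) W₂)
    (pW1 : Zper W₁) (pW2 : Zper W₂) (kW1 : ∀ x, x ∉ K → W₁ x = 0) (kW2 : ∀ x, x ∉ K → W₂ x = 0)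
    (hP1 : ContDiff ℝ (⊤ : ℕ∞) P₁) (hP2 : ContDiff ℝ (⊤ : ℕ∞) P₂) (pP1 : Zper P₁) (pP2 : Zper P₂)
    (hcurl : ∀ x, dd ((1 : ℝ), (0 : ℝ)) P₂ x - dd ((0 : ℝ), (1 : ℝ)) P₁ x = 0)
    (hdiv : ∀ x, dd ((1 : ℝ), (0 : ℝ)) P₁ x + dd ((0 : ℝ), (1 : ℝ)) P₂ x +
      (dd ((1 : ℝ), (0 : ℝ)) W₁ x + dd ((0 : ℝ), (1 : ℝ)) W₂ x) = 0)
    (m1 : FT P₁ 0 + FT W₁ 0 = 0) (m2 : FT P₂ 0 + FT W₂ 0 = 0) :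
    ∃ T, 0 < T ∧ ∃ e₁ e₂ b : ℝ × V2 → ℝ, Adm c K e₁ e₂ b ∧
      (∀ t x, t ≤ 0 ∨ T ≤ t → e₁ (t, x) = 0 ∧ e₂ (t, x) = 0 ∧ b (t, x) = 0) ∧
      ∀ x, ∫ t in (0 : ℝ)..T, e₁ (t, x) = (P₁ x).re ∧
        ∫ t in (0 : ℝ)..T, e₂ (t, x) = (P₂ x).re := by
  obtain ⟨T, hT, H, hH, pH, zH, kH, rH⟩ := exists_window hc hχ pχ nχ hG
  obtain ⟨N, w₁, w₂, h⟩ := exists_source_high hc hT hK hH pH zH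
    (fun α t x hx => kH α t x (kχ x hx)) rH hW1 hW2 pW1 pW2 kW1 kW2
  have hs : HasSource c T K W₁ W₂ {l | N ≤ lw l} := ⟨w₁, w₂, h⟩
  obtain ⟨T', hT', v₁, v₂, h1, h2, p1, p2, hz, hk, hv, ho⟩ := hs.low hc hT
    ((finite_lw_lt N).toFinset.erase 0) fun l hl => Finset.ne_of_mem_erase hl
  refine ⟨T', hT', exists_pulse_of_source hc hT' hK h1 h2 p1 p2 (fun t x ht => (hz t x ht).1)
    (fun t x ht => (hz t x ht).2) (fun t x hx => (hk t x hx).1) (fun t x hx => (hk t x hx).2)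
    (fun l hl r hr => ho l ?_ r hr) (fun x => (hv x).1) (fun x => (hv x).2) hP1 hP2 pP1 pP2
    hcurl hdiv m1 m2⟩
  by_cases hN : N ≤ lw l
  · exact Or.inl hN
  · right
    simp [hl, not_le.1 hN]

/-! ### A nowhere vanishing holomorphic field on the punctured torus -/

lemma hasDerivAt_integral_of_holomorphic {U : Set ℂ} (hU : IsOpen U) {G G' : ℂ → ℝ → ℂ} {a b : ℝ}
    (hG : ∀ z ∈ U, ∀ t, HasDerivAt (fun z => G z t) (G' z t) z) (cG : ∀ z ∈ U, Continuous (G z))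
    (cG' : ContinuousOn (fun p : ℂ × ℝ => G' p.1 p.2) (U ×ˢ Set.univ)) {z : ℂ} (hz : z ∈ U) :
    HasDerivAt (fun z => ∫ t in a..b, G z t) (∫ t in a..b, G' z t) z := by
  obtain ⟨ε, hε, hb⟩ := Metric.nhds_basis_closedBall.mem_iff.1 (hU.mem_nhds hz)
  obtain ⟨C, hC⟩ := ((isCompact_closedBall z ε).prod
    (isCompact_uIcc (a := a) (b := b))).exists_bound_of_continuousOn
    (cG'.mono (Set.prod_mono hb (Set.subset_univ _)))
  have cz : Continuous (G' z) := by
    have : Continuous fun t : ℝ => (z, t) := by fun_prop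
    exact cG'.comp_continuous this fun t => ⟨hz, trivial⟩
  exact (intervalIntegral.hasDerivAt_integral_of_dominated_loc_of_deriv_le
    (s := Metric.ball z ε) (bound := fun _ => C) (Metric.ball_mem_nhds z hε)
    (Filter.eventually_of_mem (hU.mem_nhds hz) fun w hw => (cG w hw).aestronglyMeasurable)
    ((cG z hz).intervalIntegrable _ _) cz.aestronglyMeasurable
    (Filter.Eventually.of_forall fun t ht w hw => hC (w, t)
      ⟨Metric.ball_subset_closedBall hw, Set.uIoc_subset_uIcc ht⟩)
    (intervalIntegrable_const) (Filter.Eventually.of_forall fun t _ w hw =>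
      hG w (hb (Metric.ball_subset_closedBall hw)) t)).2

/-- The square lattice. -/
def sqPair : PeriodPair where
  ω₁ := 1
  ω₂ := Complex.I
  indep := by
    rw [LinearIndependent.pair_iff]
    intro s t h
    have h1 := congrArg Complex.re h
    have h2 := congrArg Complex.im h
    simp at h1 h2
    exact ⟨h1, h2⟩

lemma mem_sqPair {z : ℂ} : z ∈ sqPair.lattice ↔ ∃ m n : ℤ, (m : ℂ) + n * Complex.I = z := by
  rw [PeriodPair.mem_lattice]
  simp [sqPair]

/-- Points of the plane outside of the square lattice. -/
def punct : Set ℂ := (sqPair.lattice : Set ℂ)ᶜ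

lemma punct_open : IsOpen punct := sqPair.isClosed_lattice.isOpen_compl

lemma mem_punct_of_re {z : ℂ} (h : |z.re| = 1 / 2) : z ∈ punct := fun hz => by
  obtain ⟨m, n, rfl⟩ := mem_sqPair.1 hz
  have h : |(m : ℝ)| = 1 / 2 := by simpa using h
  have : ((2 * |m| : ℤ) : ℝ) = (1 : ℤ) := by push_cast; linarith
  have : 2 * |m| = 1 := by exact_mod_cast this
  omega

lemma mem_punct_of_im {z : ℂ} (h : |z.im| = 1 / 2) : z ∈ punct := fun hz => by
  obtain ⟨m, n, rfl⟩ := mem_sqPair.1 hz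
  have h : |(n : ℝ)| = 1 / 2 := by simpa using h
  have : ((2 * |n| : ℤ) : ℝ) = (1 : ℤ) := by push_cast; linarith
  have : 2 * |n| = 1 := by exact_mod_cast this
  omega

/-- The horizontal and vertical half-integer lines. -/
def hline (x : ℝ) : ℂ := x + (1 / 2 : ℝ) * Complex.I

def vline (x : ℝ) : ℂ := (1 / 2 : ℝ) + x * Complex.I

lemma hline_mem (x : ℝ) : hline x ∈ punct := mem_punct_of_im (by simp [hline, abs_of_pos])

lemma vline_mem (x : ℝ) : vline x ∈ punct := mem_punct_of_re (by simp [vline, abs_of_pos])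

lemma hline_continuous : Continuous hline := by unfold hline; fun_prop

lemma vline_continuous : Continuous vline := by unfold vline; fun_prop

lemma weierstrass_periods :
    (∫ x in (-(1 / 2) : ℝ)..1 / 2, sqPair.weierstrassP (vline x)) ≠
      ∫ x in (-(1 / 2) : ℝ)..1 / 2, sqPair.weierstrassP (hline x) := by
  set p : ℝ → ℂ := fun x => sqPair.weierstrassP (hline x) with hp
  set q : ℝ → ℂ := fun x => sqPair.weierstrassP (vline x) with hq
  set k : ℝ → ℝ := fun x => 1 / (x ^ 2 + 1 / 4) with hk
  set E : ℂ → ℂ := sqPair.weierstrassPExcept 0 with hE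
  have dg : ContinuousOn sqPair.weierstrassP punct :=
    sqPair.differentiableOn_weierstrassP.continuousOn
  have cp : Continuous p := dg.comp_continuous hline_continuous hline_mem
  have cq : Continuous q := dg.comp_continuous vline_continuous vline_mem
  have ck : Continuous k := by
    refine continuous_const.div (by fun_prop) fun x => ?_
    positivity
  have eE : ∀ z : ℂ, z ≠ 0 → z * E z = z * sqPair.weierstrassP z - 1 / z := fun z hz => by
    have := sqPair.weierstrassPExcept_add 0 z
    simp only [ZeroMemClass.coe_zero, sub_zero] at this
    rw [← this]
    field_simp
    simp [hE]
  have shift : ∀ z : ℂ, ∀ m n : ℤ, sqPair.weierstrassP (z + (m + n * Complex.I)) =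
      sqPair.weierstrassP z := fun z m n =>
    sqPair.weierstrassP_add_coe z ⟨_, mem_sqPair.2 ⟨m, n, rfl⟩⟩
  have H : DifferentiableOn ℂ (fun z => z * E z)
      (Set.uIcc (-(1 / 2)) (1 / 2) ×ℂ Set.uIcc (-(1 / 2)) (1 / 2)) := by
    refine differentiableOn_id.mul ((sqPair.differentiableOn_weierstrassPExcept 0).mono ?_)
    rintro z ⟨h1, h2⟩ ⟨hz, hz0⟩
    rw [Set.uIcc_of_le (by norm_num)] at h1 h2
    obtain ⟨m, n, rfl⟩ := mem_sqPair.1 hz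
    simp only [Set.mem_preimage, Set.mem_Icc, Complex.add_re, Complex.intCast_re, Complex.mul_re,
      Complex.I_re, mul_zero, Complex.intCast_im, Complex.I_im, mul_one, sub_self, add_zero,
      Complex.add_im, Complex.mul_im, zero_add] at h1 h2
    have hm : m = 0 := by
      have a : (-1 : ℝ) < m := by linarith
      have b : (m : ℝ) < 1 := by linarith
      have a' : -1 < m := by exact_mod_cast a
      have b' : m < 1 := by exact_mod_cast b
      omega
    have hn : n = 0 := by
      have a : (-1 : ℝ) < n := by linarith
      have b : (n : ℝ) < 1 := by linarith
      have a' : -1 < n := by exact_mod_cast a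
      have b' : n < 1 := by exact_mod_cast b
      omega
    simp [hm, hn] at hz0
  have hR := Complex.integral_boundary_rect_eq_zero_of_differentiableOn (fun z => z * E z)
    ⟨-(1 / 2), -(1 / 2)⟩ ⟨1 / 2, 1 / 2⟩ H
  simp only [smul_eq_mul] at hR
  have cE : ∀ {γ : ℝ → ℂ}, Continuous γ → (∀ x, γ x ∈ punct) →
      Continuous fun x => γ x * E (γ x) := fun {γ} hγ h =>
    hγ.mul ((sqPair.differentiableOn_weierstrassPExcept 0).continuousOn.comp_continuous hγ
      fun x hx => h x hx.1)
  have i1 : ∀ x : ℝ, ((x : ℂ) + ((-(1 / 2) : ℝ) : ℂ) * Complex.I) *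
      E (x + ((-(1 / 2) : ℝ) : ℂ) * Complex.I) -
      (x + ((1 / 2 : ℝ) : ℂ) * Complex.I) * E (x + ((1 / 2 : ℝ) : ℂ) * Complex.I) =
      -Complex.I * (p x + k x) := fun x => by
    have hx := shift (x + ((-(1 / 2) : ℝ) : ℂ) * Complex.I) 0 1
    have e : (x : ℂ) + ((-(1 / 2) : ℝ) : ℂ) * Complex.I + ((0 : ℤ) + (1 : ℤ) * Complex.I) =
        hline x := by simp only [hline]; push_cast; ring
    have n1 : (x : ℂ) + ((-(1 / 2) : ℝ) : ℂ) * Complex.I ≠ 0 := fun h => by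
      have := congrArg Complex.im h; simp at this
    have n2 : (x : ℂ) + ((1 / 2 : ℝ) : ℂ) * Complex.I ≠ 0 := fun h => by
      have := congrArg Complex.im h; simp at this
    rw [e] at hx
    rw [eE _ n1, eE _ n2, ← hx]
    have hk' : ((k x : ℝ) : ℂ) = 1 / (((x : ℂ) + ((-(1 / 2) : ℝ) : ℂ) * Complex.I) *
        ((x : ℂ) + ((1 / 2 : ℝ) : ℂ) * Complex.I)) := by
      simp only [hk]
      push_cast
      congr 1
      linear_combination (1 / 4 : ℂ) * Complex.I_sq
    have hI : (1 : ℂ) / ((x : ℂ) + ((-(1 / 2) : ℝ) : ℂ) * Complex.I) -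
        1 / ((x : ℂ) + ((1 / 2 : ℝ) : ℂ) * Complex.I) = Complex.I * k x := by
      rw [hk', div_sub_div _ _ n1 n2, mul_one_div]
      congr 1
      push_cast
      ring
    simp only [hp]
    have e2 : hline x = (x : ℂ) + ((1 / 2 : ℝ) : ℂ) * Complex.I := rfl
    rw [e2]
    push_cast at hI ⊢
    linear_combination -hI
  have i2 : ∀ y : ℝ, (((1 / 2 : ℝ) : ℂ) + y * Complex.I) * E (((1 / 2 : ℝ) : ℂ) + y * Complex.I) -
      (((-(1 / 2) : ℝ) : ℂ) + y * Complex.I) * E (((-(1 / 2) : ℝ) : ℂ) + y * Complex.I) =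
      q y - k y := fun y => by
    have hx := shift (((-(1 / 2) : ℝ) : ℂ) + y * Complex.I) 1 0
    have e : ((-(1 / 2) : ℝ) : ℂ) + y * Complex.I + ((1 : ℤ) + (0 : ℤ) * Complex.I) =
        vline y := by simp only [vline]; push_cast; ring
    have n1 : ((-(1 / 2) : ℝ) : ℂ) + y * Complex.I ≠ 0 := fun h => by
      have := congrArg Complex.re h; simp at this
    have n2 : ((1 / 2 : ℝ) : ℂ) + y * Complex.I ≠ 0 := fun h => by
      have := congrArg Complex.re h; simp at this
    rw [e] at hx
    rw [eE _ n1, eE _ n2, ← hx]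
    have hk' : ((k y : ℝ) : ℂ) = -1 / ((((1 / 2 : ℝ) : ℂ) + y * Complex.I) *
        (((-(1 / 2) : ℝ) : ℂ) + y * Complex.I)) := by
      simp only [hk]
      push_cast
      rw [neg_div, ← div_neg]
      congr 1
      linear_combination (y ^ 2 : ℂ) * Complex.I_sq
    have hI : (1 : ℂ) / (((1 / 2 : ℝ) : ℂ) + y * Complex.I) -
        1 / (((-(1 / 2) : ℝ) : ℂ) + y * Complex.I) = k y := by
      rw [hk', div_sub_div _ _ n2 n1]
      congr 1
      push_cast
      ring
    simp only [hq]
    have e2 : vline y = ((1 / 2 : ℝ) : ℂ) + y * Complex.I := rfl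
    rw [e2]
    push_cast at hI ⊢
    linear_combination -hI
  have kpos : 0 < ∫ x in (-(1 / 2) : ℝ)..1 / 2, k x := by
    refine intervalIntegral.intervalIntegral_pos_of_pos (ck.intervalIntegrable _ _)
      (fun x => ?_) (by norm_num)
    positivity
  have ckc : Continuous fun x => (k x : ℂ) := Complex.continuous_ofReal.comp ck
  have hh : ∀ s : ℝ, |s| = 1 / 2 → IntervalIntegrable (fun x : ℝ => ((x : ℂ) + (s : ℂ) * Complex.I) *
      E (x + (s : ℂ) * Complex.I)) volume (-(1 / 2)) (1 / 2) := fun s hs =>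
    (cE (γ := fun x : ℝ => (x : ℂ) + (s : ℂ) * Complex.I) (by fun_prop) fun x =>
      mem_punct_of_im (by simpa using hs)).intervalIntegrable _ _
  have hv : ∀ s : ℝ, |s| = 1 / 2 → IntervalIntegrable (fun x : ℝ => ((s : ℂ) + x * Complex.I) *
      E ((s : ℂ) + x * Complex.I)) volume (-(1 / 2)) (1 / 2) := fun s hs =>
    (cE (γ := fun x : ℝ => (s : ℂ) + x * Complex.I) (by fun_prop) fun x =>
      mem_punct_of_re (by simpa using hs)).intervalIntegrable _ _
  have ha : |(1 / 2 : ℝ)| = 1 / 2 := abs_of_pos (by norm_num)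
  have hb : |(-(1 / 2) : ℝ)| = 1 / 2 := by rw [abs_neg, ha]
  rw [← intervalIntegral.integral_sub (hh _ hb) (hh _ ha), add_sub_assoc, ← mul_sub,
    ← intervalIntegral.integral_sub (hv _ ha) (hv _ hb)] at hR
  simp only [i1, i2] at hR
  rw [intervalIntegral.integral_const_mul, intervalIntegral.integral_add
    (cp.intervalIntegrable _ _) (ckc.intervalIntegrable _ _), intervalIntegral.integral_sub
    (cq.intervalIntegrable _ _) (ckc.intervalIntegrable _ _),
    intervalIntegral.integral_ofReal] at hR
  intro h
  rw [h] at hR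
  have h2 : Complex.I * ((∫ x in (-(1 / 2) : ℝ)..1 / 2, k x : ℝ) : ℂ) = 0 := by
    linear_combination (-1 / 2) * hR
  rcases mul_eq_zero.1 h2 with h2 | h2
  · exact Complex.I_ne_zero h2
  · exact kpos.ne' (by exact_mod_cast h2)

section Liouville

variable {u : ℝ → ℂ}

lemma hasDerivAt_integral_exp (hu : Continuous u) (a b : ℝ) (ζ : ℂ) :
    HasDerivAt (fun ζ : ℂ => ∫ x in a..b, Complex.exp (ζ * u x))
      (∫ x in a..b, Complex.exp (ζ * u x) * u x) ζ := by
  refine hasDerivAt_integral_of_holomorphic (U := Set.univ) (G := fun ζ x => Complex.exp (ζ * u x))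
    (G' := fun ζ x => Complex.exp (ζ * u x) * u x) isOpen_univ (fun z _ t => ?_)
    (fun z _ => by fun_prop) (Continuous.continuousOn (by fun_prop)) trivial
  simpa using ((hasDerivAt_id z).mul_const (u t)).cexp

lemma exists_orthogonal_periods {v : ℝ → ℂ} (hu : Continuous u) (hv : Continuous v)
    (h : (∫ x in (-(1 / 2) : ℝ)..1 / 2, v x) ≠ ∫ x in (-(1 / 2) : ℝ)..1 / 2, u x) :
    ∃ ζ : ℂ, ((∫ x in (-(1 / 2) : ℝ)..1 / 2, Complex.exp (ζ * u x)) *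
      (starRingEnd ℂ) (∫ x in (-(1 / 2) : ℝ)..1 / 2, Complex.exp (ζ * v x))).re = 0 := by
  set A : ℂ → ℂ := fun ζ => ∫ x in (-(1 / 2) : ℝ)..1 / 2, Complex.exp (ζ * u x) with hA
  set B : ℂ → ℂ := fun ζ => ∫ x in (-(1 / 2) : ℝ)..1 / 2, Complex.exp (ζ * v x) with hB
  have dA := hasDerivAt_integral_exp hu (-(1 / 2)) (1 / 2)
  have dB := hasDerivAt_integral_exp hv (-(1 / 2)) (1 / 2)
  have hA0 : A 0 = 1 := by simp [hA]; norm_num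
  have hB0 : B 0 = 1 := by simp [hB]; norm_num
  have cA : Differentiable ℂ A := fun ζ => (dA ζ).differentiableAt
  have cB : Differentiable ℂ B := fun ζ => (dB ζ).differentiableAt
  by_contra! hn
  change ∀ ζ, (A ζ * (starRingEnd ℂ) (B ζ)).re ≠ 0 at hn
  have hc : Continuous fun ζ => (A ζ * (starRingEnd ℂ) (B ζ)).re :=
    Complex.continuous_re.comp (cA.continuous.mul (Complex.continuous_conj.comp cB.continuous))
  have pos : ∀ ζ, 0 < (A ζ * (starRingEnd ℂ) (B ζ)).re := by
    intro ζ
    by_contra! hneg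
    obtain ⟨ξ, hξ⟩ := mem_range_of_exists_le_of_exists_ge hc ⟨ζ, hneg⟩
      ⟨0, by rw [hA0, hB0]; simp⟩
    exact hn ξ hξ
  have hB1 : ∀ ζ, B ζ ≠ 0 := fun ζ h0 => by simpa [h0] using pos ζ
  have qpos : ∀ ζ, 0 < (A ζ / B ζ).re := fun ζ => by
    have h1 : A ζ / B ζ = ((Complex.normSq (B ζ))⁻¹ : ℝ) * (A ζ * (starRingEnd ℂ) (B ζ)) := by
      rw [div_eq_mul_inv, Complex.inv_def]; ring
    rw [h1, Complex.re_ofReal_mul]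
    have := Complex.normSq_pos.2 (hB1 ζ)
    have := pos ζ
    positivity
  have dQ : ∀ ζ, HasDerivAt (fun ζ => Complex.exp (-(A ζ / B ζ))) _ ζ := fun ζ =>
    (((dA ζ).div (dB ζ) (hB1 ζ)).neg).cexp
  have bd : Bornology.IsBounded (Set.range fun ζ => Complex.exp (-(A ζ / B ζ))) := by
    rw [isBounded_iff_forall_norm_le]
    refine ⟨1, ?_⟩
    rintro _ ⟨ζ, rfl⟩
    rw [Complex.norm_exp, Real.exp_le_one_iff, Complex.neg_re]
    linarith [qpos ζ]
  have hd : Differentiable ℂ fun ζ => Complex.exp (-(A ζ / B ζ)) := fun ζ => (dQ ζ).differentiableAt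
  have hcst : (fun ζ => Complex.exp (-(A ζ / B ζ))) = fun _ => Complex.exp (-(A 0 / B 0)) :=
    funext fun ζ => hd.apply_eq_apply_of_bounded bd ζ 0
  have dA0 : HasDerivAt A (∫ x in (-(1 / 2) : ℝ)..1 / 2, u x) 0 := by
    simpa only [zero_mul, Complex.exp_zero, one_mul] using dA 0
  have dB0 : HasDerivAt B (∫ x in (-(1 / 2) : ℝ)..1 / 2, v x) 0 := by
    simpa only [zero_mul, Complex.exp_zero, one_mul] using dB 0
  have h0 : HasDerivAt (fun ζ => Complex.exp (-(A ζ / B ζ))) _ 0 :=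
    ((dA0.div dB0 (hB1 0)).neg).cexp
  rw [hcst] at h0
  have h1 := h0.unique (hasDerivAt_const _ _)
  rw [hA0, hB0] at h1
  have h2 := (mul_eq_zero.1 h1).resolve_left (Complex.exp_ne_zero _)
  apply h
  linear_combination h2

end Liouville

theorem exists_holomorphic_field : ∃ F : ℂ → ℂ, DifferentiableOn ℂ F punct ∧
    (∀ z, ∀ m n : ℤ, F (z + (m + n * Complex.I)) = F z) ∧ (∀ z, F (-z) = F z) ∧ (∀ z, F z ≠ 0) ∧
    (∫ x in (-(1 / 2) : ℝ)..1 / 2, F (hline x)).im = 0 ∧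
    (∫ x in (-(1 / 2) : ℝ)..1 / 2, F (vline x)).re = 0 := by
  have dg : DifferentiableOn ℂ sqPair.weierstrassP punct := sqPair.differentiableOn_weierstrassP
  obtain ⟨ζ, hζ⟩ := exists_orthogonal_periods
    (dg.continuousOn.comp_continuous hline_continuous hline_mem)
    (dg.continuousOn.comp_continuous vline_continuous vline_mem) weierstrass_periods
  set A := ∫ x in (-(1 / 2) : ℝ)..1 / 2, Complex.exp (ζ * sqPair.weierstrassP (hline x)) with hA
  set B := ∫ x in (-(1 / 2) : ℝ)..1 / 2, Complex.exp (ζ * sqPair.weierstrassP (vline x)) with hB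
  obtain ⟨κ, hκ, h1, h2⟩ : ∃ κ : ℂ, κ ≠ 0 ∧ (κ * A).im = 0 ∧ (κ * B).re = 0 := by
    by_cases hA0 : A = 0
    · by_cases hB0 : B = 0
      · exact ⟨1, one_ne_zero, by simp [hA0], by simp [hB0]⟩
      · refine ⟨Complex.I * (starRingEnd ℂ) B, by simpa using hB0, by simp [hA0], ?_⟩
        simp; ring
    · refine ⟨(starRingEnd ℂ) A, by simpa using hA0, ?_, ?_⟩
      · simp; ring
      · simp at hζ ⊢; linarith
  refine ⟨fun z => κ * Complex.exp (ζ * sqPair.weierstrassP z), (dg.const_mul ζ).cexp.const_mul κ,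
    fun z m n => ?_, fun z => ?_, fun z => mul_ne_zero hκ (Complex.exp_ne_zero _), ?_, ?_⟩
  · have := sqPair.weierstrassP_add_coe z ⟨_, mem_sqPair.2 ⟨m, n, rfl⟩⟩
    simp only at this
    simp only [this]
  · simp only [sqPair.weierstrassP_neg]
  · rw [intervalIntegral.integral_const_mul]; exact h1
  · rw [intervalIntegral.integral_const_mul]; exact h2

/-! ### A primitive near the punctures -/

lemma mem_punct_of_norm {z : ℂ} (h0 : z ≠ 0) (h : ‖z‖ < 1) : z ∈ punct := fun hz => by
  obtain ⟨m, n, rfl⟩ := mem_sqPair.1 hz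
  have h1 := (Complex.abs_re_le_norm _).trans_lt h
  have h2 := (Complex.abs_im_le_norm _).trans_lt h
  simp only [Complex.add_re, Complex.intCast_re, Complex.mul_re,
      Complex.I_re, mul_zero, Complex.intCast_im, Complex.I_im, mul_one, sub_self, add_zero,
      Complex.add_im, Complex.mul_im, zero_add] at h1 h2
  have a : |m| < 1 := by exact_mod_cast h1
  have b : |n| < 1 := by exact_mod_cast h2
  rw [Int.abs_lt_one_iff] at a b
  simp [a, b] at h0

lemma exists_primitive_punctured_disc {F : ℂ → ℂ} (hF : DifferentiableOn ℂ F punct)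
    (ev : ∀ z, F (-z) = F z) :
    ∃ Ξ : ℂ → ℂ, ∀ z, z ≠ 0 → ‖z‖ < 1 → HasDerivAt Ξ (F z) z := by
  set U : Set ℂ := {z | z ≠ 0 ∧ ‖z‖ < 1} with hU
  have oU : IsOpen U := (isOpen_ne).inter (isOpen_lt continuous_norm continuous_const)
  have sU : U ⊆ punct := fun z hz => mem_punct_of_norm hz.1 hz.2
  have dF : ∀ z ∈ U, HasDerivAt F (deriv F z) z := fun z hz =>
    (hF.differentiableAt (punct_open.mem_nhds (sU hz))).hasDerivAt
  set w : ℝ → ℂ := fun t => Complex.exp (t * Complex.I) with hw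
  have cw : Continuous w := by rw [hw]; fun_prop
  have nw : ∀ t, ‖w t‖ = 1 := fun t => Complex.norm_exp_ofReal_mul_I t
  have mw : ∀ z ∈ U, ∀ t, z * w t ∈ U := fun z hz t =>
    ⟨mul_ne_zero hz.1 (Complex.exp_ne_zero _), by rw [norm_mul, nw, mul_one]; exact hz.2⟩
  have cF : ContinuousOn F U := fun z hz => (dF z hz).continuousAt.continuousWithinAt
  have cF' : ContinuousOn (deriv F) U := ((hF.deriv punct_open).mono sU).continuousOn
  have cm : Continuous fun p : ℂ × ℝ => p.1 * w p.2 := by fun_prop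
  have mm : Set.MapsTo (fun p : ℂ × ℝ => p.1 * w p.2) (U ×ˢ Set.univ) U := fun p hp =>
    mw p.1 hp.1 p.2
  have c1 : ContinuousOn (fun p : ℂ × ℝ => F (p.1 * w p.2)) (U ×ˢ Set.univ) :=
    cF.comp cm.continuousOn mm
  have c2 : ContinuousOn (fun p : ℂ × ℝ => deriv F (p.1 * w p.2)) (U ×ˢ Set.univ) :=
    cF'.comp cm.continuousOn mm
  refine ⟨fun z => (1 / 2) * ∫ t in (-π)..0, F (z * w t) * (Complex.I * (z * w t)),
    fun z h0 h1 => ?_⟩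
  have hz : z ∈ U := ⟨h0, h1⟩
  have cc : ContinuousOn (fun p : ℂ × ℝ => deriv F (p.1 * w p.2) * w p.2 *
      (Complex.I * (p.1 * w p.2)) + F (p.1 * w p.2) * (Complex.I * w p.2)) (U ×ˢ Set.univ) :=
    ((c2.mul (by fun_prop)).mul (by fun_prop)).add (c1.mul (by fun_prop))
  have key := hasDerivAt_integral_of_holomorphic (a := -π) (b := 0) oU
    (G := fun z t => F (z * w t) * (Complex.I * (z * w t)))
    (G' := fun z t => deriv F (z * w t) * w t * (Complex.I * (z * w t)) +
      F (z * w t) * (Complex.I * w t))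
    (fun z hz t => by
      have e : HasDerivAt (fun z => z * w t) (w t) z := by
        simpa using (hasDerivAt_id z).mul_const (w t)
      exact ((dF _ (mw z hz t)).comp z e).mul (e.const_mul Complex.I))
    (fun z hz => by
      have : Continuous fun t => F (z * w t) :=
        cF.comp_continuous (by fun_prop) (mw z hz)
      exact this.mul (by fun_prop))
    cc hz
  have fin : (∫ t in (-π)..0, (deriv F (z * w t) * w t * (Complex.I * (z * w t)) +
      F (z * w t) * (Complex.I * w t))) = F (z * w 0) * w 0 - F (z * w (-π)) * w (-π) := by
    refine intervalIntegral.integral_eq_sub_of_hasDerivAt (f := fun t => F (z * w t) * w t)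
      (fun t _ => ?_) ?_
    · have e1 : HasDerivAt w (w t * Complex.I) t := by
        have : HasDerivAt (fun t : ℝ => (t : ℂ) * Complex.I) (1 * Complex.I) t :=
          (Complex.ofRealCLM.hasDerivAt (x := t)).mul_const Complex.I
        simpa using this.cexp
      have e2 : HasDerivAt (fun t => z * w t) (z * (w t * Complex.I)) t := e1.const_mul z
      have e3 := ((dF _ (mw z hz t)).comp t e2).mul e1
      refine e3.congr_deriv ?_
      simp only [Function.comp]
      ring
    · have : Continuous fun t : ℝ => (z, t) := by fun_prop
      exact (cc.comp_continuous this fun t => ⟨hz, trivial⟩).intervalIntegrable _ _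
  rw [fin] at key
  have w0 : w 0 = 1 := by simp [hw]
  have w1 : w (-π) = -1 := by simp [hw, Complex.exp_neg, Complex.exp_pi_mul_I]
  rw [w0, w1] at key
  refine (key.const_mul (1 / 2 : ℂ)).congr_deriv ?_
  rw [show z * (-1 : ℂ) = -z by ring, ev]
  simp only [mul_one]
  ring

lemma round_eq_of_abs_lt {x : ℝ} {m : ℤ} (h : |x - m| < 1 / 2) : round x = m := by
  have h1 := abs_sub_round x
  have : |((round x - m : ℤ) : ℝ)| < 1 := by
    push_cast
    rw [abs_lt] at h ⊢
    rw [abs_le] at h1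
    constructor <;> linarith [h.1, h.2, h1.1, h1.2]
  have h2 : |round x - m| < 1 := by exact_mod_cast this
  rw [Int.abs_lt_one_iff] at h2
  omega

/-- The primitive is periodic and defined near all the punctures. -/
lemma exists_periodic_primitive {F : ℂ → ℂ} (hF : DifferentiableOn ℂ F punct)
    (per : ∀ z, ∀ m n : ℤ, F (z + (m + n * Complex.I)) = F z) (ev : ∀ z, F (-z) = F z) :
    ∃ Ξ : ℂ → ℂ, (∀ z, ∀ m n : ℤ, Ξ (z + (m + n * Complex.I)) = Ξ z) ∧
      ∀ z, ∀ m n : ℤ, z ∈ punct → ‖z - (m + n * Complex.I)‖ < 1 / 2 →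
        HasDerivAt Ξ (F z) z := by
  obtain ⟨Ξ, h⟩ := exists_primitive_punctured_disc hF ev
  refine ⟨fun z => Ξ (z - (round z.re + round z.im * Complex.I)), fun z m n => ?_,
    fun z m n hz hn => ?_⟩
  · have e1 : (z + (m + n * Complex.I)).re = z.re + m := by simp
    have e2 : (z + (m + n * Complex.I)).im = z.im + n := by simp
    beta_reduce
    rw [e1, e2, round_add_intCast, round_add_intCast]
    congr 1
    push_cast
    ring
  · have h0 : z - (m + n * Complex.I) ≠ 0 := fun h0 =>
      hz (mem_sqPair.2 ⟨m, n, (sub_eq_zero.1 h0).symm⟩)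
    have h1 := h _ h0 (by linarith)
    have h2 : HasDerivAt (fun z => Ξ (z - (m + n * Complex.I))) (F z) z := by
      have := h1.comp_sub_const z (m + n * Complex.I)
      have e : F (z - (m + n * Complex.I)) = F z := by
        rw [← per (z - (m + n * Complex.I)) m n]
        congr 1
        ring
      rwa [e] at this
    refine h2.congr_of_eventuallyEq ?_
    have op : IsOpen {z : ℂ | ‖z - (m + n * Complex.I)‖ < 1 / 2} :=
      isOpen_lt (by fun_prop) continuous_const
    filter_upwards [op.mem_nhds hn] with u hu
    have a := (Complex.abs_re_le_norm _).trans_lt hu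
    have b := (Complex.abs_im_le_norm _).trans_lt hu
    simp only [Complex.sub_re, Complex.sub_im, Complex.add_re, Complex.intCast_re, Complex.mul_re,
      Complex.I_re, mul_zero, Complex.intCast_im, Complex.I_im, mul_one, sub_self, add_zero,
      Complex.add_im, Complex.mul_im, zero_add] at a b
    rw [round_eq_of_abs_lt a, round_eq_of_abs_lt b]

/-! ### Fields with local potentials -/

lemma dd_comm_at {u : V2 → ℝ} {p : V2} (hu : ContDiffAt ℝ (⊤ : ℕ∞) u p) (w w' : V2) :
    dd w (dd w' u) p = dd w' (dd w u) p := by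
  have hs : IsSymmSndFDerivAt ℝ u p :=
    hu.isSymmSndFDerivAt (by
      simp only [minSmoothness_of_isRCLikeNormedField]
      exact WithTop.coe_le_coe.2 le_top)
  have hd : DifferentiableAt ℝ (fderiv ℝ u) p :=
    (hu.fderiv_right (m := (⊤ : ℕ∞)) (by simp)).differentiableAt (by simp)
  have key : ∀ a b : V2, dd a (dd b u) p = fderiv ℝ (fderiv ℝ u) p a b := by
    intro a b
    have : HasFDerivAt (dd b u) ((fderiv ℝ (fderiv ℝ u) p).flip b) p := by
      have := hd.hasFDerivAt.clm_apply (hasFDerivAt_const b p)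
      change HasFDerivAt (fun y => fderiv ℝ u y b) _ p
      simpa using this
    simp only [dd] at this ⊢
    rw [this.fderiv]; rfl
  rw [key, key, hs.eq]

/-- A field which is locally a smooth gradient is smooth and curl-free. -/
lemma local_gradient {p q : V2 → ℝ}
    (h : ∀ x, ∃ φ : V2 → ℝ, ContDiffAt ℝ (⊤ : ℕ∞) φ x ∧
      ∀ᶠ z in nhds x, p z = dd (1, 0) φ z ∧ q z = dd (0, 1) φ z) :
    ContDiff ℝ (⊤ : ℕ∞) p ∧ ContDiff ℝ (⊤ : ℕ∞) q ∧ ∀ x, dd (1, 0) q x = dd (0, 1) p x := by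
  have sm : ∀ {φ : V2 → ℝ} {x : V2} (w : V2), ContDiffAt ℝ (⊤ : ℕ∞) φ x →
      ContDiffAt ℝ (⊤ : ℕ∞) (dd w φ) x := fun {φ x} w hφ =>
    (hφ.fderiv_right (m := (⊤ : ℕ∞)) (by simp)).clm_apply contDiffAt_const
  refine ⟨contDiff_iff_contDiffAt.2 fun x => ?_, contDiff_iff_contDiffAt.2 fun x => ?_,
    fun x => ?_⟩
  · obtain ⟨φ, hφ, hn⟩ := h x
    exact (sm (1, 0) hφ).congr_of_eventuallyEq (hn.mono fun z hz => hz.1)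
  · obtain ⟨φ, hφ, hn⟩ := h x
    exact (sm (0, 1) hφ).congr_of_eventuallyEq (hn.mono fun z hz => hz.2)
  · obtain ⟨φ, hφ, hn⟩ := h x
    have e1 : p =ᶠ[nhds x] dd (1, 0) φ := hn.mono fun z hz => hz.1
    have e2 : q =ᶠ[nhds x] dd (0, 1) φ := hn.mono fun z hz => hz.2
    have := dd_comm_at hφ (1, 0) (0, 1)
    rw [dd, e2.fderiv_eq, dd, e1.fderiv_eq]
    exact this

/-- The mean of a divergence-free field is its flux through any section. -/
lemma integral_eq_flux {u v : V2 → ℝ} (hu : ContDiff ℝ (⊤ : ℕ∞) u) (hv : ContDiff ℝ (⊤ : ℕ∞) v)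
    (pu : Zper u) (pv : Zper v) (h : ∀ x, dd (1, 0) u x + dd (0, 1) v x = 0) :
    (∀ a, ∫ x in unitSq, u x = ∫ t in (0 : ℝ)..1, u (a, t)) ∧
      ∀ b, ∫ x in unitSq, v x = ∫ t in (0 : ℝ)..1, v (t, b) := by
  have key : ∀ a₁ b₁ a₂ b₂ : ℝ, (((∫ x in a₁..b₁, v (x, b₂)) - ∫ x in a₁..b₁, v (x, a₂)) +
      ∫ y in a₂..b₂, u (b₁, y)) - ∫ y in a₂..b₂, u (a₁, y) = 0 := fun a₁ b₁ a₂ b₂ => by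
    have h0 : (fun x : ℝ × ℝ => fderiv ℝ u x (1, 0) + fderiv ℝ v x (0, 1)) = fun _ => 0 :=
      funext h
    have := integral2_divergence_prod_of_hasFDerivAt u v (fderiv ℝ u) (fderiv ℝ v) a₁ a₂ b₁ b₂
      hu.continuous.continuousOn hv.continuous.continuousOn
      (fun x _ => (hu.differentiable_top x).hasFDerivAt)
      (fun x _ => (hv.differentiable_top x).hasFDerivAt) (by rw [h0]; exact integrableOn_zero)
    rw [← this]
    have h1 : ∀ x y : ℝ, fderiv ℝ u (x, y) (1, 0) + fderiv ℝ v (x, y) (0, 1) = 0 :=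
      fun x y => h (x, y)
    simp only [h1, intervalIntegral.integral_zero]
  constructor
  · intro a
    have e : ∀ t, ∫ s in (0 : ℝ)..1, u (t, s) = ∫ s in (0 : ℝ)..1, u (a, s) := fun t => by
      have h1 := key a t 0 1
      have h2 : ∀ x : ℝ, v (x, 1) = v (x, 0) := fun x => by simpa using pv (x, 0) 0 1
      simp only [h2] at h1
      linarith
    rw [integral_unitSq_eq hu.continuous]
    simp only [e]
    simp
  · intro b
    have e : ∀ t, ∫ s in (0 : ℝ)..1, v (s, t) = ∫ s in (0 : ℝ)..1, v (s, b) := fun t => by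
      have h1 := key 0 1 b t
      have h2 : ∀ x : ℝ, u (1, x) = u (0, x) := fun x => by simpa using pu (0, x) 1 0
      simp only [h2] at h1
      linarith
    rw [integral_unitSq_eq hv.continuous, intervalIntegral_intervalIntegral_swap
      (F := fun a b => v (a, b)) ((hv.continuous.continuousOn.integrableOn_compact
        (isCompact_uIcc.prod isCompact_uIcc)).mono_set
          (Set.prod_mono Set.uIoc_subset_uIcc Set.uIoc_subset_uIcc))]
    simp only [e]
    simp

/-- The complex coordinate centered at `y`. -/
def zc (y x : V2) : ℂ := (x.1 - y.1 : ℝ) + (x.2 - y.2 : ℝ) * Complex.I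

lemma zc_hasFDerivAt (y x : V2) : HasFDerivAt (zc y)
    (Complex.ofRealCLM.comp (ContinuousLinearMap.fst ℝ ℝ ℝ) +
      (Complex.ofRealCLM.comp (ContinuousLinearMap.snd ℝ ℝ ℝ)).smulRight Complex.I) x := by
  have h1 : HasFDerivAt (fun x : V2 => ((x.1 - y.1 : ℝ) : ℂ))
      (Complex.ofRealCLM.comp (ContinuousLinearMap.fst ℝ ℝ ℝ)) x :=
    Complex.ofRealCLM.hasFDerivAt.comp x (hasFDerivAt_fst.sub_const y.1)
  have h2 : HasFDerivAt (fun x : V2 => ((x.2 - y.2 : ℝ) : ℂ))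
      (Complex.ofRealCLM.comp (ContinuousLinearMap.snd ℝ ℝ ℝ)) x :=
    Complex.ofRealCLM.hasFDerivAt.comp x (hasFDerivAt_snd.sub_const y.2)
  exact h1.add (h2.mul_const' Complex.I)

lemma zc_contDiff (y : V2) : ContDiff ℝ (⊤ : ℕ∞) (zc y) := by
  have h : ∀ f : V2 → ℝ, ContDiff ℝ (⊤ : ℕ∞) f → ContDiff ℝ (⊤ : ℕ∞) fun x => (f x : ℂ) :=
    fun f hf => Complex.ofRealCLM.contDiff.comp hf
  exact (h _ (by fun_prop)).add ((h _ (by fun_prop)).mul contDiff_const)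

/-- Cauchy-Riemann: partial derivatives of a cut off complex potential. -/
lemma dd_cutoff_potential {y x : V2} {ξ : V2 → ℝ} (hξ : Differentiable ℝ ξ) {Ξ : ℂ → ℂ} {w : ℂ}
    (h : HasDerivAt Ξ w (zc y x)) :
    dd (1, 0) (fun x => (1 - ξ x) * (Ξ (zc y x)).re) x =
        (1 - ξ x) * w.re - (Ξ (zc y x)).re * dd (1, 0) ξ x ∧
      dd (0, 1) (fun x => (1 - ξ x) * (Ξ (zc y x)).re) x =
        -(1 - ξ x) * w.im - (Ξ (zc y x)).re * dd (0, 1) ξ x ∧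
      dd (1, 0) (fun x => (1 - ξ x) * (Ξ (zc y x)).im) x =
        (1 - ξ x) * w.im - (Ξ (zc y x)).im * dd (1, 0) ξ x ∧
      dd (0, 1) (fun x => (1 - ξ x) * (Ξ (zc y x)).im) x =
        (1 - ξ x) * w.re - (Ξ (zc y x)).im * dd (0, 1) ξ x := by
  have h1 := (h.hasFDerivAt.restrictScalars ℝ).comp x (zc_hasFDerivAt y x)
  have hr := (Complex.reCLM.hasFDerivAt (x := Ξ (zc y x))).comp x h1
  have hi := (Complex.imCLM.hasFDerivAt (x := Ξ (zc y x))).comp x h1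
  have h2 := (hξ x).hasFDerivAt.const_sub 1
  have a : HasFDerivAt (fun x => (1 - ξ x) * (Ξ (zc y x)).re) _ x := h2.mul hr
  have b : HasFDerivAt (fun x => (1 - ξ x) * (Ξ (zc y x)).im) _ x := h2.mul hi
  simp only [dd]
  rw [a.fderiv, b.fderiv]
  refine ⟨?_, ?_, ?_, ?_⟩ <;> simp <;> ring

lemma contDiffAt_cutoff_potential {y x : V2} {ξ : V2 → ℝ} (hξ : ContDiff ℝ (⊤ : ℕ∞) ξ) {Ξ : ℂ → ℂ}
    (h : ∀ᶠ z in nhds (zc y x), DifferentiableAt ℂ Ξ z) :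
    ContDiffAt ℝ (⊤ : ℕ∞) (fun x => (1 - ξ x) * (Ξ (zc y x)).re) x ∧
      ContDiffAt ℝ (⊤ : ℕ∞) (fun x => (1 - ξ x) * (Ξ (zc y x)).im) x := by
  have h1 : ContDiffAt ℂ (⊤ : ℕ∞) Ξ (zc y x) :=
    (Complex.analyticAt_iff_eventually_differentiableAt.2 h).contDiffAt
  have h2 : ContDiffAt ℝ (⊤ : ℕ∞) (fun x => Ξ (zc y x)) x :=
    (h1.restrict_scalars ℝ).comp x (zc_contDiff y).contDiffAt
  have h3 : ContDiffAt ℝ (⊤ : ℕ∞) (fun x => 1 - ξ x) x := (contDiff_const.sub hξ).contDiffAt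
  exact ⟨h3.mul (Complex.reCLM.contDiff.contDiffAt.comp x h2),
    h3.mul (Complex.imCLM.contDiff.contDiffAt.comp x h2)⟩

/-! ### The static field -/

lemma zc_sub (y x : V2) (m n : ℤ) : zc y x - (m + n * Complex.I) =
    (x.1 - y.1 - m : ℝ) + (x.2 - y.2 - n : ℝ) * Complex.I := by
  simp only [zc]
  push_cast
  ring

lemma zc_per (y x : V2) (m n : ℤ) :
    zc y (x.1 + m, x.2 + n) = zc y x + (m + n * Complex.I) := by
  simp only [zc]
  push_cast
  ring

lemma exists_puncture_cutoff (y : V2) {ρ : ℝ} (hρ : 0 < ρ) :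
    ∃ ξ : V2 → ℝ, ContDiff ℝ (⊤ : ℕ∞) ξ ∧ Zper ξ ∧ (∀ x, 0 ≤ ξ x) ∧
      (∀ x, zc y x ∉ punct → ∀ᶠ z in nhds x, ξ z = 1) ∧
      ∀ x, (∃ m n : ℤ, ‖zc y x - (m + n * Complex.I)‖ < 1 / 2 ∧
        dist x (y.1 + m, y.2 + n) < ρ) ∨ ∀ᶠ z in nhds x, ξ z = 0 := by
  set δ : ℝ := min (ρ ^ 2) (1 / 4) with hδ
  have δ0 : 0 < δ := lt_min (by positivity) (by norm_num)
  have δ1 : δ ≤ ρ ^ 2 := min_le_left _ _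
  have δ2 : δ ≤ 1 / 4 := min_le_right _ _
  set s : V2 → ℝ := fun x => sin (π * (x.1 - y.1)) ^ 2 + sin (π * (x.2 - y.2)) ^ 2 with hs
  have cs : ContDiff ℝ (⊤ : ℕ∞) s := by rw [hs]; fun_prop
  have ps : Zper s := fun x m n => by
    simp only [hs]
    rw [show x.1 + (m : ℝ) - y.1 = x.1 - y.1 + m by ring,
      show x.2 + (n : ℝ) - y.2 = x.2 - y.2 + n by ring, sin_sq_per, sin_sq_per]
  refine ⟨fun x => Real.smoothTransition (2 - s x / δ),
    Real.smoothTransition.contDiff.comp (contDiff_const.sub (cs.div_const δ)),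
    fun x m n => by simp only [ps x m n], fun x => Real.smoothTransition.nonneg _,
    fun x hx => ?_, fun x => ?_⟩
  · have h0 : s x < δ := by
      obtain ⟨m, n, h⟩ := mem_sqPair.1 (not_not.1 hx)
      have e := zc_sub y x m n
      rw [h, sub_self] at e
      have e1 := congrArg Complex.re e
      have e2 := congrArg Complex.im e
      simp only [Complex.zero_re, Complex.zero_im, Complex.add_re, Complex.add_im, Complex.mul_re,
        Complex.mul_im, Complex.ofReal_re, Complex.ofReal_im, Complex.I_re, Complex.I_im, mul_zero,
        mul_one, sub_zero, add_zero, zero_add] at e1 e2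
      have : s x = 0 := by
        simp only [hs]
        rw [show x.1 - y.1 = 0 + (m : ℝ) by linarith, show x.2 - y.2 = 0 + (n : ℝ) by linarith,
          sin_sq_per, sin_sq_per]
        simp
      rw [this]; exact δ0
    filter_upwards [(isOpen_lt cs.continuous continuous_const).mem_nhds h0] with z hz
    refine Real.smoothTransition.one_of_one_le ?_
    have : s z / δ ≤ 1 := (div_le_one δ0).2 (le_of_lt hz)
    linarith
  · by_cases h0 : 2 * δ < s x
    · right
      filter_upwards [(isOpen_lt continuous_const cs.continuous).mem_nhds h0] with z hz
      refine Real.smoothTransition.zero_of_nonpos ?_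
      have : 2 ≤ s z / δ := (le_div_iff₀ δ0).2 (le_of_lt hz)
      linarith
    · left
      have h1 : s x ≤ 2 * δ := not_lt.1 h0
      have a := abs_sub_round_le_sin (x.1 - y.1)
      have b := abs_sub_round_le_sin (x.2 - y.2)
      set u : ℝ := x.1 - y.1 - round (x.1 - y.1) with hu
      set v : ℝ := x.2 - y.2 - round (x.2 - y.2) with hv
      have key : ∀ t w : ℝ, 2 * |t| ≤ |w| → 4 * t ^ 2 ≤ w ^ 2 := fun t w h => by
        rw [← sq_abs t, ← sq_abs w]
        nlinarith [abs_nonneg t, abs_nonneg w]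
      have hsum : 4 * (u ^ 2 + v ^ 2) ≤ 2 * δ := by
        have := key _ _ a
        have := key _ _ b
        simp only [hs] at h1
        linarith
      refine ⟨round (x.1 - y.1), round (x.2 - y.2), ?_, ?_⟩
      · rw [zc_sub, ← hu, ← hv, Complex.norm_add_mul_I, Real.sqrt_lt' (by norm_num)]
        linarith
      · rw [Prod.dist_eq, Real.dist_eq, Real.dist_eq, max_lt_iff, ← sub_sub, ← sub_sub]
        exact ⟨abs_lt_of_sq_lt_sq (by nlinarith [sq_nonneg v]) hρ.le,
          abs_lt_of_sq_lt_sq (by nlinarith [sq_nonneg u]) hρ.le⟩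

lemma intervalIntegral_shift_periodic {f : ℝ → ℂ} (hf : Function.Periodic f 1) (a : ℝ) :
    ∫ t in (0 : ℝ)..1, f (t - a) = ∫ t in (-(1 / 2) : ℝ)..1 / 2, f t := by
  rw [intervalIntegral.integral_comp_sub_right (fun t => f t)]
  have := hf.intervalIntegral_add_eq (0 - a) (-(1 / 2))
  rw [show 0 - a + 1 = 1 - a by ring, show (-(1 / 2) : ℝ) + 1 = 1 / 2 by norm_num] at this
  exact this

lemma zc_vline (y : V2) (t : ℝ) : zc y (y.1 + 1 / 2, t) = vline (t - y.2) := by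
  simp only [zc, vline]
  congr 2
  ring

lemma zc_hline (y : V2) (t : ℝ) : zc y (t, y.2 + 1 / 2) = hline (t - y.1) := by
  simp only [zc, hline]
  congr 3
  ring

lemma exists_static (y : V2) {ρ : ℝ} (hρ : 0 < ρ) (hρ' : ρ ≤ 1 / 2) :
    ∃ p q u v : V2 → ℝ, ContDiff ℝ (⊤ : ℕ∞) p ∧ ContDiff ℝ (⊤ : ℕ∞) q ∧
      ContDiff ℝ (⊤ : ℕ∞) u ∧ ContDiff ℝ (⊤ : ℕ∞) v ∧ Zper p ∧ Zper q ∧ Zper u ∧ Zper v ∧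
      (∀ x, dd (1, 0) q x = dd (0, 1) p x) ∧ (∀ x, dd (1, 0) u x + dd (0, 1) v x = 0) ∧
      (∫ x in unitSq, u x = 0) ∧ (∫ x in unitSq, v x = 0) ∧
      (∀ x, (∀ m n : ℤ, ρ ≤ dist x (y.1 + m, y.2 + n)) → u x = p x ∧ v x = q x) ∧
      ∃ p₀, 0 < p₀ ∧ ∀ x, (∀ m n : ℤ, ρ ≤ dist x (y.1 + m, y.2 + n)) → p₀ ≤ ‖(p x, q x)‖ := by
  obtain ⟨F, hF, perF, evF, F0, Fh, Fv⟩ := exists_holomorphic_field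
  obtain ⟨Ξ, perΞ, hΞ⟩ := exists_periodic_primitive hF perF evF
  obtain ⟨ξ, sξ, pξ, nξ, ξ1, ξ0⟩ := exists_puncture_cutoff y hρ
  have dξ := sξ.differentiable_top
  have pdξ : ∀ w, Zper (dd w ξ) := fun w => Zper.dd pξ w
  have off : ∀ x, (∀ m n : ℤ, ρ ≤ dist x (y.1 + m, y.2 + n)) → ∀ᶠ z in nhds x, ξ z = 0 :=
    fun x hx => (ξ0 x).resolve_left fun ⟨m, n, _, h⟩ => absurd h (not_lt.2 (hx m n))
  have dz : ∀ (w x : V2), ξ x = 0 → dd w ξ x = 0 := fun w x h => by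
    have : IsLocalMin ξ x := Filter.Eventually.of_forall fun z => by rw [h]; exact nξ z
    simp [dd, this.fderiv_eq_zero]
  set p : V2 → ℝ := fun x => (1 - ξ x) * (F (zc y x)).re - (Ξ (zc y x)).re * dd (1, 0) ξ x with hp
  set q : V2 → ℝ := fun x => -(1 - ξ x) * (F (zc y x)).im - (Ξ (zc y x)).re * dd (0, 1) ξ x
    with hq
  set u : V2 → ℝ := fun x => (1 - ξ x) * (F (zc y x)).re - (Ξ (zc y x)).im * dd (0, 1) ξ x with hu
  set v' : V2 → ℝ := fun x => (1 - ξ x) * (F (zc y x)).im - (Ξ (zc y x)).im * dd (1, 0) ξ x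
    with hv
  have loc : ∀ x, ∃ φ σ : V2 → ℝ, (ContDiffAt ℝ (⊤ : ℕ∞) φ x ∧ ContDiffAt ℝ (⊤ : ℕ∞) σ x) ∧
      ∀ᶠ z in nhds x, (p z = dd (1, 0) φ z ∧ q z = dd (0, 1) φ z) ∧
        (v' z = dd (1, 0) σ z ∧ u z = dd (0, 1) σ z) := fun x => by
    by_cases hx : zc y x ∈ punct
    · have cz := (zc_contDiff y).continuous
      obtain ⟨Θ, h1, h2⟩ : ∃ Θ : ℂ → ℂ, (∀ᶠ w in nhds (zc y x), HasDerivAt Θ (F w) w) ∧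
          ∀ᶠ z in nhds x, Ξ (zc y z) = Θ (zc y z) ∨ ξ z = 0 := by
        rcases ξ0 x with ⟨m, n, h, -⟩ | h
        · refine ⟨Ξ, ?_, Filter.Eventually.of_forall fun z => Or.inl rfl⟩
          have op : IsOpen {z : ℂ | ‖z - (m + n * Complex.I)‖ < 1 / 2} :=
            isOpen_lt (by fun_prop) continuous_const
          filter_upwards [op.mem_nhds h, punct_open.mem_nhds hx] with w hw hw'
          exact hΞ w m n hw' hw
        · obtain ⟨ε, hε, hb⟩ := Metric.isOpen_iff.1 punct_open _ hx
          obtain ⟨Θ, hΘ⟩ := (hF.mono hb).isExactOn_ball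
          exact ⟨Θ, Filter.eventually_of_mem (Metric.ball_mem_nhds _ hε) hΘ,
            h.mono fun z hz => Or.inr hz⟩
      refine ⟨_, _, contDiffAt_cutoff_potential sξ (h1.mono fun w hw => hw.differentiableAt), ?_⟩
      filter_upwards [h2, cz.continuousAt.eventually h1] with z hz hz1
      obtain ⟨e1, e2, e3, e4⟩ := dd_cutoff_potential dξ hz1
      rw [e1, e2, e3, e4]
      rcases hz with hz | hz
      · simp only [hp, hq, hu, hv, hz, and_self]
      · simp only [hp, hq, hu, hv, dz _ z hz, mul_zero, and_self]
    · refine ⟨fun _ => 0, fun _ => 0, ⟨contDiffAt_const, contDiffAt_const⟩, ?_⟩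
      filter_upwards [(ξ1 x hx).eventually_nhds] with z hz
      have d0 : ∀ w, dd w ξ z = 0 := fun w => by
        have e : ξ =ᶠ[nhds z] fun _ => 1 := hz
        simp [dd, e.fderiv_eq]
      have h1 : ξ z = 1 := hz.self_of_nhds
      have e0 : ∀ w : V2, dd w (fun _ : V2 => (0 : ℝ)) z = 0 := fun w => by simp [dd]
      simp [hp, hq, hu, hv, d0, h1, e0]
  obtain ⟨sp, sq, curl⟩ := local_gradient (p := p) (q := q) fun x => by
    obtain ⟨φ, σ, h, h'⟩ := loc x
    exact ⟨φ, h.1, h'.mono fun z hz => hz.1⟩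
  obtain ⟨sv, su, div⟩ := local_gradient (p := v') (q := u) fun x => by
    obtain ⟨φ, σ, h, h'⟩ := loc x
    exact ⟨σ, h.2, h'.mono fun z hz => hz.2⟩
  have pp : Zper p := fun x m n => by
    simp only [hp]; rw [pξ, pdξ, zc_per, perF, perΞ]
  have pq : Zper q := fun x m n => by
    simp only [hq]; rw [pξ, pdξ, zc_per, perF, perΞ]
  have pu : Zper u := fun x m n => by
    simp only [hu]; rw [pξ, pdξ, zc_per, perF, perΞ]
  have pv : Zper v' := fun x m n => by
    simp only [hv]; rw [pξ, pdξ, zc_per, perF, perΞ]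
  have div' : ∀ x, dd (1, 0) u x + dd (0, 1) (fun x => -v' x) x = 0 := fun x => by
    rw [dd_neg, div x]; ring
  have flux := integral_eq_flux su sv.neg pu (fun x m n => by simp only [pv x m n]) div'
  have far : ∀ x : V2, (∃ k : ℤ, x.1 - y.1 = 1 / 2 + k) ∨ (∃ k : ℤ, x.2 - y.2 = 1 / 2 + k) →
      ∀ m n : ℤ, ρ ≤ dist x (y.1 + m, y.2 + n) := fun x hx m n => by
    have half : ∀ k m : ℤ, ∀ t : ℝ, t = 1 / 2 + k → 1 / 2 ≤ |t - m| := fun k m t ht => by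
      subst ht
      rcases le_or_gt m k with h | h
      · have : (m : ℝ) ≤ k := by exact_mod_cast h
        exact le_trans (by linarith) (le_abs_self _)
      · have : (k : ℝ) + 1 ≤ m := by exact_mod_cast h
        exact le_trans (by linarith) (neg_le_abs _)
    rw [Prod.dist_eq, Real.dist_eq, Real.dist_eq, ← sub_sub, ← sub_sub]
    rcases hx with ⟨k, hk⟩ | ⟨k, hk⟩
    · exact le_max_of_le_left (hρ'.trans (half k m _ hk))
    · exact le_max_of_le_right (hρ'.trans (half k n _ hk))
  have val : ∀ x, ξ x = 0 → p x = (F (zc y x)).re ∧ q x = -(F (zc y x)).im ∧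
      u x = (F (zc y x)).re ∧ v' x = (F (zc y x)).im := fun x hx => by
    simp [hp, hq, hu, hv, dz _ x hx, hx]
  refine ⟨p, q, u, fun x => -v' x, sp, sq, su, sv.neg, pp, pq, pu,
    fun x m n => by simp only [pv x m n], curl, div', ?_, ?_, fun x hx => ?_, ?_⟩
  · rw [flux.1 (y.1 + 1 / 2)]
    have e : ∀ t : ℝ, u (y.1 + 1 / 2, t) = (F (vline (t - y.2))).re := fun t => by
      rw [← zc_vline]
      exact (val _ (off _ (far _ (Or.inl ⟨0, by simp⟩))).self_of_nhds).2.2.1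
    simp only [e]
    have c : Continuous fun t : ℝ => F (vline (t - y.2)) :=
      hF.continuousOn.comp_continuous (vline_continuous.comp (by fun_prop)) fun t => vline_mem _
    have := Complex.reCLM.intervalIntegral_comp_comm (c.intervalIntegrable (μ := volume) 0 1)
    simp only [Complex.reCLM_apply] at this
    rw [this, intervalIntegral_shift_periodic (f := fun t => F (vline t)), Fv]
    intro t
    have : vline (t + 1) = vline t + ((0 : ℤ) + (1 : ℤ) * Complex.I) := by
      simp only [vline]; push_cast; ring
    beta_reduce
    rw [this, perF]
  · rw [flux.2 (y.2 + 1 / 2)]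
    have e : ∀ t : ℝ, v' (t, y.2 + 1 / 2) = (F (hline (t - y.1))).im := fun t => by
      rw [← zc_hline]
      exact (val _ (off _ (far _ (Or.inr ⟨0, by simp⟩))).self_of_nhds).2.2.2
    simp only [e, intervalIntegral.integral_neg]
    have c : Continuous fun t : ℝ => F (hline (t - y.1)) :=
      hF.continuousOn.comp_continuous (hline_continuous.comp (by fun_prop)) fun t => hline_mem _
    have := Complex.imCLM.intervalIntegral_comp_comm (c.intervalIntegrable (μ := volume) 0 1)
    simp only [Complex.imCLM_apply] at this
    rw [this, intervalIntegral_shift_periodic (f := fun t => F (hline t)), Fh, neg_zero]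
    intro t
    have : hline (t + 1) = hline t + ((1 : ℤ) + (0 : ℤ) * Complex.I) := by
      simp only [hline]; push_cast; ring
    beta_reduce
    rw [this, perF]
  · obtain ⟨a, b, c, d⟩ := val x (off x hx).self_of_nhds
    beta_reduce
    rw [a, b, c, d]
    exact ⟨rfl, rfl⟩
  · set h : V2 → ℝ := fun x => ‖(p x, q x)‖ + ξ x with hh
    have ch : Continuous h :=
      ((sp.continuous.prodMk sq.continuous).norm).add sξ.continuous
    have h0 : ∀ x, 0 < h x := fun x => by
      rcases (nξ x).eq_or_lt with h1 | h1
      · obtain ⟨a, b, -, -⟩ := val x h1.symm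
        have : (p x, q x) ≠ 0 := fun h2 => by
          rw [Prod.mk_eq_zero, a, b, neg_eq_zero] at h2
          exact F0 _ (Complex.ext h2.1 h2.2)
        have := norm_pos_iff.2 this
        simp only [hh]
        linarith
      · have := norm_nonneg (p x, q x)
        simp only [hh]
        linarith
    obtain ⟨M, M0, hM⟩ := Zper.bounded (u := fun x => (h x)⁻¹)
      (ch.inv₀ fun x => (h0 x).ne') fun x m n => by simp only [hh, pp x m n, pq x m n, pξ x m n]
    refine ⟨(M + 1)⁻¹, by positivity, fun x hx => ?_⟩
    have h1 := hM x
    rw [Real.norm_of_nonneg (inv_nonneg.2 (h0 x).le)] at h1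
    have h2 : h x = ‖(p x, q x)‖ := by simp only [hh, (off x hx).self_of_nhds, add_zero]
    rw [← h2]
    exact inv_le_of_inv_le₀ (h0 x) (h1.trans (by linarith))

/-! ### The reference solution -/

lemma dd_ofReal {f : V2 → ℝ} (hf : Differentiable ℝ f) (w x : V2) :
    dd w (fun x => (f x : ℂ)) x = (dd w f x : ℝ) := by
  have h : HasFDerivAt (fun x => (f x : ℂ)) (Complex.ofRealCLM.comp (fderiv ℝ f x)) x :=
    Complex.ofRealCLM.hasFDerivAt.comp x (hf x).hasFDerivAt
  simp [dd, h.fderiv]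

lemma FT_ofReal_zero (f : V2 → ℝ) : FT (fun x => (f x : ℂ)) 0 = (∫ x in unitSq, f x : ℝ) := by
  simp only [FT, neg_zero, ch_zero, mul_one]
  exact integral_ofReal

/-- A field program accelerating all the particles to a speed larger than `4` inside of `ω`. -/
theorem exists_program_of_GCC {c : ℝ} (hc : 0 < c) {ω : Set V2} (ho : IsOpen ω)
    (hp : Zper fun x => x ∈ ω) (hG : GCC ω) :
    ∃ (K : Set V2) (T₁ η : ℝ) (E₁ E₂ b : ℝ × V2 → ℝ), IsClosed K ∧ K ⊆ ω ∧ 0 < T₁ ∧ 0 < η ∧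
      Adm c K E₁ E₂ b ∧
      (∀ t x, t ≤ η ∨ T₁ - η ≤ t → E₁ (t, x) = 0 ∧ E₂ (t, x) = 0 ∧ b (t, x) = 0) ∧
      ∀ X V, SolvesOn c E₁ E₂ b X V 0 T₁ → ∃ t ∈ Set.Icc 0 T₁, X t ∈ ω ∧ 4 ≤ en (V t) := by
  obtain ⟨r, hr, L, hL, hu⟩ := GCC_uniform ho hp hG
  obtain ⟨χ, sχ, pχ, nχ, χ1, χ0⟩ := exists_cutoff hp hr
  obtain ⟨s, -, -, hy⟩ := hu 0 (1, 0) (by simp [en])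
  set y : V2 := 0 + s • (1, 0) with hy'
  have near : ∀ x, x ∉ core ω (3 / 2 * r) → ∀ m n : ℤ,
      min r (1 / 2) ≤ dist x (y.1 + m, y.2 + n) := fun x hx m n => by
    by_contra h
    have h1 : (y.1 + (m : ℝ), y.2 + (n : ℝ)) ∈ core ω (3 * r) := by
      have := core_per hp (3 * r) y m n
      simp only at this
      rw [this]; exact hy
    refine hx (core_move h1 ?_)
    rw [dist_comm]
    have := (not_le.1 h).le.trans (min_le_left _ _)
    linarith
  have hK : ∀ x, x ∉ core ω (r / 2) → x ∉ core ω (3 / 2 * r) := fun x hx h =>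
    hx (core_anti (by linarith) h)
  obtain ⟨p, q, u, v, sp, sq, su, sv, pp, pq, pu, pv, curl, div, mu, mv, eq, p₀, hp₀, low⟩ :=
    exists_static y (lt_min hr (by norm_num : (0 : ℝ) < 1 / 2)) (min_le_right _ _)
  have cast : ∀ f : V2 → ℝ, ContDiff ℝ (⊤ : ℕ∞) f → ContDiff ℝ (⊤ : ℕ∞) fun x => (f x : ℂ) :=
    fun f hf => Complex.ofRealCLM.contDiff.comp hf
  have castp : ∀ f : V2 → ℝ, Zper f → Zper fun x => (f x : ℂ) := fun f hf x m n => by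
    simp only [hf x m n]
  have su' : ContDiff ℝ (⊤ : ℕ∞) fun x => u x - p x := su.sub sp
  have sv' : ContDiff ℝ (⊤ : ℕ∞) fun x => v x - q x := sv.sub sq
  have int : ∀ f : V2 → ℝ, ContDiff ℝ (⊤ : ℕ∞) f → IntegrableOn f unitSq := fun f hf =>
    hf.continuous.continuousOn.integrableOn_compact unitSq_compact
  obtain ⟨τ, hτ, e₁, e₂, b, adm, hz, hI⟩ := exists_pulse hc sχ pχ nχ (L := L)
    (fun x e he => by
      obtain ⟨s, h0, h1, h2⟩ := hu x e he
      exact ⟨s, h0, h1, zero_lt_one.trans_le (χ1 _ (core_anti (by linarith) h2))⟩)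
    (core_closed ω (r / 2)) χ0
    (W₁ := fun x => ((u x - p x : ℝ) : ℂ)) (W₂ := fun x => ((v x - q x : ℝ) : ℂ))
    (P₁ := fun x => (p x : ℂ)) (P₂ := fun x => (q x : ℂ))
    (cast _ su') (cast _ sv')
    (castp _ fun x m n => by simp only [pu x m n, pp x m n])
    (castp _ fun x m n => by simp only [pv x m n, pq x m n])
    (fun x hx => by rw [(eq x (near x (hK x hx))).1, sub_self, Complex.ofReal_zero])
    (fun x hx => by rw [(eq x (near x (hK x hx))).2, sub_self, Complex.ofReal_zero])
    (cast _ sp) (cast _ sq) (castp _ pp) (castp _ pq)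
    (fun x => by
      rw [dd_ofReal sq.differentiable_top, dd_ofReal sp.differentiable_top, curl, sub_self])
    (fun x => by
      rw [dd_ofReal sq.differentiable_top, dd_ofReal sp.differentiable_top,
        dd_ofReal su'.differentiable_top, dd_ofReal sv'.differentiable_top,
        dd_sub su.differentiable_top sp.differentiable_top,
        dd_sub sv.differentiable_top sq.differentiable_top]
      have := congrArg (fun t : ℝ => (t : ℂ)) (div x)
      push_cast at this ⊢
      linear_combination this)
    (by
      rw [FT_ofReal_zero, FT_ofReal_zero, integral_sub (int _ su) (int _ sp), mu]
      push_cast; ring)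
    (by
      rw [FT_ofReal_zero, FT_ofReal_zero, integral_sub (int _ sv) (int _ sq), mv]
      push_cast; ring)
  obtain ⟨T₁, η, E₁, E₂, b', h⟩ := exists_program hc (core_closed ω (r / 2)) hr hL hu sχ pχ χ1 χ0
    adm hτ hz hp₀ fun x hx => by
      rw [(hI x).1, (hI x).2, Complex.ofReal_re, Complex.ofReal_re]
      exact low x (near x hx)
  exact ⟨core ω (r / 2), T₁, η, E₁, E₂, b', core_closed _ _, core_subset (by linarith), h⟩

/-- **Existence of a reference solution for the return method, under the geometric
control condition** (Proposition on the reference solution, GCC case). -/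
theorem reference_solution_GCC
    (c : ℝ) (hc : 0 < c)
    (ω ω' : Set V2) (hωopen : IsOpen ω) (hωper : Zper fun x => x ∈ ω) (hGCC : GCC ω)
    (hω'open : IsOpen ω') (hω'per : Zper fun x => x ∈ ω') (hGCC' : GCC ω')
    (hω'sub : closure ω' ⊆ ω) :
    ∃ T₀ > (0 : ℝ), ∀ T ≥ T₀,
      ∃ (F : ℝ × V2 × V2 → ℝ) (E : ℝ × V2 → V2) (b : ℝ × V2 → ℝ)
        (G : ℝ × V2 × V2 → ℝ),
        -- smoothness of the reference solution and of its source
        ContDiff ℝ (⊤ : ℕ∞) F ∧ ContDiff ℝ (⊤ : ℕ∞) E ∧ ContDiff ℝ (⊤ : ℕ∞) b ∧ ContDiff ℝ (⊤ : ℕ∞) G ∧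
        -- the source is spatially supported in ω
        (∀ t x v, x ∉ ω → G (t, x, v) = 0) ∧
        -- it solves the 2D relativistic Vlasov–Maxwell system with source G
        IsVMSolution c T F E b G ∧
        -- (i) it starts from 0 and comes back to 0
        (∀ x v, F (0, x, v) = 0) ∧ (∀ x, E (0, x) = 0) ∧ (∀ x, b (0, x) = 0) ∧
        (∀ x v, F (T, x, v) = 0) ∧ (∀ x, E (T, x) = 0) ∧ (∀ x, b (T, x) = 0) ∧
        -- (ii) the distribution function is supported in ω in the space variable
        (∀ t ∈ Set.Icc (0 : ℝ) T, ∀ v : V2, ∀ x, x ∉ ω → F (t, x, v) = 0) ∧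
        -- (iii) all characteristics of Ē + c⁻¹ v̂⊥ b̄ visit ω' with large velocity
        (∀ x v : V2, ∀ X V : ℝ → V2,
          IsRelChar c
            (fun t y w => E (t, y) + (c⁻¹ * b (t, y)) • pperp (vhat c w)) 0 x v X V →
          ∃ t ∈ Set.Icc (T / 9) (8 * T / 9), X t ∈ ω' ∧ 4 ≤ en (V t)) := by
  obtain ⟨K, T₁, η, E₁, E₂, b, hK, Kω, hT₁, hη, adm, hz, hchar⟩ :=
    exists_program_of_GCC hc hω'open hω'per hGCC'
  refine ⟨9 * T₁ / 7, by positivity, fun T hT => ?_⟩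
  have hT0 : 0 < T := lt_of_lt_of_le (by positivity) hT
  have hT7 : T / 9 + T₁ ≤ 8 * T / 9 := by linarith
  have ad := adm.shift (T / 9)
  obtain ⟨F, G, sF, sG, kF, kG, sol, van⟩ := assembly hK ad
  have out : ∀ x, x ∉ ω → x ∉ K := fun x hx h => hx (hω'sub (subset_closure (Kω h)))
  have hz0 : ∀ᶠ s in nhds (0 : ℝ), ∀ x, tsh (T / 9) E₁ (s, x) = 0 ∧ tsh (T / 9) E₂ (s, x) = 0 ∧
      tsh (T / 9) b (s, x) = 0 := by
    filter_upwards [eventually_lt_nhds (by positivity : (0 : ℝ) < T / 9)] with s hs x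
    simp only [tsh_apply]
    exact hz _ x (Or.inl (by linarith))
  have hz1 : ∀ᶠ s in nhds T, ∀ x, tsh (T / 9) E₁ (s, x) = 0 ∧ tsh (T / 9) E₂ (s, x) = 0 ∧
      tsh (T / 9) b (s, x) = 0 := by
    filter_upwards [eventually_gt_nhds (by linarith : 8 * T / 9 < T)] with s hs x
    simp only [tsh_apply]
    exact hz _ x (Or.inr (by linarith))
  refine ⟨F, fun p => (tsh (T / 9) E₁ p, tsh (T / 9) E₂ p), tsh (T / 9) b, G, sF,
    ad.s1.prodMk ad.s2, ad.s3, sG, fun t x v hx => kG t x v (out x hx), sol T,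
    van 0 hz0, fun x => ?_, fun x => (hz0.self_of_nhds x).2.2, van T hz1, fun x => ?_,
    fun x => (hz1.self_of_nhds x).2.2, fun t _ v x hx => kF t x v (out x hx), ?_⟩
  · exact Prod.ext (hz0.self_of_nhds x).1 (hz0.self_of_nhds x).2.1
  · exact Prod.ext (hz1.self_of_nhds x).1 (hz1.self_of_nhds x).2.1
  · rintro x v X V ⟨-, -, hXV⟩
    obtain ⟨t, ht, h1, h2⟩ := hchar (fun t => X (t + T / 9)) (fun t => V (t + T / 9))
      fun t _ => by
        have hd := hXV (t + T / 9)
        simp only [tsh_apply, add_sub_cancel_right] at hd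
        exact ⟨hd.1.comp_add_const t (T / 9), hd.2.comp_add_const t (T / 9)⟩
    exact ⟨t + T / 9, ⟨by linarith [ht.1], by linarith [ht.2]⟩, h1, h2⟩

end
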